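/- Let 0 < s < 1, ε > 0 and C₀ > 0. There exist δ > 0 depending only on s and C₀, and C > 0 depending only on s, ε and C₀, such that: for every N ≥ 2, every admissible high symbol θ (with parameters N, s) with associated multiplier D, every smooth Schwartz solution u of the focusing cubic NLS, and every t₀ ∈ ℝ with ‖D u(·,t₀)‖_{L²}² ≤ C₀, one has |‖D u(·,t₀+δ)‖_{L²}² − ‖D u(·,t₀)‖_{L²}²| ≤ C N^{−1/2+ε}. -/

import Mathlib

open MeasureTheory Real

noncomputable section

/-- The Fourier transform on `ℝ`: `f̂(ξ) = ∫ e^{-ixξ} f(x) dx`. -/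
def ft (f : ℝ → ℂ) (ξ : ℝ) : ℂ := ∫ x : ℝ, Complex.exp (-Complex.I * x * ξ) * f x

/-- The Japanese bracket `⟨ξ⟩ = 1 + |ξ|`. -/
def jap (ξ : ℝ) : ℝ := 1 + |ξ|

/-- The Sobolev norm `‖f‖_{H^s} = (∫ ⟨ξ⟩^{2s} |f̂(ξ)|² dξ)^{1/2}`. -/
def HsNorm (s : ℝ) (f : ℝ → ℂ) : ℝ :=
  (∫ ξ : ℝ, jap ξ ^ (2 * s) * ‖ft f ξ‖ ^ 2) ^ ((1 : ℝ) / 2)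

/-- The squared `L²` norm. -/
def L2sq (f : ℝ → ℂ) : ℝ := ∫ x : ℝ, ‖f x‖ ^ 2

/-- The spacetime Fourier transform (x first variable, t second). -/
def stft (u : ℝ → ℝ → ℂ) (ξ τ : ℝ) : ℂ :=
  ∫ t : ℝ, ∫ x : ℝ, Complex.exp (-Complex.I * (x * ξ + t * τ)) * u x t

/-- The `X^{s,b}` norm. -/
def XsbNorm (s b : ℝ) (u : ℝ → ℝ → ℂ) : ℝ :=
  (∫ ξ : ℝ, ∫ τ : ℝ,
    jap ξ ^ (2 * s) * jap (τ - ξ ^ 2) ^ (2 * b) * ‖stft u ξ τ‖ ^ 2) ^ ((1 : ℝ) / 2)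

/-- The Fourier multiplier with symbol `θ`: `(mult θ f)̂(ξ) = θ(ξ) f̂(ξ)`. -/
def mult (θ : ℝ → ℝ) (f : ℝ → ℂ) (x : ℝ) : ℂ :=
  (2 * π)⁻¹ • ∫ ξ : ℝ, Complex.exp (Complex.I * x * ξ) * (θ ξ : ℂ) * ft f ξ

/-- The multiplier applied in the `x`-variable of a spacetime function. -/
def multX (θ : ℝ → ℝ) (u : ℝ → ℝ → ℂ) (x t : ℝ) : ℂ := mult θ (fun y => u y t) x

/-- The cubic nonlinearity `F(z) = |z|² z`. -/
def Fnl (z : ℂ) : ℂ := (‖z‖ : ℂ) ^ 2 * z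

/-- The real inner product `⟨f,g⟩ = Re ∫ f ḡ`. -/
def rip (f g : ℝ → ℂ) : ℝ := (∫ x : ℝ, f x * (starRingEnd ℂ) (g x)).re

/-- The Lyapunov functional `L(u) = ∫ |∂ₓu|² + |u|² - ½|u|⁴`. -/
def Lfun (f : ℝ → ℂ) : ℝ :=
  ∫ x : ℝ, (‖deriv f x‖ ^ 2 + ‖f x‖ ^ 2
    - (1 / 2) * ‖f x‖ ^ 4)

/-- The Lyapunov functional with the `H¹`-part expressed on the Fourier side
(Plancherel form), suitable for `H¹` functions. -/
def LfunH1 (f : ℝ → ℂ) : ℝ :=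
  (2 * π)⁻¹ * (∫ ξ : ℝ, (ξ ^ 2 + 1) * ‖ft f ξ‖ ^ 2)
    - (1 / 2) * ∫ x : ℝ, ‖f x‖ ^ 4

/-- Membership in `H¹(ℝ)`. -/
def MemH1 (f : ℝ → ℂ) : Prop :=
  MemLp f 2 (volume : Measure ℝ) ∧
    Integrable (fun ξ : ℝ => jap ξ ^ (2 : ℝ) * ‖ft f ξ‖ ^ 2)

/-- The ground state `Q(x) = 2^{-1/2} / cosh x`. -/
def Qgs (x : ℝ) : ℝ := (Real.sqrt 2)⁻¹ / Real.cosh x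

/-- A point `e^{iα} Q(· - x₀)` of the ground state cylinder. -/
def Qcyl (α x₀ : ℝ) (x : ℝ) : ℂ := Complex.exp (Complex.I * α) * (Qgs (x - x₀) : ℂ)

/-- The ground state cylinder `Σ`. -/
def groundCyl : Set (ℝ → ℂ) := { f | ∃ α x₀ : ℝ, f = Qcyl α x₀ }

/-- `dist_{H^s}(f, Σ)`. -/
def distHs (s : ℝ) (f : ℝ → ℂ) : ℝ :=
  ⨅ v ∈ groundCyl, HsNorm s (fun x => f x - v x)

/-- A smooth function `u(x,t)` all of whose `x`-derivatives are rapidly decreasing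
in `x`, locally uniformly in `t`. -/
structure IsSchwartzInX (u : ℝ → ℝ → ℂ) : Prop where
  smooth : ContDiff ℝ (⊤ : ℕ∞) (fun p : ℝ × ℝ => u p.1 p.2)
  decay : ∀ (k n : ℕ) (T : ℝ), 0 < T → ∃ C : ℝ, ∀ x t : ℝ, |t| ≤ T →
    |x| ^ k * ‖iteratedDeriv n (fun y => u y t) x‖ ≤ C

/-- A smooth Schwartz solution of the focusing cubic NLS `iu_t + u_xx = -|u|²u`. -/
structure IsSchwartzSolution (u : ℝ → ℝ → ℂ) extends IsSchwartzInX u : Prop where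
  eqn : ∀ x t : ℝ, Complex.I * deriv (fun τ => u x τ) t
      + iteratedDeriv 2 (fun y => u y t) x
      = -((‖u x t‖ : ℂ) ^ 2 * u x t)

/-- A Schwartz function on spacetime. -/
def IsSchwartz2 (u : ℝ → ℝ → ℂ) : Prop :=
  ∃ g : SchwartzMap (ℝ × ℝ) ℂ, ∀ x t : ℝ, u x t = g (x, t)

/-- An admissible high symbol `θ` with parameters `N`, `s`. -/
structure AdmissibleHigh (N s : ℝ) (θ : ℝ → ℝ) : Prop where
  smooth : ContDiff ℝ (⊤ : ℕ∞) θ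
  even : ∀ ξ : ℝ, θ (-ξ) = θ ξ
  eq_one : ∀ ξ : ℝ, |ξ| ≤ N → θ ξ = 1
  eq_high : ∀ ξ : ℝ, 2 * N ≤ |ξ| → θ ξ = |ξ| ^ s * N ^ (-s)
  mono : ∀ ξ η : ℝ, |ξ| ≤ |η| → θ ξ ≤ θ η
  deriv1 : ∀ ξ : ℝ, |deriv (fun ζ => θ ζ ^ 2) ξ| ≤ 10 * θ ξ ^ 2 / jap ξ
  deriv2 : ∀ ξ : ℝ, |iteratedDeriv 2 (fun ζ => θ ζ ^ 2) ξ| ≤ 10 * θ ξ ^ 2 / jap ξ ^ 2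

/-- An admissible low symbol `m` with parameters `N`, `s`. -/
structure AdmissibleLow (N s : ℝ) (m : ℝ → ℝ) : Prop where
  smooth : ContDiff ℝ (⊤ : ℕ∞) m
  even : ∀ ξ : ℝ, m (-ξ) = m ξ
  eq_one : ∀ ξ : ℝ, |ξ| ≤ N → m ξ = 1
  eq_high : ∀ ξ : ℝ, 2 * N ≤ |ξ| → m ξ = |ξ| ^ (s - 1) * N ^ (1 - s)
  anti : ∀ ξ η : ℝ, |ξ| ≤ |η| → m η ≤ m ξ
  mono : ∀ ξ η : ℝ, |ξ| ≤ |η| → m ξ * jap ξ ≤ m η * jap η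
  deriv1 : ∀ ξ : ℝ, |deriv m ξ| ≤ 10 * m ξ / jap ξ
  deriv2 : ∀ ξ : ℝ, |iteratedDeriv 2 m ξ| ≤ 10 * m ξ / jap ξ ^ 2

/-- The multilinear form `Λ₄` on the hyperplane `ξ₁+ξ₂+ξ₃+ξ₄ = 0`. -/
def Lam4 (M : ℝ → ℝ → ℝ → ℝ → ℝ) (f₁ f₂ f₃ f₄ : ℝ → ℂ) : ℂ :=
  ∫ ξ₁ : ℝ, ∫ ξ₂ : ℝ, ∫ ξ₃ : ℝ,
    (M ξ₁ ξ₂ ξ₃ (-(ξ₁ + ξ₂ + ξ₃)) : ℂ) * ft f₁ ξ₁ * ft f₂ ξ₂ * ft f₃ ξ₃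
      * ft f₄ (-(ξ₁ + ξ₂ + ξ₃))

/-- The multilinear form `Λ₆` on the hyperplane `ξ₁+⋯+ξ₆ = 0`. -/
def Lam6 (M : ℝ → ℝ → ℝ → ℝ → ℝ → ℝ → ℝ) (f₁ f₂ f₃ f₄ f₅ f₆ : ℝ → ℂ) : ℂ :=
  ∫ ξ₁ : ℝ, ∫ ξ₂ : ℝ, ∫ ξ₃ : ℝ, ∫ ξ₄ : ℝ, ∫ ξ₅ : ℝ,
    (M ξ₁ ξ₂ ξ₃ ξ₄ ξ₅ (-(ξ₁ + ξ₂ + ξ₃ + ξ₄ + ξ₅)) : ℂ) * ft f₁ ξ₁ * ft f₂ ξ₂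
      * ft f₃ ξ₃ * ft f₄ ξ₄ * ft f₅ ξ₅ * ft f₆ (-(ξ₁ + ξ₂ + ξ₃ + ξ₄ + ξ₅))

/-- The complex conjugate of a function. -/
def cj (f : ℝ → ℂ) : ℝ → ℂ := fun x => (starRingEnd ℂ) (f x)

open scoped FourierTransform ENNReal SchwartzMap Convolution

lemma fourier_toLp_ae_eq {f : ℝ → ℂ} (hf : Integrable f) (hf2 : MemLp f 2) :
    (𝓕 (hf2.toLp f) : Lp ℂ 2 (volume : Measure ℝ)) =ᵐ[volume] 𝓕 f := by
  refine ae_eq_of_integral_contDiff_smul_eq ?_ ?_ ?_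
  · exact (Lp.memLp _).locallyIntegrable (by norm_num)
  · refine Continuous.locallyIntegrable ?_
    exact VectorFourier.fourierIntegral_continuous Real.continuous_fourierChar
      (by fun_prop) hf
  · intro φ hφ hc
    have hφ' : ContDiff ℝ (⊤ : ℕ∞) (fun x => (φ x : ℂ)) :=
      Complex.ofRealCLM.contDiff.comp hφ
    have hc' : HasCompactSupport (fun x => (φ x : ℂ)) :=
      hc.comp_left (g := fun x : ℝ => (x : ℂ)) (by simp)
    set ψ : 𝓢(ℝ, ℂ) := hc'.toSchwartzMap hφ' with hψ
    have hψa : ∀ x, ψ x = (φ x : ℂ) := fun x => rfl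
    have h1 := congrArg (fun T => T ψ) (Lp.fourier_toTemperedDistribution_eq (hf2.toLp f))
    simp only [TemperedDistribution.fourier_apply, Lp.toTemperedDistribution_apply] at h1
    have h2 : ∫ x, φ x • (𝓕 (hf2.toLp f) : Lp ℂ 2 (volume : Measure ℝ)) x
        = ∫ x, ψ x • (𝓕 (hf2.toLp f) : Lp ℂ 2 (volume : Measure ℝ)) x := by
      simp [hψa]
    rw [h2, ← h1]
    have h3 : ∫ x, (𝓕 ψ) x • (hf2.toLp f) x = ∫ x, (𝓕 ψ) x • f x := by
      refine integral_congr_ae ?_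
      filter_upwards [hf2.coeFn_toLp] with x hx
      rw [hx]
    rw [h3]
    have h4 := VectorFourier.integral_fourierIntegral_smul_eq_flip (μ := volume) (ν := volume)
      (L := innerₗ ℝ) (f := ψ) (g := f) Real.continuous_fourierChar (by fun_prop) ψ.integrable hf
    have h5 : ∀ g : ℝ → ℂ, VectorFourier.fourierIntegral 𝐞 volume (innerₗ ℝ) g = 𝓕 g :=
      fun g => rfl
    rw [flip_innerₗ] at h4
    rw [h5, h5] at h4
    rw [SchwartzMap.fourier_coe, h4]
    simp [hψa]

lemma lintegral_fourier_sq {f : ℝ → ℂ} (hf : Integrable f) (hf2 : MemLp f 2) :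
    ∫⁻ x, ‖𝓕 f x‖ₑ ^ (2 : ℕ) = ∫⁻ x, ‖f x‖ₑ ^ (2 : ℕ) := by
  have key : ∀ g : ℝ → ℂ, ∫⁻ x, ‖g x‖ₑ ^ (2 : ℕ) = eLpNorm g 2 volume ^ (2 : ℕ) := by
    intro g
    have := eLpNorm_nnreal_pow_eq_lintegral (μ := volume) (f := g) (p := 2) (by norm_num)
    simpa using this.symm
  rw [key, key]
  congr 1
  have h := Lp.norm_fourier_eq (hf2.toLp f)
  rw [Lp.norm_def, Lp.norm_def, ENNReal.toReal_eq_toReal_iff' (Lp.eLpNorm_ne_top _)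
    (Lp.eLpNorm_ne_top _), eLpNorm_congr_ae (fourier_toLp_ae_eq hf hf2),
    eLpNorm_congr_ae hf2.coeFn_toLp] at h
  exact h

lemma lintegral_fourier_sq_le (f : ℝ → ℂ) (hf : AEStronglyMeasurable f volume) :
    ∫⁻ x, ‖𝓕 f x‖ₑ ^ (2 : ℕ) ≤ ∫⁻ x, ‖f x‖ₑ ^ (2 : ℕ) := by
  by_cases hi : Integrable f
  · by_cases h2 : MemLp f 2
    · exact (lintegral_fourier_sq hi h2).le
    · have : eLpNorm f 2 volume = ⊤ := by
        by_contra h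
        exact h2 ⟨hf, lt_top_iff_ne_top.2 h⟩
      have h3 := eLpNorm_nnreal_pow_eq_lintegral (μ := volume) (f := f) (p := 2) (by norm_num)
      simp only [ENNReal.coe_ofNat, this, NNReal.coe_ofNat, ENNReal.rpow_ofNat] at h3
      rw [← h3]
      simp
  · have : ∀ x, 𝓕 f x = 0 := by
      intro x
      rw [Real.fourier_eq]
      exact integral_undef fun h => hi ((Real.fourierIntegral_convergent_iff x).1 h)
    simp [this]

lemma lintegral_fourierInv_sq {f : ℝ → ℂ} (hf : Integrable f) (hf2 : MemLp f 2) :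
    ∫⁻ x, ‖𝓕⁻ f x‖ₑ ^ (2 : ℕ) = ∫⁻ x, ‖f x‖ₑ ^ (2 : ℕ) := by
  simp_rw [Real.fourierInv_eq_fourier_neg]
  rw [lintegral_neg_eq_self (f := fun x => ‖𝓕 f x‖ₑ ^ (2 : ℕ)), lintegral_fourier_sq hf hf2]

lemma lintegral_fourierInv_sq_le (f : ℝ → ℂ) (hf : AEStronglyMeasurable f volume) :
    ∫⁻ x, ‖𝓕⁻ f x‖ₑ ^ (2 : ℕ) ≤ ∫⁻ x, ‖f x‖ₑ ^ (2 : ℕ) := by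
  simp_rw [Real.fourierInv_eq_fourier_neg]
  rw [lintegral_neg_eq_self (f := fun x => ‖𝓕 f x‖ₑ ^ (2 : ℕ))]
  exact lintegral_fourier_sq_le f hf

lemma lintegral_comp_mul_left_real (f : ℝ → ℝ≥0∞) {c : ℝ} (hc : 0 < c) :
    ∫⁻ x, f (c * x) = ENNReal.ofReal c⁻¹ * ∫⁻ x, f x := by
  have h := (MeasurableEquiv.mulLeft₀ c hc.ne').measurableEmbedding.lintegral_map
    (μ := volume) f
  simp only [MeasurableEquiv.coe_mulLeft₀] at h
  rw [← h, Real.map_volume_mul_left hc.ne', lintegral_smul_measure, abs_of_pos (inv_pos.2 hc),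
    smul_eq_mul]

/-- Polar coordinates with the squared radius as a coordinate. -/
def sqPolar (q : ℝ × ℝ) : ℝ × ℝ := (√q.1 * cos q.2, √q.1 * sin q.2)

lemma measurable_sqPolar : Measurable sqPolar := by
  unfold sqPolar; fun_prop

lemma lintegral_sq_Ioi (h : ℝ → ℝ≥0∞) :
    ∫⁻ r in Set.Ioi (0 : ℝ), ENNReal.ofReal (2 * r) * h (r ^ 2) = ∫⁻ ρ in Set.Ioi (0 : ℝ), h ρ := by
  have him : (fun r : ℝ => r ^ 2) '' Set.Ioi 0 = Set.Ioi 0 := by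
    ext y
    simp only [Set.mem_image, Set.mem_Ioi]
    constructor
    · rintro ⟨x, hx, rfl⟩; positivity
    · intro hy; exact ⟨√y, Real.sqrt_pos.2 hy, Real.sq_sqrt hy.le⟩
  have := lintegral_image_eq_lintegral_abs_deriv_mul (s := Set.Ioi (0 : ℝ))
    (f := fun r : ℝ => r ^ 2) (f' := fun r => 2 * r) measurableSet_Ioi
    (fun x _ => by simpa using (hasDerivAt_pow 2 x).hasDerivWithinAt)
    (fun x hx y hy hxy => by
      simpa using (sq_eq_sq₀ (le_of_lt hx) (le_of_lt hy)).1 hxy) h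
  rw [him] at this
  rw [this]
  refine setLIntegral_congr_fun measurableSet_Ioi fun r hr => ?_
  rw [abs_of_pos (mul_pos two_pos hr)]

lemma map_sqPolar :
    Measure.map sqPolar ((volume.restrict (Set.Ioi 0)).prod (volume.restrict (Set.Ioo (-π) π)))
      = (2 : ℝ≥0∞) • (volume : Measure (ℝ × ℝ)) := by
  refine Measure.ext_of_lintegral _ fun f hf => ?_
  rw [lintegral_map hf measurable_sqPolar, lintegral_smul_measure,
    ← lintegral_comp_polarCoord_symm,
    lintegral_prod (fun q => f (sqPolar q)) (hf.comp measurable_sqPolar).aemeasurable]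
  rw [← lintegral_sq_Ioi (fun ρ => ∫⁻ φ in Set.Ioo (-π) π, f (sqPolar (ρ, φ)))]
  rw [polarCoord_target, Measure.volume_eq_prod, ← Measure.prod_restrict, lintegral_prod]
  · rw [smul_eq_mul, ← lintegral_const_mul]
    · refine setLIntegral_congr_fun measurableSet_Ioi fun r hr => ?_
      simp only [polarCoord_symm_apply, smul_eq_mul]
      have hr' : (0 : ℝ) ≤ r := le_of_lt hr
      rw [lintegral_const_mul, ← mul_assoc, ENNReal.ofReal_mul two_pos.le]
      · simp [sqPolar, Real.sqrt_sq hr']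
      · fun_prop
    · refine Measurable.lintegral_prod_right' (f := fun p : ℝ × ℝ => ENNReal.ofReal p.1 • f (polarCoord.symm p)) ?_
      simp only [polarCoord_symm_apply, smul_eq_mul]
      fun_prop
  · refine Measurable.aemeasurable ?_
    simp only [polarCoord_symm_apply, smul_eq_mul]
    fun_prop

/-- Linear coordinates on frequency space adapted to the sum and the sum of squares. -/
def sumLin : (ℝ × ℝ × ℝ) →ₗ[ℝ] (ℝ × ℝ × ℝ) where
  toFun q := (q.1 + q.2.1 + (√3)⁻¹ * q.2.2, q.1 - q.2.1 + (√3)⁻¹ * q.2.2,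
    q.1 - 2 * (√3)⁻¹ * q.2.2)
  map_add' x y := by
    ext <;> simp <;> ring
  map_smul' c x := by
    ext <;> simp <;> ring

lemma sumLin_injective : Function.Injective sumLin := by
  rw [← LinearMap.ker_eq_bot, LinearMap.ker_eq_bot']
  rintro ⟨p, y, z⟩ h
  simp only [sumLin, LinearMap.coe_mk, AddHom.coe_mk, Prod.mk_eq_zero] at h
  obtain ⟨h1, h2, h3⟩ := h
  have h3' : (√3 : ℝ)⁻¹ ≠ 0 := by positivity
  have hy : y = 0 := by linarith
  have hp : p = 0 := by linarith
  have hz : (√3 : ℝ)⁻¹ * z = 0 := by linarith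
  have hz : z = 0 := by simpa using hz
  simp [hy, hp, hz]

lemma map_sumLin : ∃ c : ℝ≥0∞, c ≠ 0 ∧ c ≠ ⊤ ∧
    Measure.map sumLin (volume : Measure (ℝ × ℝ × ℝ)) = c • volume := by
  have hdet : LinearMap.det sumLin ≠ 0 := by
    have := (LinearEquiv.ofInjectiveEndo sumLin sumLin_injective).isUnit_det'
    have h2 : ((LinearEquiv.ofInjectiveEndo sumLin sumLin_injective : (ℝ × ℝ × ℝ) ≃ₗ[ℝ] (ℝ × ℝ × ℝ)) : (ℝ × ℝ × ℝ) →ₗ[ℝ] (ℝ × ℝ × ℝ)) = sumLin := by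
      ext <;> simp
    rw [h2] at this
    exact this.ne_zero
  have : (volume : Measure (ℝ × ℝ)).IsAddHaarMeasure :=
    inferInstanceAs ((volume.prod volume : Measure (ℝ × ℝ)).IsAddHaarMeasure)
  have : (volume : Measure (ℝ × ℝ × ℝ)).IsAddHaarMeasure :=
    inferInstanceAs ((volume.prod volume : Measure (ℝ × ℝ × ℝ)).IsAddHaarMeasure)
  refine ⟨_, ?_, ?_, Measure.map_linearMap_addHaar_eq_smul_addHaar _ hdet⟩
  · simpa using hdet
  · simp

lemma lintegral_mul_sq_le {α : Type*} [MeasurableSpace α] {μ : Measure α} {f g : α → ℝ≥0∞}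
    (hf : AEMeasurable f μ) (hg : AEMeasurable g μ) :
    (∫⁻ x, f x * g x ∂μ) ^ (2 : ℕ) ≤ (∫⁻ x, f x ^ (2 : ℕ) ∂μ) * ∫⁻ x, g x ^ (2 : ℕ) ∂μ := by
  have := ENNReal.lintegral_mul_le_Lp_mul_Lq μ Real.HolderConjugate.two_two hf hg
  have h2 := pow_le_pow_left' this 2
  rw [mul_pow, ← ENNReal.rpow_natCast, ← ENNReal.rpow_natCast,
    ← ENNReal.rpow_natCast, ← ENNReal.rpow_mul, ← ENNReal.rpow_mul] at h2
  simpa using h2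

/-- The free Schrödinger evolution on the frequency side. -/
def schr (t : ℝ) (G : ℝ → ℂ) (ξ : ℝ) : ℂ :=
  Complex.exp (((-(4 * π ^ 2 * t * ξ ^ 2) : ℝ) : ℂ) * Complex.I) * G ξ

lemma norm_schr (t : ℝ) (G : ℝ → ℂ) (ξ : ℝ) : ‖schr t G ξ‖ = ‖G ξ‖ := by
  rw [schr, norm_mul, Complex.norm_exp_ofReal_mul_I, one_mul]

lemma enorm_schr (t : ℝ) (G : ℝ → ℂ) (ξ : ℝ) : ‖schr t G ξ‖ₑ = ‖G ξ‖ₑ := by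
  rw [← ofReal_norm, norm_schr, ofReal_norm]


/-- The product of three copies of `G` in the coordinates `sumLin`. -/
def tripleProd (G : ℝ → ℂ) (q : ℝ × ℝ × ℝ) : ℂ :=
  G (sumLin q).1 * (G (sumLin q).2.1 * G (sumLin q).2.2)

/-- The angular average of `tripleProd`. -/
def angAvg (G : ℝ → ℂ) (p ρ : ℝ) : ℂ :=
  (Set.Ioi (0 : ℝ)).indicator
    (fun ρ => ∫ φ in Set.Ioo (-π) π, tripleProd G (p, sqPolar (ρ, φ))) ρ

lemma measurable_sumLin : Measurable sumLin := by
  have : Continuous sumLin := by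
    simp only [sumLin, LinearMap.coe_mk, AddHom.coe_mk]; fun_prop
  exact this.measurable

lemma measurable_tripleProd {G : ℝ → ℂ} (hG : Measurable G) : Measurable (tripleProd G) := by
  have := measurable_sumLin
  unfold tripleProd
  fun_prop

lemma measurable_angAvg {G : ℝ → ℂ} (hG : Measurable G) :
    Measurable (fun q : ℝ × ℝ => angAvg G q.1 q.2) := by
  have h1 : Measurable (fun q : ℝ × ℝ => ∫ φ in Set.Ioo (-π) π,
      tripleProd G (q.1, sqPolar (q.2, φ))) := by
    refine (StronglyMeasurable.integral_prod_right (ν := volume.restrict (Set.Ioo (-π) π))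
      (f := fun (q : ℝ × ℝ) (φ : ℝ) => tripleProd G (q.1, sqPolar (q.2, φ))) ?_).measurable
    have := measurable_tripleProd hG
    have := measurable_sqPolar
    exact Measurable.stronglyMeasurable (by fun_prop)
  have h2 : MeasurableSet {q : ℝ × ℝ | q.2 ∈ Set.Ioi (0 : ℝ)} :=
    measurable_snd measurableSet_Ioi
  exact h1.indicator h2

lemma lintegral_tripleProd {G : ℝ → ℂ} (hG : Measurable G) {c : ℝ≥0∞}
    (hc : Measure.map sumLin (volume : Measure (ℝ × ℝ × ℝ)) = c • volume) :
    ∫⁻ q, ‖tripleProd G q‖ₑ ^ (2 : ℕ) = c * (∫⁻ x, ‖G x‖ₑ ^ (2 : ℕ)) ^ (3 : ℕ) := by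
  have h := lintegral_map (μ := (volume : Measure (ℝ × ℝ × ℝ)))
    (f := fun q : ℝ × ℝ × ℝ => ‖G q.1 * (G q.2.1 * G q.2.2)‖ₑ ^ (2 : ℕ)) (by fun_prop)
    measurable_sumLin
  rw [hc, lintegral_smul_measure, smul_eq_mul] at h
  rw [show (fun q => ‖tripleProd G q‖ₑ ^ (2 : ℕ)) = fun q => ‖G (sumLin q).1 *
    (G (sumLin q).2.1 * G (sumLin q).2.2)‖ₑ ^ (2 : ℕ) from rfl, ← h]
  congr 1
  simp_rw [enorm_mul, mul_pow]
  have e1 := lintegral_prod_mul (μ := (volume : Measure ℝ)) (ν := (volume : Measure (ℝ × ℝ)))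
    (f := fun x => ‖G x‖ₑ ^ (2 : ℕ)) (g := fun y : ℝ × ℝ => ‖G y.1‖ₑ ^ (2 : ℕ) * ‖G y.2‖ₑ ^ (2 : ℕ))
    (by fun_prop) (by fun_prop)
  have e2 := lintegral_prod_mul (μ := (volume : Measure ℝ)) (ν := (volume : Measure ℝ))
    (f := fun x => ‖G x‖ₑ ^ (2 : ℕ)) (g := fun y : ℝ => ‖G y‖ₑ ^ (2 : ℕ))
    (by fun_prop) (by fun_prop)
  rw [Measure.volume_eq_prod, e1, Measure.volume_eq_prod, e2]
  ring

lemma lintegral_angAvg_le {G : ℝ → ℂ} (hG : Measurable G) {c : ℝ≥0∞}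
    (hc : Measure.map sumLin (volume : Measure (ℝ × ℝ × ℝ)) = c • volume) :
    ∫⁻ p, ∫⁻ ρ, ‖angAvg G p ρ‖ₑ ^ (2 : ℕ)
      ≤ ENNReal.ofReal (2 * π) * 2 * c * (∫⁻ x, ‖G x‖ₑ ^ (2 : ℕ)) ^ (3 : ℕ) := by
  have hT := measurable_tripleProd hG
  have hP := measurable_sqPolar
  rw [mul_assoc, ← lintegral_tripleProd hG hc, Measure.volume_eq_prod,
    lintegral_prod _ (by fun_prop), ← lintegral_const_mul _ (by fun_prop)]
  refine lintegral_mono fun p => ?_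
  have h1 : ∀ ρ, ‖angAvg G p ρ‖ₑ ^ (2 : ℕ) ≤ (Set.Ioi (0 : ℝ)).indicator (fun ρ =>
      ENNReal.ofReal (2 * π) * ∫⁻ φ in Set.Ioo (-π) π,
        ‖tripleProd G (p, sqPolar (ρ, φ))‖ₑ ^ (2 : ℕ)) ρ := by
    intro ρ
    unfold angAvg
    by_cases hρ : ρ ∈ Set.Ioi (0 : ℝ)
    · simp only [Set.indicator_of_mem hρ]
      calc _ ≤ (∫⁻ φ in Set.Ioo (-π) π, ‖tripleProd G (p, sqPolar (ρ, φ))‖ₑ) ^ (2 : ℕ) := by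
            gcongr; exact enorm_integral_le_lintegral_enorm _
        _ ≤ _ := by
            have h2 := lintegral_mul_sq_le (μ := volume.restrict (Set.Ioo (-π) π)) (f := fun _ => 1)
              (g := fun φ => ‖tripleProd G (p, sqPolar (ρ, φ))‖ₑ) (by fun_prop) (by fun_prop)
            simp only [one_mul, one_pow, lintegral_const, Measure.restrict_apply_univ,
              Real.volume_Ioo] at h2
            rwa [show π - -π = 2 * π by ring] at h2
    · simp [Set.indicator_of_notMem hρ]
  refine (lintegral_mono h1).trans ?_
  rw [lintegral_indicator measurableSet_Ioi, lintegral_const_mul]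
  · rw [mul_assoc]
    gcongr
    have h3 := lintegral_map (μ := (volume.restrict (Set.Ioi 0)).prod
      (volume.restrict (Set.Ioo (-π) π))) (f := fun w => ‖tripleProd G (p, w)‖ₑ ^ (2 : ℕ))
      (by fun_prop) measurable_sqPolar
    rw [map_sqPolar, lintegral_smul_measure, smul_eq_mul, lintegral_prod _ (by fun_prop)] at h3
    exact h3.ge
  · exact Measurable.lintegral_prod_right' (f := fun q : ℝ × ℝ =>
      ‖tripleProd G (p, sqPolar (q.1, q.2))‖ₑ ^ (2 : ℕ)) (by fun_prop)

lemma fourierInv_cube {g : ℝ → ℂ} (x : ℝ) :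
    (𝓕⁻ g x) ^ 3 = ∫ q : ℝ × ℝ × ℝ,
      Complex.exp (((2 * π * (q.1 + q.2.1 + q.2.2) * x : ℝ) : ℂ) * Complex.I)
        * (g q.1 * (g q.2.1 * g q.2.2)) := by
  set k : ℝ → ℂ := fun a => Complex.exp (((2 * π * (a * x) : ℝ) : ℂ) * Complex.I) * g a with hk
  have h0 : 𝓕⁻ g x = ∫ a, k a := by
    rw [Real.fourierInv_eq']
    refine integral_congr_ae (Filter.Eventually.of_forall fun a => ?_)
    simp [hk, mul_comm]
  have e1 := integral_prod_mul (μ := (volume : Measure ℝ)) (ν := (volume : Measure (ℝ × ℝ)))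
    k (fun y : ℝ × ℝ => k y.1 * k y.2)
  have e2 := integral_prod_mul (μ := (volume : Measure ℝ)) (ν := (volume : Measure ℝ)) k k
  rw [h0, pow_succ, pow_two, mul_assoc, ← e2, ← Measure.volume_eq_prod, ← e1,
    ← Measure.volume_eq_prod]
  refine integral_congr_ae (Filter.Eventually.of_forall fun q => ?_)
  simp only [hk]
  rw [show (((2 * π * (q.1 + q.2.1 + q.2.2) * x : ℝ) : ℂ) * Complex.I)
    = ((2 * π * (q.1 * x) : ℝ) : ℂ) * Complex.I + (((2 * π * (q.2.1 * x) : ℝ) : ℂ) * Complex.I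
      + ((2 * π * (q.2.2 * x) : ℝ) : ℂ) * Complex.I) by push_cast; ring, Complex.exp_add,
      Complex.exp_add]
  ring

lemma sumLin_sum (q : ℝ × ℝ × ℝ) :
    (sumLin q).1 + (sumLin q).2.1 + (sumLin q).2.2 = 3 * q.1 := by
  simp only [sumLin, LinearMap.coe_mk, AddHom.coe_mk]; ring

lemma sumLin_sum_sq (q : ℝ × ℝ × ℝ) :
    (sumLin q).1 ^ 2 + (sumLin q).2.1 ^ 2 + (sumLin q).2.2 ^ 2
      = 3 * q.1 ^ 2 + 2 * (q.2.1 ^ 2 + q.2.2 ^ 2) := by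
  have h : ((√3 : ℝ)⁻¹) ^ 2 = 3⁻¹ := by rw [inv_pow, Real.sq_sqrt (by norm_num)]
  simp only [sumLin, LinearMap.coe_mk, AddHom.coe_mk]
  linear_combination (6 * q.2.2 ^ 2) * h

lemma sqPolar_sq {ρ : ℝ} (hρ : 0 ≤ ρ) (φ : ℝ) :
    (sqPolar (ρ, φ)).1 ^ 2 + (sqPolar (ρ, φ)).2 ^ 2 = ρ := by
  simp only [sqPolar, mul_pow, Real.sq_sqrt hρ]
  linear_combination ρ * Real.cos_sq_add_sin_sq φ

lemma schr_cube_eq {G : ℝ → ℂ} (hG : Measurable G) (hGi : Integrable G) {c : ℝ≥0∞}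
    (hct : c ≠ ⊤)
    (hc : Measure.map sumLin (volume : Measure (ℝ × ℝ × ℝ)) = c • volume) (t x : ℝ) :
    (c.toReal : ℂ) * (𝓕⁻ (schr t G) x) ^ 3
      = 𝓕⁻ (fun p => Complex.exp (((-(12 * π ^ 2 * t * p ^ 2) : ℝ) : ℂ) * Complex.I)
        * (2⁻¹ * 𝓕 (angAvg G p) (4 * π * t))) (3 * x) := by
  have hT := measurable_tripleProd hG
  have hP := measurable_sqPolar
  set F : ℝ × ℝ × ℝ → ℂ := fun q =>
    Complex.exp (((2 * π * (q.1 + q.2.1 + q.2.2) * x : ℝ) : ℂ) * Complex.I)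
        * (schr t G q.1 * (schr t G q.2.1 * schr t G q.2.2)) with hF
  have hSm : Measurable (schr t G) := by unfold schr; fun_prop
  have hFm : Measurable F := by fun_prop
  have hSi : Integrable (schr t G) :=
    hGi.mono hSm.aestronglyMeasurable (Filter.Eventually.of_forall fun a => (norm_schr t G a).le)
  have hFi : Integrable F := by
    have := hSi.mul_prod (hSi.mul_prod hSi)
    refine this.mono hFm.aestronglyMeasurable (Filter.Eventually.of_forall fun q => ?_)
    simp only [hF]
    rw [norm_mul, Complex.norm_exp_ofReal_mul_I, one_mul]
  have hFi2 : Integrable (F ∘ sumLin) := by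
    rw [← integrable_map_measure hFm.aestronglyMeasurable measurable_sumLin.aemeasurable, hc]
    exact hFi.smul_measure hct
  have h1 : ∫ q, F (sumLin q) = (c.toReal : ℂ) * ∫ q, F q := by
    rw [← integral_map measurable_sumLin.aemeasurable hFm.aestronglyMeasurable, hc,
      integral_smul_measure]
    simp
  rw [fourierInv_cube, ← h1, Measure.volume_eq_prod,
    integral_prod (fun q => F (sumLin q)) hFi2, Real.fourierInv_eq']
  have h2 := hFi2.prod_right_ae
  refine integral_congr_ae ?_
  filter_upwards [h2] with p hp
  set A : ℂ := Complex.exp (((2 * π * (3 * p) * x : ℝ) : ℂ) * Complex.I)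
    * Complex.exp (((-(12 * π ^ 2 * t * p ^ 2) : ℝ) : ℂ) * Complex.I) with hA
  set E : ℝ × ℝ → ℂ := fun w =>
    Complex.exp (((-(8 * π ^ 2 * t * (w.1 ^ 2 + w.2 ^ 2)) : ℝ) : ℂ) * Complex.I)
      * tripleProd G (p, w) with hE
  have hA0 : A ≠ 0 := mul_ne_zero (Complex.exp_ne_zero _) (Complex.exp_ne_zero _)
  have hEm : Measurable E := by fun_prop
  have hFE : ∀ w, F (sumLin (p, w)) = A * E w := by
    intro w
    simp only [hF, hA, hE, schr, tripleProd, sumLin_sum]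
    have e : ∀ a b c' : ℂ, ∀ r₁ r₂ r₃ r₄ : ℝ,
        Complex.exp ((r₁ : ℂ) * Complex.I) * ((Complex.exp ((r₂ : ℂ) * Complex.I) * a) *
        ((Complex.exp ((r₃ : ℂ) * Complex.I) * b) * (Complex.exp ((r₄ : ℂ) * Complex.I) * c')))
        = Complex.exp ((r₁ : ℂ) * Complex.I) * Complex.exp (((r₂ + r₃ + r₄ : ℝ) : ℂ) * Complex.I)
          * (a * (b * c')) := by
      intro a b c' r₁ r₂ r₃ r₄
      push_cast
      rw [add_mul, add_mul, Complex.exp_add, Complex.exp_add]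
      ring
    rw [e, show -(4 * π ^ 2 * t * (sumLin (p, w)).1 ^ 2) + -(4 * π ^ 2 * t * (sumLin (p, w)).2.1 ^ 2)
        + -(4 * π ^ 2 * t * (sumLin (p, w)).2.2 ^ 2) = -(12 * π ^ 2 * t * p ^ 2)
          + -(8 * π ^ 2 * t * (w.1 ^ 2 + w.2 ^ 2)) by
        linear_combination (-4 * π ^ 2 * t) * sumLin_sum_sq (p, w), Complex.ofReal_add, add_mul,
      Complex.exp_add]
    ring
  have hEi : Integrable E := by
    have : Integrable (fun w => A * E w) := by
      refine hp.congr (Filter.Eventually.of_forall fun w => ?_)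
      exact hFE w
    exact (integrable_const_mul_iff (IsUnit.mk0 _ hA0) _).1 this
  simp_rw [hFE]
  rw [integral_const_mul]
  have h3 : (2 : ℂ) * ∫ w, E w = 𝓕 (angAvg G p) (4 * π * t) := by
    have h4 : (2 : ℂ) * ∫ w, E w = ∫ w, E w ∂((2 : ℝ≥0∞) • (volume : Measure (ℝ × ℝ))) := by
      rw [integral_smul_measure]; simp
    have h5 : Integrable E ((2 : ℝ≥0∞) • (volume : Measure (ℝ × ℝ))) :=
      hEi.smul_measure (by norm_num)
    rw [h4, ← map_sqPolar, integral_map hP.aemeasurable hEm.aestronglyMeasurable]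
    rw [← map_sqPolar, integrable_map_measure hEm.aestronglyMeasurable hP.aemeasurable] at h5
    rw [integral_prod (fun q => E (sqPolar q)) h5, Real.fourier_eq',
      ← integral_indicator measurableSet_Ioi]
    refine integral_congr_ae (Filter.Eventually.of_forall fun ρ => ?_)
    unfold angAvg
    by_cases hρ : ρ ∈ Set.Ioi (0 : ℝ)
    · simp only [Set.indicator_of_mem hρ, hE, sqPolar_sq (le_of_lt hρ)]
      rw [integral_const_mul, smul_eq_mul]
      congr 2
      push_cast
      simp
      ring
    · simp [Set.indicator_of_notMem hρ]
  rw [← h3, hA, smul_eq_mul]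
  have h6 : Complex.exp (((2 * π * (3 * p) * x : ℝ) : ℂ) * Complex.I)
      = Complex.exp (((2 * π * inner ℝ p (3 * x) : ℝ) : ℂ) * Complex.I) := by
    congr 2
    simp
    ring
  rw [h6]
  ring

lemma lintegral_comp_mul_left_le (f : ℝ → ℝ≥0∞) {c : ℝ} (hc : 1 ≤ c) :
    ∫⁻ x, f (c * x) ≤ ∫⁻ x, f x := by
  rw [lintegral_comp_mul_left_real f (by linarith)]
  calc _ ≤ 1 * ∫⁻ x, f x := by
        gcongr
        rw [← ENNReal.ofReal_one]
        exact ENNReal.ofReal_le_ofReal (inv_le_one_of_one_le₀ hc)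
    _ = _ := one_mul _

lemma measurable_fourier_angAvg {G : ℝ → ℂ} (hG : Measurable G) :
    Measurable (fun q : ℝ × ℝ => 𝓕 (angAvg G q.1) q.2) := by
  have hav := measurable_angAvg hG
  simp_rw [Real.fourier_eq']
  refine (StronglyMeasurable.integral_prod_right (ν := (volume : Measure ℝ))
    (f := fun (q : ℝ × ℝ) (v : ℝ) =>
      Complex.exp (((-2 * π * inner ℝ v q.2 : ℝ) : ℂ) * Complex.I) • angAvg G q.1 v)
    ?_).measurable
  refine Measurable.stronglyMeasurable ?_
  have : Measurable (fun a : (ℝ × ℝ) × ℝ => angAvg G a.1.1 a.2) :=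
    hav.comp (by fun_prop : Measurable fun a : (ℝ × ℝ) × ℝ => (a.1.1, a.2))
  fun_prop

lemma measurable_fourier_angAvg_left {G : ℝ → ℂ} (hG : Measurable G) (w : ℝ) :
    Measurable (fun p => 𝓕 (angAvg G p) w) :=
  (measurable_fourier_angAvg hG).of_uncurry_right

lemma lintegral_schr_six_le {G : ℝ → ℂ} (hG : Measurable G) (hGi : Integrable G) {c : ℝ≥0∞}
    (hct : c ≠ ⊤)
    (hc : Measure.map sumLin (volume : Measure (ℝ × ℝ × ℝ)) = c • volume) (t : ℝ) :
    c ^ 2 * ∫⁻ x, ‖𝓕⁻ (schr t G) x‖ₑ ^ (6 : ℕ)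
      ≤ ∫⁻ p, ‖𝓕 (angAvg G p) (4 * π * t)‖ₑ ^ (2 : ℕ) := by
  rw [← lintegral_const_mul' _ _ (ENNReal.pow_ne_top hct)]
  set A : ℝ → ℂ := fun p => Complex.exp (((-(12 * π ^ 2 * t * p ^ 2) : ℝ) : ℂ) * Complex.I)
      * (2⁻¹ * 𝓕 (angAvg G p) (4 * π * t)) with hA
  have hAm : Measurable A := by
    have := measurable_fourier_angAvg_left hG (4 * π * t)
    have h2 : Measurable fun p : ℝ =>
      Complex.exp (((-(12 * π ^ 2 * t * p ^ 2) : ℝ) : ℂ) * Complex.I) := by fun_prop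
    exact h2.mul (this.const_mul _)
  have hAn : ∀ p, ‖A p‖ₑ ≤ ‖𝓕 (angAvg G p) (4 * π * t)‖ₑ := by
    intro p
    rw [← ofReal_norm, ← ofReal_norm]
    refine ENNReal.ofReal_le_ofReal ?_
    rw [hA, norm_mul, Complex.norm_exp_ofReal_mul_I, one_mul, norm_mul]
    have := norm_nonneg (𝓕 (angAvg G p) (4 * π * t))
    norm_num
    linarith
  have h1 : ∀ x, c ^ 2 * ‖𝓕⁻ (schr t G) x‖ₑ ^ (6 : ℕ) = ‖𝓕⁻ A (3 * x)‖ₑ ^ (2 : ℕ) := by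
    intro x
    rw [hA, ← schr_cube_eq hG hGi hct hc, enorm_mul, mul_pow, enorm_pow, ← pow_mul]
    congr 2
    rw [← ofReal_norm]
    simp [hct]
  clear_value A
  simp_rw [h1]
  calc _ ≤ ∫⁻ y, ‖𝓕⁻ A y‖ₑ ^ (2 : ℕ) :=
        lintegral_comp_mul_left_le (fun y => ‖𝓕⁻ A y‖ₑ ^ (2 : ℕ)) (by norm_num)
    _ ≤ ∫⁻ y, ‖A y‖ₑ ^ (2 : ℕ) := lintegral_fourierInv_sq_le _ hAm.aestronglyMeasurable
    _ ≤ _ := lintegral_mono fun p => pow_le_pow_left' (hAn p) 2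

/-- The endpoint one-dimensional Strichartz estimate. -/
lemma strichartz : ∃ K : ℝ≥0∞, K ≠ ⊤ ∧ ∀ G : ℝ → ℂ, Measurable G → Integrable G →
    ∫⁻ t, ∫⁻ x, ‖𝓕⁻ (schr t G) x‖ₑ ^ (6 : ℕ) ≤ K * (∫⁻ x, ‖G x‖ₑ ^ (2 : ℕ)) ^ (3 : ℕ) := by
  obtain ⟨c, hc0, hct, hc⟩ := map_sumLin
  refine ⟨(c ^ 2)⁻¹ * (ENNReal.ofReal (2 * π) * 2 * c), ?_, fun G hG hGi => ?_⟩
  · exact ENNReal.mul_ne_top (by simp [hc0]) (ENNReal.mul_ne_top (ENNReal.mul_ne_top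
      ENNReal.ofReal_ne_top (by norm_num)) hct)
  have hav := measurable_angAvg hG
  have hFm2 : Measurable (fun q : ℝ × ℝ => ‖𝓕 (angAvg G q.2) (4 * π * q.1)‖ₑ ^ (2 : ℕ)) :=
    ((measurable_fourier_angAvg hG).comp
      (by fun_prop : Measurable fun q : ℝ × ℝ => (q.2, 4 * π * q.1))).enorm.pow_const 2
  have key : c ^ 2 * ∫⁻ t, ∫⁻ x, ‖𝓕⁻ (schr t G) x‖ₑ ^ (6 : ℕ)
      ≤ ENNReal.ofReal (2 * π) * 2 * c * (∫⁻ x, ‖G x‖ₑ ^ (2 : ℕ)) ^ (3 : ℕ) := by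
    refine le_trans ?_ (lintegral_angAvg_le hG hc)
    rw [← lintegral_const_mul' _ _ (ENNReal.pow_ne_top hct)]
    refine (lintegral_mono fun t => lintegral_schr_six_le hG hGi hct hc t).trans ?_
    rw [lintegral_lintegral_swap hFm2.aemeasurable]
    refine lintegral_mono fun p => ?_
    refine (lintegral_comp_mul_left_le (fun y => ‖𝓕 (angAvg G p) y‖ₑ ^ (2 : ℕ)) ?_).trans ?_
    · linarith [Real.pi_gt_three]
    · refine lintegral_fourier_sq_le _ (Measurable.aestronglyMeasurable ?_)
      exact hav.comp (by fun_prop : Measurable fun ρ : ℝ => (p, ρ))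
  rw [mul_assoc (c ^ 2)⁻¹]
  exact (ENNReal.mul_le_iff_le_inv (by simp [hc0]) (ENNReal.pow_ne_top hct)).1 key

section

/-- The decaying weight `(1 + ξ²)^{-m}`. -/
def dec (m : ℕ) (ξ : ℝ) : ℝ := ((1 + ξ ^ 2) ^ m)⁻¹

lemma dec_pos (m : ℕ) (ξ : ℝ) : 0 < dec m ξ := by unfold dec; positivity

lemma dec_le_one (m : ℕ) (ξ : ℝ) : dec m ξ ≤ 1 := by
  unfold dec
  exact inv_le_one_of_one_le₀ (one_le_pow₀ (by nlinarith [sq_nonneg ξ]))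

lemma dec_anti {m n : ℕ} (h : m ≤ n) (ξ : ℝ) : dec n ξ ≤ dec m ξ := by
  unfold dec
  gcongr
  nlinarith [sq_nonneg ξ]

lemma dec_add (m n : ℕ) (ξ : ℝ) : dec (m + n) ξ = dec m ξ * dec n ξ := by
  unfold dec; rw [pow_add, mul_inv]

lemma dec_neg (m : ℕ) (ξ : ℝ) : dec m (-ξ) = dec m ξ := by simp [dec]

lemma measurable_dec (m : ℕ) : Measurable (dec m) := by unfold dec; fun_prop

lemma dec_one_eq : dec 1 = fun ξ : ℝ => (1 + ξ ^ 2)⁻¹ := by ext; simp [dec]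

lemma integrable_dec {m : ℕ} (hm : 1 ≤ m) : Integrable (dec m) := by
  have h1 : Integrable (dec 1) := by
    rw [dec_one_eq]; exact integrable_inv_one_add_sq
  refine h1.mono (measurable_dec m).aestronglyMeasurable (Filter.Eventually.of_forall fun ξ => ?_)
  rw [Real.norm_of_nonneg (dec_pos _ _).le, Real.norm_of_nonneg (dec_pos _ _).le]
  exact dec_anti hm ξ

lemma dec_mul_le (m : ℕ) (x t : ℝ) : dec m t * dec m (x - t) ≤ 2 ^ m * dec m x := by
  unfold dec
  rw [← mul_inv, ← mul_pow, ← div_eq_mul_inv, inv_le_comm₀ (by positivity) (by positivity),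
    inv_div, div_le_iff₀ (by positivity), ← mul_pow]
  gcongr
  nlinarith [sq_nonneg (t * (x - t)), sq_nonneg (t - (x - t))]

/-- Measurable functions bounded by a multiple of `dec m`. -/
structure HasDec (m : ℕ) (C : ℝ) (G : ℝ → ℂ) : Prop where
  meas : Measurable G
  bound : ∀ ξ, ‖G ξ‖ ≤ C * dec m ξ

namespace HasDec
variable {m : ℕ} {C D : ℝ} {G H : ℝ → ℂ}

lemma nonneg (h : HasDec m C G) : 0 ≤ C := by
  have := (norm_nonneg _).trans (h.bound 0)
  exact nonneg_of_mul_nonneg_left this (dec_pos m 0)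

lemma mono_m {n : ℕ} (h : HasDec m C G) (hn : n ≤ m) : HasDec n C G :=
  ⟨h.meas, fun ξ => (h.bound ξ).trans (by have := h.nonneg; have := dec_anti hn ξ; gcongr)⟩

lemma bdd (h : HasDec m C G) (ξ : ℝ) : ‖G ξ‖ ≤ C :=
  (h.bound ξ).trans (mul_le_of_le_one_right h.nonneg (dec_le_one m ξ))

lemma integrable (h : HasDec m C G) (hm : 1 ≤ m) : Integrable G :=
  ((integrable_dec hm).const_mul C).mono' h.meas.aestronglyMeasurable
    (Filter.Eventually.of_forall h.bound)

lemma memLp (h : HasDec m C G) (hm : 1 ≤ m) : MemLp G 2 :=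
  (memLp_two_iff_integrable_sq_norm h.meas.aestronglyMeasurable).2 <| by
    simp_rw [sq]
    exact (h.integrable hm).norm.bdd_mul h.meas.norm.aestronglyMeasurable
      (Filter.Eventually.of_forall fun ξ => by simpa using h.bdd ξ)

lemma indicator (h : HasDec m C G) {J : Set ℝ} (hJ : MeasurableSet J) :
    HasDec m C (J.indicator G) :=
  ⟨h.meas.indicator hJ, fun ξ => (norm_indicator_le_norm_self G ξ).trans (h.bound ξ)⟩

lemma convolution (hG : HasDec (m + 1) C G) (hH : HasDec (m + 1) D H) :
    HasDec m (2 ^ m * π * C * D) (G ⋆[ContinuousLinearMap.mul ℂ ℂ, volume] H) := by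
  have hC := hG.nonneg
  have hD := hH.nonneg
  constructor
  · unfold MeasureTheory.convolution
    refine (StronglyMeasurable.integral_prod_right (ν := (volume : Measure ℝ))
      (f := fun (x : ℝ) (t : ℝ) => (ContinuousLinearMap.mul ℂ ℂ) (G t) (H (x - t))) ?_).measurable
    have := hG.meas
    have := hH.meas
    simp only [ContinuousLinearMap.mul_apply']
    exact Measurable.stronglyMeasurable (by fun_prop)
  · intro x
    unfold MeasureTheory.convolution
    simp only [ContinuousLinearMap.mul_apply']
    have h1 : ∀ t, ‖G t * H (x - t)‖ ≤ (C * D * (2 ^ m * dec m x)) * dec 1 t := by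
      intro t
      rw [norm_mul]
      calc _ ≤ (C * dec (m + 1) t) * (D * dec (m + 1) (x - t)) := by
            have := (dec_pos (m + 1) t).le
            gcongr
            · exact hG.bound t
            · exact hH.bound _
        _ = C * D * (dec m t * dec m (x - t)) * dec 1 t * dec 1 (x - t) := by
            rw [dec_add, dec_add]; ring
        _ ≤ C * D * (2 ^ m * dec m x) * dec 1 t * 1 := by
            have := (dec_pos 1 t).le
            have := (dec_pos 1 (x - t)).le
            have := (dec_pos m x).le
            have := dec_mul_le m x t
            have := dec_le_one 1 (x - t)
            gcongr
        _ = _ := by ring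
    refine (norm_integral_le_of_norm_le ((integrable_dec le_rfl).const_mul _)
      (Filter.Eventually.of_forall h1)).trans (le_of_eq ?_)
    rw [integral_const_mul, dec_one_eq, integral_univ_inv_one_add_sq]
    ring

end HasDec

/-- The reflected conjugate. -/
def reflConj (G : ℝ → ℂ) (ξ : ℝ) : ℂ := (starRingEnd ℂ) (G (-ξ))

/-- The frequency side of the cubic nonlinearity. -/
def conv3 (G : ℝ → ℂ) : ℝ → ℂ :=
  G ⋆[ContinuousLinearMap.mul ℂ ℂ, volume] (reflConj G ⋆[ContinuousLinearMap.mul ℂ ℂ, volume] G)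

lemma HasDec.reflConj {m : ℕ} {C : ℝ} {G : ℝ → ℂ} (h : HasDec m C G) :
    HasDec m C (reflConj G) := by
  refine ⟨?_, fun ξ => ?_⟩
  · have := h.meas
    unfold _root_.reflConj
    exact (Complex.continuous_conj.measurable).comp (by fun_prop)
  · rw [_root_.reflConj, RCLike.norm_conj, ← dec_neg]
    exact h.bound _

lemma HasDec.conv3 {m : ℕ} {C : ℝ} {G : ℝ → ℂ} (h : HasDec (m + 2) C G) :
    HasDec m (2 ^ m * π * C * (2 ^ (m + 1) * π * C * C)) (conv3 G) :=
  (h.mono_m (by omega)).convolution (h.reflConj.convolution h)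

lemma fourierInv_reflConj (G : ℝ → ℂ) (x : ℝ) :
    𝓕⁻ (reflConj G) x = (starRingEnd ℂ) (𝓕⁻ G x) := by
  rw [Real.fourierInv_eq', Real.fourierInv_eq', ← integral_conj, ← integral_neg_eq_self]
  refine integral_congr_ae (Filter.Eventually.of_forall fun v => ?_)
  simp [reflConj, ← Complex.exp_conj, Complex.conj_ofNat]

lemma fourierInv_convolution {f g : ℝ → ℂ} (hf : Integrable f) (hg : Integrable g) (x : ℝ) :
    𝓕⁻ (f ⋆[ContinuousLinearMap.mul ℂ ℂ, volume] g) x = 𝓕⁻ f x * 𝓕⁻ g x := by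
  simp_rw [Real.fourierInv_eq_fourier_neg]
  exact Real.fourier_mul_convolution_eq hf hg _

lemma fourierInv_conv3 {G : ℝ → ℂ} (hG : Integrable G) (x : ℝ) :
    𝓕⁻ (conv3 G) x = 𝓕⁻ G x * ((starRingEnd ℂ) (𝓕⁻ G x) * 𝓕⁻ G x) := by
  have hr : Integrable (reflConj G) := by
    unfold reflConj
    exact Complex.conjCLE.toContinuousLinearMap.integrable_comp hG.comp_neg
  unfold conv3
  rw [fourierInv_convolution hG (hr.integrable_convolution _ hG), fourierInv_convolution hr hG,
    fourierInv_reflConj]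

lemma measurable_conv3_param {α : Type*} [MeasurableSpace α] {U : α → ℝ → ℂ}
    (hU : Measurable (fun q : α × ℝ => U q.1 q.2)) :
    Measurable (fun q : α × ℝ => conv3 (U q.1) q.2) := by
  have hc := Complex.continuous_conj.measurable
  have h1 : Measurable (fun q : α × ℝ => (reflConj (U q.1)
      ⋆[ContinuousLinearMap.mul ℂ ℂ, volume] U q.1) q.2) := by
    refine (StronglyMeasurable.integral_prod_right (ν := (volume : Measure ℝ))
      (f := fun (q : α × ℝ) (t : ℝ) => (reflConj (U q.1) t * U q.1 (q.2 - t))) ?_).measurable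
    refine Measurable.stronglyMeasurable (Measurable.mul ?_ ?_)
    · exact hc.comp (hU.comp (by fun_prop : Measurable fun a : (α × ℝ) × ℝ => (a.1.1, -a.2)))
    · exact hU.comp (by fun_prop : Measurable fun a : (α × ℝ) × ℝ => (a.1.1, a.1.2 - a.2))
  refine (StronglyMeasurable.integral_prod_right (ν := (volume : Measure ℝ))
      (f := fun (q : α × ℝ) (t : ℝ) => (U q.1 t * (reflConj (U q.1)
      ⋆[ContinuousLinearMap.mul ℂ ℂ, volume] U q.1) (q.2 - t))) ?_).measurable
  refine Measurable.stronglyMeasurable (Measurable.mul ?_ ?_)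
  · exact hU.comp (by fun_prop : Measurable fun a : (α × ℝ) × ℝ => (a.1.1, a.2))
  · exact h1.comp (by fun_prop : Measurable fun a : (α × ℝ) × ℝ => (a.1.1, a.1.2 - a.2))

lemma conv3_eq_integral (G : ℝ → ℂ) (p : ℝ) :
    conv3 G p = ∫ ξ, ∫ η, G (p + ξ) * ((starRingEnd ℂ) (G (p + ξ + η)) * G (p + η)) := by
  unfold conv3 MeasureTheory.convolution reflConj
  simp only [ContinuousLinearMap.mul_apply']
  rw [← integral_add_left_eq_self _ p]
  refine integral_congr_ae (Filter.Eventually.of_forall fun ξ => ?_)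
  dsimp only
  rw [integral_const_mul]
  congr 1
  rw [← integral_neg_eq_self, ← integral_add_left_eq_self _ (p + ξ)]
  refine integral_congr_ae (Filter.Eventually.of_forall fun η => ?_)
  dsimp only
  rw [neg_neg]
  congr 2
  ring

lemma conv3_eq_zero {G : ℝ → ℂ} {R p : ℝ} (hG : ∀ ξ, R < |ξ| → G ξ = 0) (hp : 3 * R < |p|) :
    conv3 G p = 0 := by
  rw [conv3_eq_integral]
  refine integral_eq_zero_of_ae (Filter.Eventually.of_forall fun ξ => ?_)
  refine integral_eq_zero_of_ae (Filter.Eventually.of_forall fun η => ?_)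
  simp only [Pi.zero_apply]
  by_cases h1 : R < |p + ξ|
  · simp [hG _ h1]
  by_cases h2 : R < |p + ξ + η|
  · simp [hG _ h2]
  by_cases h3 : R < |p + η|
  · simp [hG _ h3]
  exfalso
  push Not at h1 h2 h3
  rw [abs_le] at h1 h2 h3
  have : |p| ≤ 3 * R := abs_le.2 ⟨by linarith [h1.1, h2.2, h3.1], by linarith [h1.2, h2.1, h3.2]⟩
  linarith

end

lemma rpow_half_sq (x : ℝ≥0∞) : (x ^ (1 / 2 : ℝ)) ^ (2 : ℕ) = x := by
  rw [← ENNReal.rpow_natCast, ← ENNReal.rpow_mul]; norm_num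

lemma add_sq_le_two (a b : ℝ≥0∞) : (a + b) ^ (2 : ℕ) ≤ 2 * (a ^ 2 + b ^ 2) := by
  have := ENNReal.rpow_add_le_mul_rpow_add_rpow a b (p := 2) (by norm_num)
  norm_num at this
  exact this

lemma le_pow_six_of_le_mul {X M : ℝ≥0∞} (hX : X ≠ ⊤) (h : X ≤ X ^ (5 / 6 : ℝ) * M) :
    X ≤ M ^ (6 : ℕ) := by
  by_cases h0 : X = 0
  · simp [h0]
  have h1 : X ^ (1 / 6 : ℝ) ≤ M := by
    have h2 : X ^ (5 / 6 : ℝ) * X ^ (1 / 6 : ℝ) ≤ X ^ (5 / 6 : ℝ) * M := by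
      rw [← ENNReal.rpow_add _ _ h0 hX]; norm_num; exact h
    exact (ENNReal.mul_le_mul_iff_right (by simp [h0, hX]) (by simp [h0, hX])).1 h2
  calc X = (X ^ (1 / 6 : ℝ)) ^ (6 : ℕ) := by
        rw [← ENNReal.rpow_natCast, ← ENNReal.rpow_mul]; norm_num
    _ ≤ _ := by gcongr

/-- Minkowski's integral inequality in `L⁶`, for a function with a finite norm. -/
lemma lintegral_pow_six_le {Ω S : Type*} [MeasurableSpace Ω] [MeasurableSpace S]
    {μ : Measure Ω} {ν : Measure S} [SFinite μ] [SFinite ν] {f A : Ω → ℝ≥0∞}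
    {B : S → Ω → ℝ≥0∞} {a : ℝ≥0∞} {b : S → ℝ≥0∞} (hf : Measurable f) (hA : Measurable A)
    (hB : Measurable (fun q : S × Ω => B q.1 q.2))
    (hle : ∀ᵐ ω ∂μ, f ω ≤ A ω + ∫⁻ s, B s ω ∂ν) (hfin : ∫⁻ ω, f ω ^ (6 : ℕ) ∂μ ≠ ⊤)
    (ha : ∫⁻ ω, A ω ^ (6 : ℕ) ∂μ ≤ a ^ (6 : ℕ))
    (hb : ∀ᵐ s ∂ν, ∫⁻ ω, B s ω ^ (6 : ℕ) ∂μ ≤ b s ^ (6 : ℕ)) :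
    ∫⁻ ω, f ω ^ (6 : ℕ) ∂μ ≤ (a + ∫⁻ s, b s ∂ν) ^ (6 : ℕ) := by
  set X := ∫⁻ ω, f ω ^ (6 : ℕ) ∂μ with hX
  have hold : ∀ (g : Ω → ℝ≥0∞) (c : ℝ≥0∞), Measurable g → ∫⁻ ω, g ω ^ (6 : ℕ) ∂μ ≤ c ^ (6 : ℕ) →
      ∫⁻ ω, f ω ^ (5 : ℕ) * g ω ∂μ ≤ X ^ (5 / 6 : ℝ) * c := by
    intro g c hg hgc
    have hpq : Real.HolderConjugate (6 / 5) 6 := by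
      rw [Real.holderConjugate_iff]; norm_num
    have h := ENNReal.lintegral_mul_le_Lp_mul_Lq μ hpq (f := fun ω => f ω ^ (5 : ℕ)) (g := g)
      (by fun_prop) hg.aemeasurable
    refine h.trans ?_
    gcongr
    · rw [show (1 / (6 / 5) : ℝ) = 5 / 6 by norm_num, hX]
      gcongr with ω
      rw [← ENNReal.rpow_natCast, ← ENNReal.rpow_mul, ← ENNReal.rpow_natCast]
      norm_num
    · calc _ ≤ (c ^ (6 : ℕ)) ^ (1 / 6 : ℝ) := by
            gcongr
            refine le_trans (le_of_eq ?_) hgc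
            refine lintegral_congr fun ω => ?_
            rw [← ENNReal.rpow_natCast]; norm_num
        _ = c := by rw [← ENNReal.rpow_natCast, ← ENNReal.rpow_mul]; norm_num
  refine le_pow_six_of_le_mul hfin ?_
  calc X = ∫⁻ ω, f ω ^ (5 : ℕ) * f ω ∂μ := by simp_rw [hX, ← pow_succ]
    _ ≤ ∫⁻ ω, (f ω ^ (5 : ℕ) * A ω + ∫⁻ s, f ω ^ (5 : ℕ) * B s ω ∂ν) ∂μ := by
        refine lintegral_mono_ae ?_
        filter_upwards [hle] with ω hω
        have hBω : Measurable fun s => B s ω :=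
          hB.comp (by fun_prop : Measurable fun s : S => (s, ω))
        rw [lintegral_const_mul _ hBω, ← mul_add]
        gcongr
    _ = ∫⁻ ω, f ω ^ (5 : ℕ) * A ω ∂μ + ∫⁻ s, ∫⁻ ω, f ω ^ (5 : ℕ) * B s ω ∂μ ∂ν := by
        rw [lintegral_add_left (by fun_prop), lintegral_lintegral_swap]
        refine Measurable.aemeasurable (Measurable.mul (by fun_prop) ?_)
        exact hB.comp (by fun_prop : Measurable fun q : Ω × S => (q.2, q.1))
    _ ≤ X ^ (5 / 6 : ℝ) * a + ∫⁻ s, X ^ (5 / 6 : ℝ) * b s ∂ν := by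
        gcongr ?_ + ?_
        · exact hold A a hA ha
        · refine lintegral_mono_ae ?_
          filter_upwards [hb] with s hs
          exact hold _ _ (hB.comp (by fun_prop : Measurable fun ω : Ω => (s, ω))) hs
    _ = _ := by rw [lintegral_const_mul' _ _ (by finiteness), mul_add]

lemma measurable_fourierInv_param {α : Type*} [MeasurableSpace α] {U : α → ℝ → ℂ}
    (hU : Measurable (fun q : α × ℝ => U q.1 q.2)) :
    Measurable (fun q : α × ℝ => 𝓕⁻ (U q.1) q.2) := by
  simp_rw [Real.fourierInv_eq']
  refine (StronglyMeasurable.integral_prod_right (ν := (volume : Measure ℝ))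
    (f := fun (q : α × ℝ) (v : ℝ) =>
      Complex.exp (((2 * π * inner ℝ v q.2 : ℝ) : ℂ) * Complex.I) • U q.1 v)
    ?_).measurable
  refine Measurable.stronglyMeasurable ?_
  have : Measurable (fun a : (α × ℝ) × ℝ => U a.1.1 a.2) :=
    hU.comp (by fun_prop : Measurable fun a : (α × ℝ) × ℝ => (a.1.1, a.2))
  fun_prop

lemma norm_fourierInv_le (G : ℝ → ℂ) (x : ℝ) : ‖𝓕⁻ G x‖ ≤ ∫ ξ, ‖G ξ‖ := by
  rw [Real.fourierInv_eq']
  refine (norm_integral_le_integral_norm _).trans (le_of_eq ?_)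
  refine integral_congr_ae (Filter.Eventually.of_forall fun ξ => ?_)
  simp only [norm_smul, Complex.norm_exp_ofReal_mul_I, one_mul]

lemma integrable_exp_smul {α : Type*} [MeasurableSpace α] {μ : Measure α} {F : α → ℂ} {k : α → ℝ}
    (hk : Measurable k) (hF : Integrable F μ) :
    Integrable (fun a => Complex.exp ((k a : ℂ) * Complex.I) • F a) μ := by
  have hm : AEStronglyMeasurable (fun a => Complex.exp ((k a : ℂ) * Complex.I)) μ :=
    Measurable.aestronglyMeasurable (by fun_prop)
  refine hF.mono (hm.smul hF.aestronglyMeasurable) (Filter.Eventually.of_forall fun a => ?_)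
  rw [norm_smul, Complex.norm_exp_ofReal_mul_I, one_mul]

/-- A decaying solution of the cubic NLS on the frequency side, on the time interval `[0,1]`. -/
structure FreqSol (U : ℝ → ℝ → ℂ) : Prop where
  meas : Measurable (fun q : ℝ × ℝ => U q.1 q.2)
  decay : ∃ C, ∀ t ∈ Set.Icc (0 : ℝ) 1, HasDec 4 C (U t)
  deriv : ∀ t ∈ Set.Icc (0 : ℝ) 1, ∀ ξ, HasDerivAt (fun τ => U τ ξ)
    (Complex.I * (conv3 (U t) ξ - (4 * π ^ 2 * ξ ^ 2 : ℝ) * U t ξ)) t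

/-- The nonlinearity in the interaction picture. -/
def inter (U : ℝ → ℝ → ℂ) (s : ℝ) : ℝ → ℂ := schr (-s) (fun ξ => Complex.I * conv3 (U s) ξ)

lemma measurable_schr_param {α : Type*} [MeasurableSpace α] {U : α → ℝ → ℂ} {τ : α → ℝ}
    (hτ : Measurable τ) (hU : Measurable (fun q : α × ℝ => U q.1 q.2)) :
    Measurable (fun q : α × ℝ => schr (τ q.1) (U q.1) q.2) := by
  unfold schr
  fun_prop

lemma measurable_inter {U : ℝ → ℝ → ℂ} (hU : Measurable (fun q : ℝ × ℝ => U q.1 q.2)) :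
    Measurable (fun q : ℝ × ℝ => inter U q.1 q.2) := by
  unfold inter
  exact measurable_schr_param (U := fun s ξ => Complex.I * conv3 (U s) ξ) measurable_neg
    ((measurable_conv3_param hU).const_mul _)

lemma norm_inter (U : ℝ → ℝ → ℂ) (s ξ : ℝ) : ‖inter U s ξ‖ = ‖conv3 (U s) ξ‖ := by
  rw [inter, norm_schr, norm_mul, Complex.norm_I, one_mul]

lemma schr_zero (G : ℝ → ℂ) : schr 0 G = G := by
  ext ξ; simp [schr]

lemma schr_add (s t : ℝ) (G : ℝ → ℂ) : schr s (schr t G) = schr (s + t) G := by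
  ext ξ
  simp only [schr]
  rw [← mul_assoc, ← Complex.exp_add]
  congr 2
  push_cast
  ring

lemma FreqSol.conv3_decay {U : ℝ → ℝ → ℂ} (h : FreqSol U) :
    ∃ C, ∀ t ∈ Set.Icc (0 : ℝ) 1, HasDec 2 C (conv3 (U t)) := by
  obtain ⟨C, hC⟩ := h.decay
  exact ⟨_, fun t ht => (hC t ht).conv3⟩

lemma FreqSol.duhamel {U : ℝ → ℝ → ℂ} (h : FreqSol U) {t : ℝ} (ht : t ∈ Set.Icc (0 : ℝ) 1)
    (ξ : ℝ) : schr (-t) (U t) ξ = U 0 ξ + ∫ s in 0..t, inter U s ξ := by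
  obtain ⟨C, hC⟩ := h.conv3_decay
  have hsub : Set.uIcc 0 t ⊆ Set.Icc 0 1 := by
    rw [Set.uIcc_of_le ht.1]; exact Set.Icc_subset_Icc le_rfl ht.2
  have hd : ∀ s ∈ Set.uIcc 0 t, HasDerivAt (fun τ => schr (-τ) (U τ) ξ) (inter U s ξ) s := by
    intro s hs
    have h1 := h.deriv s (hsub hs) ξ
    have h2 : HasDerivAt (fun τ : ℝ =>
        Complex.exp (((-(4 * π ^ 2 * (-τ) * ξ ^ 2) : ℝ) : ℂ) * Complex.I))
        (Complex.exp (((-(4 * π ^ 2 * (-s) * ξ ^ 2) : ℝ) : ℂ) * Complex.I)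
          * (((4 * π ^ 2 * ξ ^ 2 : ℝ) : ℂ) * Complex.I)) s := by
      refine HasDerivAt.cexp (HasDerivAt.mul_const (HasDerivAt.ofReal_comp ?_) _)
      have := (hasDerivAt_id s).const_mul (4 * π ^ 2 * ξ ^ 2)
      simp only [mul_one, id] at this
      refine this.congr_of_eventuallyEq (Filter.Eventually.of_forall fun τ => ?_)
      simp only []
      ring
    refine (h2.mul h1).congr_deriv ?_
    simp only [inter, schr]
    push_cast
    ring
  have hi : IntervalIntegrable (fun s => inter U s ξ) volume 0 t := by
    rw [intervalIntegrable_iff, Set.uIoc_of_le ht.1]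
    refine Measure.integrableOn_of_bounded (M := C * dec 2 ξ) (by simp) ?_ ?_
    · exact ((measurable_inter h.meas).comp
        (by fun_prop : Measurable fun s : ℝ => (s, ξ))).aestronglyMeasurable
    · refine (ae_restrict_mem measurableSet_Ioc).mono fun s hs => ?_
      rw [norm_inter]
      exact (hC s ⟨hs.1.le, hs.2.trans ht.2⟩).bound ξ
  have := intervalIntegral.integral_eq_sub_of_hasDerivAt hd hi
  rw [this, neg_zero, schr_zero]
  ring

lemma schr_indicator (t : ℝ) (J : Set ℝ) (G : ℝ → ℂ) :
    schr t (J.indicator G) = J.indicator (schr t G) := by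
  ext ξ
  by_cases h : ξ ∈ J <;> simp [schr, h]

lemma FreqSol.duhamel_indicator {U : ℝ → ℝ → ℂ} (h : FreqSol U) {t : ℝ}
    (ht : t ∈ Set.Icc (0 : ℝ) 1) (J : Set ℝ) (ξ : ℝ) :
    J.indicator (U t) ξ = schr t (J.indicator (U 0)) ξ
      + ∫ s in Set.Ioc 0 t, schr t (J.indicator (inter U s)) ξ := by
  simp_rw [schr_indicator]
  by_cases hξ : ξ ∈ J
  · simp only [Set.indicator_of_mem hξ]
    have h1 := h.duhamel ht ξ
    rw [intervalIntegral.integral_of_le ht.1] at h1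
    have h2 : U t ξ = schr t (schr (-t) (U t)) ξ := by
      rw [schr_add, add_neg_cancel, schr_zero]
    rw [h2]
    conv_lhs => rw [schr, h1]
    simp only [schr]
    rw [integral_const_mul, mul_add]
  · simp [Set.indicator_of_notMem hξ]

lemma FreqSol.fourierInv_indicator_le {U : ℝ → ℝ → ℂ} (h : FreqSol U) {t T : ℝ}
    (ht : t ∈ Set.Icc (0 : ℝ) T) (hT : T ≤ 1) {J : Set ℝ} (hJ : MeasurableSet J) (x : ℝ) :
    ‖𝓕⁻ (J.indicator (U t)) x‖ₑ ≤ ‖𝓕⁻ (schr t (J.indicator (U 0))) x‖ₑ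
      + ∫⁻ s in Set.Ioc 0 T, ‖𝓕⁻ (schr t (J.indicator (inter U s))) x‖ₑ := by
  have ht1 : t ∈ Set.Icc (0 : ℝ) 1 := ⟨ht.1, ht.2.trans hT⟩
  obtain ⟨C, hC⟩ := h.decay
  obtain ⟨D, hD⟩ := h.conv3_decay
  have hm : Measurable (fun q : ℝ × ℝ => schr t (J.indicator (inter U q.1)) q.2) := by
    refine measurable_schr_param (τ := fun _ : ℝ => t) (U := fun s => J.indicator (inter U s))
      measurable_const ?_
    exact (measurable_inter h.meas).indicator (measurable_snd hJ)
  have hi : Integrable (fun q : ℝ × ℝ => schr t (J.indicator (inter U q.1)) q.2)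
      ((volume.restrict (Set.Ioc 0 t)).prod volume) := by
    have h0 : Integrable (fun q : ℝ × ℝ => (D * dec 2 q.2 : ℝ))
        ((volume.restrict (Set.Ioc 0 t)).prod volume) := by
      exact ((integrable_dec (m := 2) (by norm_num)).const_mul D).comp_snd _
    refine h0.mono' hm.aestronglyMeasurable ?_
    have : ∀ᵐ s ∂(volume.restrict (Set.Ioc 0 t)), s ∈ Set.Icc (0 : ℝ) 1 :=
      (ae_restrict_mem measurableSet_Ioc).mono fun s hs => ⟨hs.1.le, hs.2.trans ht1.2⟩
    filter_upwards [Measure.quasiMeasurePreserving_fst.ae this] with q hq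
    rw [norm_schr]
    refine (norm_indicator_le_norm_self _ _).trans ?_
    rw [norm_inter]
    exact (hD _ hq).bound _
  have key : 𝓕⁻ (J.indicator (U t)) x = 𝓕⁻ (schr t (J.indicator (U 0))) x
      + ∫ s in Set.Ioc 0 t, 𝓕⁻ (schr t (J.indicator (inter U s))) x := by
    simp_rw [Real.fourierInv_eq']
    rw [integral_integral_swap, ← integral_add]
    · refine integral_congr_ae (Filter.Eventually.of_forall fun ξ => ?_)
      dsimp only
      rw [h.duhamel_indicator ht1 J ξ, smul_add]
      simp only [smul_eq_mul]
      rw [integral_const_mul]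
    · have := (hC 0 (by simp)).indicator hJ
      refine integrable_exp_smul (k := fun ξ => 2 * π * inner ℝ ξ x) (by fun_prop) ?_
      exact (this.integrable (by norm_num)).mono
        (by have := this.meas; unfold schr; fun_prop)
        (Filter.Eventually.of_forall fun ξ => (norm_schr _ _ _).le)
    · exact (integrable_exp_smul (k := fun q : ℝ × ℝ => 2 * π * inner ℝ q.2 x)
        (by fun_prop) hi).integral_prod_right
    · exact integrable_exp_smul (k := fun q : ℝ × ℝ => 2 * π * inner ℝ q.2 x)
        (by fun_prop) hi
  rw [key]
  refine (enorm_add_le _ _).trans ?_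
  gcongr
  refine (enorm_integral_le_lintegral_enorm _).trans ?_
  exact lintegral_mono_set (Set.Ioc_subset_Ioc le_rfl ht.2)

/-- The squared `L²` norm of `G` restricted to `J`. -/
def massOn (J : Set ℝ) (G : ℝ → ℂ) : ℝ≥0∞ := ∫⁻ ξ, ‖J.indicator G ξ‖ₑ ^ (2 : ℕ)

lemma massOn_mono {J J' : Set ℝ} (h : J ⊆ J') (G : ℝ → ℂ) : massOn J G ≤ massOn J' G := by
  refine lintegral_mono fun ξ => ?_
  dsimp only
  gcongr 1
  rw [enorm_indicator_eq_indicator_enorm, enorm_indicator_eq_indicator_enorm]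
  exact Set.indicator_le_indicator_of_subset h (fun _ => zero_le) ξ

/-- The amount of mass on `J` available to the solution up to time `T`. -/
def amount (U : ℝ → ℝ → ℂ) (T : ℝ) (J : Set ℝ) : ℝ≥0∞ :=
  massOn J (U 0) + ENNReal.ofReal T * ∫⁻ s in Set.Ioc 0 T, massOn J (conv3 (U s))

@[gcongr]
lemma amount_mono {U : ℝ → ℝ → ℂ} {T : ℝ} {J J' : Set ℝ} (h : J ⊆ J') :
    amount U T J ≤ amount U T J' := by
  unfold amount
  gcongr
  · exact massOn_mono h _
  · exact massOn_mono h _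

lemma HasDec.massOn_le {m : ℕ} {C : ℝ} {G : ℝ → ℂ} (h : HasDec m C G) (hm : 1 ≤ m) (J : Set ℝ) :
    massOn J G ≤ ENNReal.ofReal (C ^ 2 * π) := by
  have hC := h.nonneg
  calc massOn J G ≤ ∫⁻ ξ, ENNReal.ofReal (C ^ 2 * dec 1 ξ) := by
        refine lintegral_mono fun ξ => ?_
        dsimp only
        rw [← ofReal_norm, ← ENNReal.ofReal_pow (norm_nonneg _)]
        refine ENNReal.ofReal_le_ofReal ?_
        have h1 : ‖J.indicator G ξ‖ ≤ C * dec 1 ξ :=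
          (norm_indicator_le_norm_self _ _).trans ((h.mono_m hm).bound ξ)
        have h2 := dec_le_one 1 ξ
        have h3 := (dec_pos 1 ξ).le
        calc _ ≤ (C * dec 1 ξ) ^ 2 := by gcongr
          _ = C ^ 2 * (dec 1 ξ * dec 1 ξ) := by ring
          _ ≤ C ^ 2 * (dec 1 ξ * 1) := by gcongr
          _ = _ := by ring
    _ = _ := by
        rw [← ofReal_integral_eq_lintegral_ofReal ((integrable_dec le_rfl).const_mul _)
          (Filter.Eventually.of_forall fun ξ => by have := (dec_pos 1 ξ).le; positivity),
          integral_const_mul, dec_one_eq, integral_univ_inv_one_add_sq]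

lemma measurable_massOn_param {α : Type*} [MeasurableSpace α] {U : α → ℝ → ℂ}
    (hU : Measurable (fun q : α × ℝ => U q.1 q.2)) {J : Set ℝ} (hJ : MeasurableSet J) :
    Measurable (fun a => massOn J (U a)) := by
  unfold massOn
  refine Measurable.lintegral_prod_right' (f := fun q : α × ℝ => ‖J.indicator (U q.1) q.2‖ₑ ^ 2) ?_
  have : Measurable (fun q : α × ℝ => J.indicator (U q.1) q.2) :=
    hU.indicator (measurable_snd hJ)
  fun_prop

lemma FreqSol.lintegral_six_ne_top {U : ℝ → ℝ → ℂ} (h : FreqSol U) {T : ℝ}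
    (hT : T ≤ 1) {J : Set ℝ} (hJ : MeasurableSet J) :
    ∫⁻ q : ℝ × ℝ, ‖𝓕⁻ (J.indicator (U q.1)) q.2‖ₑ ^ (6 : ℕ)
      ∂((volume.restrict (Set.Ioc 0 T)).prod volume) ≠ ⊤ := by
  obtain ⟨C, hC⟩ := h.decay
  have hm : Measurable (fun q : ℝ × ℝ => 𝓕⁻ (J.indicator (U q.1)) q.2) :=
    measurable_fourierInv_param (U := fun t => J.indicator (U t))
      (h.meas.indicator (measurable_snd hJ))
  rw [lintegral_prod _ (hm.enorm.pow_const 6).aemeasurable]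
  have hb : ∀ t ∈ Set.Ioc 0 T, ∫⁻ x, ‖𝓕⁻ (J.indicator (U t)) x‖ₑ ^ (6 : ℕ)
      ≤ ENNReal.ofReal (C * π) ^ (4 : ℕ) * ENNReal.ofReal (C ^ 2 * π) := by
    intro t ht
    have hd := hC t ⟨ht.1.le, ht.2.trans hT⟩
    have hd' := hd.indicator hJ
    have hsup : ∀ x, ‖𝓕⁻ (J.indicator (U t)) x‖ₑ ≤ ENNReal.ofReal (C * π) := by
      intro x
      rw [← ofReal_norm]
      refine ENNReal.ofReal_le_ofReal ((norm_fourierInv_le _ _).trans ?_)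
      calc _ ≤ ∫ ξ, C * dec 1 ξ := by
            refine integral_mono (hd'.integrable (by norm_num)).norm
              ((integrable_dec le_rfl).const_mul C) fun ξ => ?_
            exact (hd'.mono_m (by norm_num)).bound ξ
        _ = _ := by rw [integral_const_mul, dec_one_eq, integral_univ_inv_one_add_sq]
    calc _ ≤ ∫⁻ x, ENNReal.ofReal (C * π) ^ (4 : ℕ) * ‖𝓕⁻ (J.indicator (U t)) x‖ₑ ^ (2 : ℕ) := by
          refine lintegral_mono fun x => ?_
          dsimp only
          rw [show (6 : ℕ) = 4 + 2 from rfl, pow_add]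
          have := hsup x
          gcongr
      _ ≤ _ := by
          rw [lintegral_const_mul' _ _ (by finiteness)]
          gcongr
          refine (lintegral_fourierInv_sq_le _ hd'.meas.aestronglyMeasurable).trans ?_
          exact hd.massOn_le (by norm_num) J
  refine ne_top_of_le_ne_top ?_ (setLIntegral_mono' measurableSet_Ioc hb)
  rw [setLIntegral_const, Real.volume_Ioc]
  exact ENNReal.mul_ne_top (by finiteness) ENNReal.ofReal_ne_top

lemma measurable_fourierInv_schr {G : ℝ → ℂ} (hG : Measurable G) :
    Measurable (fun q : ℝ × ℝ => 𝓕⁻ (schr q.1 G) q.2) := by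
  have h0 : Measurable (fun q : ℝ × ℝ => G q.2) := hG.comp measurable_snd
  have h1 : Measurable (fun q : ℝ × ℝ => schr q.1 G q.2) :=
    measurable_schr_param (τ := fun t : ℝ => t) (U := fun _ => G) measurable_id h0
  exact measurable_fourierInv_param (U := fun t => schr t G) h1

lemma lintegral_schr_six_restrict_le {K : ℝ≥0∞}
    (hK : ∀ G : ℝ → ℂ, Measurable G → Integrable G →
    ∫⁻ t, ∫⁻ x, ‖𝓕⁻ (schr t G) x‖ₑ ^ (6 : ℕ) ≤ K * (∫⁻ x, ‖G x‖ₑ ^ (2 : ℕ)) ^ (3 : ℕ))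
    (I : Set ℝ) {G : ℝ → ℂ} (hG : Measurable G) (hGi : Integrable G) :
    ∫⁻ q : ℝ × ℝ, ‖𝓕⁻ (schr q.1 G) q.2‖ₑ ^ (6 : ℕ) ∂((volume.restrict I).prod volume)
      ≤ (K ^ (1 / 6 : ℝ) * (∫⁻ x, ‖G x‖ₑ ^ (2 : ℕ)) ^ (1 / 2 : ℝ)) ^ (6 : ℕ) := by
  have hm : Measurable (fun q : ℝ × ℝ => 𝓕⁻ (schr q.1 G) q.2) :=
    measurable_fourierInv_schr hG
  rw [lintegral_prod _ (hm.enorm.pow_const 6).aemeasurable]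
  refine (setLIntegral_le_lintegral _ _).trans ((hK G hG hGi).trans (le_of_eq ?_))
  generalize (∫⁻ x, ‖G x‖ₑ ^ (2 : ℕ)) = m
  rw [mul_pow]
  congr 1
  · rw [← ENNReal.rpow_natCast, ← ENNReal.rpow_mul]
    norm_num
  · rw [← ENNReal.rpow_natCast, ← ENNReal.rpow_natCast, ← ENNReal.rpow_mul]
    norm_num

lemma measurable_schr_inter {U : ℝ → ℝ → ℂ} (hU : Measurable (fun q : ℝ × ℝ => U q.1 q.2))
    {J : Set ℝ} (hJ : MeasurableSet J) : Measurable (fun q : ℝ × (ℝ × ℝ) =>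
      ‖𝓕⁻ (schr q.2.1 (J.indicator (inter U q.1))) q.2.2‖ₑ) := by
  have hmV : Measurable (fun q : ℝ × ℝ => J.indicator (inter U q.1) q.2) :=
    (measurable_inter hU).indicator (measurable_snd hJ)
  have h0 : Measurable (fun a : (ℝ × ℝ) × ℝ => J.indicator (inter U a.1.1) a.2) :=
    hmV.comp (by fun_prop : Measurable fun a : (ℝ × ℝ) × ℝ => (a.1.1, a.2))
  have h1 : Measurable (fun q : (ℝ × ℝ) × ℝ => schr q.1.2 (J.indicator (inter U q.1.1)) q.2) :=
    measurable_schr_param (τ := fun a : ℝ × ℝ => a.2)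
      (U := fun (a : ℝ × ℝ) => J.indicator (inter U a.1)) measurable_snd h0
  have h2 : Measurable (fun q : (ℝ × ℝ) × ℝ =>
      𝓕⁻ (schr q.1.2 (J.indicator (inter U q.1.1))) q.2) := measurable_fourierInv_param
    (U := fun (a : ℝ × ℝ) => schr a.2 (J.indicator (inter U a.1))) h1
  have h3 : Measurable fun q : ℝ × (ℝ × ℝ) => ((q.1, q.2.1), q.2.2) := by fun_prop
  exact (Measurable.comp (g := fun q : (ℝ × ℝ) × ℝ =>
      𝓕⁻ (schr q.1.2 (J.indicator (inter U q.1.1))) q.2) h2 h3).enorm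

lemma massOn_inter (U : ℝ → ℝ → ℂ) (J : Set ℝ) (s : ℝ) :
    ∫⁻ x, ‖J.indicator (inter U s) x‖ₑ ^ (2 : ℕ) = massOn J (conv3 (U s)) := by
  refine lintegral_congr fun ξ => ?_
  congr 1
  by_cases hξ : ξ ∈ J
  · simp only [Set.indicator_of_mem hξ]
    rw [← ofReal_norm, norm_inter, ofReal_norm]
  · simp [Set.indicator_of_notMem hξ]

lemma amount_six {K : ℝ≥0∞} {U : ℝ → ℝ → ℂ} {T : ℝ} {J : Set ℝ}
    (hβm : Measurable (fun s => massOn J (conv3 (U s)))) :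
    (K ^ (1 / 6 : ℝ) * massOn J (U 0) ^ (1 / 2 : ℝ) + ∫⁻ s in Set.Ioc 0 T,
      K ^ (1 / 6 : ℝ) * massOn J (conv3 (U s)) ^ (1 / 2 : ℝ)) ^ (6 : ℕ)
      ≤ 8 * K * amount U T J ^ (3 : ℕ) := by
  have hsq : (massOn J (U 0) ^ (1 / 2 : ℝ) + ∫⁻ s in Set.Ioc 0 T,
      massOn J (conv3 (U s)) ^ (1 / 2 : ℝ)) ^ (2 : ℕ) ≤ 2 * amount U T J := by
    refine (add_sq_le_two _ _).trans ?_
    unfold amount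
    gcongr
    · exact (rpow_half_sq (massOn J (U 0))).le
    · have h3 := lintegral_mul_sq_le (μ := volume.restrict (Set.Ioc 0 T)) (f := fun _ => 1)
        (g := fun s => massOn J (conv3 (U s)) ^ (1 / 2 : ℝ)) aemeasurable_const
        (hβm.pow_const _).aemeasurable
      simp only [rpow_half_sq] at h3
      simpa using h3
  rw [lintegral_const_mul _ (hβm.pow_const _), ← mul_add, mul_pow]
  have h6 : (K ^ (1 / 6 : ℝ)) ^ (6 : ℕ) = K := by
    rw [← ENNReal.rpow_natCast, ← ENNReal.rpow_mul]; norm_num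
  rw [h6]
  generalize (massOn J (U 0) ^ (1 / 2 : ℝ) + ∫⁻ s in Set.Ioc 0 T,
      massOn J (conv3 (U s)) ^ (1 / 2 : ℝ)) = m at hsq ⊢
  rw [show m ^ 6 = (m ^ 2) ^ 3 by ring]
  calc _ ≤ K * (2 * amount U T J) ^ (3 : ℕ) := by gcongr
    _ = _ := by rw [mul_pow]; ring

lemma FreqSol.lintegral_six_le {U : ℝ → ℝ → ℂ} (h : FreqSol U) {K : ℝ≥0∞}
    (hK : ∀ G : ℝ → ℂ, Measurable G → Integrable G →
    ∫⁻ t, ∫⁻ x, ‖𝓕⁻ (schr t G) x‖ₑ ^ (6 : ℕ) ≤ K * (∫⁻ x, ‖G x‖ₑ ^ (2 : ℕ)) ^ (3 : ℕ)) {T : ℝ}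
    (hT : T ≤ 1) {J : Set ℝ} (hJ : MeasurableSet J) :
    ∫⁻ q : ℝ × ℝ, ‖𝓕⁻ (J.indicator (U q.1)) q.2‖ₑ ^ (6 : ℕ)
      ∂((volume.restrict (Set.Ioc 0 T)).prod volume) ≤ 8 * K * amount U T J ^ (3 : ℕ) := by
  obtain ⟨C, hC⟩ := h.decay
  obtain ⟨D, hD⟩ := h.conv3_decay
  have hβm : Measurable (fun s => massOn J (conv3 (U s))) :=
    measurable_massOn_param (measurable_conv3_param h.meas) hJ
  have hm : Measurable (fun q : ℝ × ℝ => ‖𝓕⁻ (J.indicator (U q.1)) q.2‖ₑ) :=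
    (measurable_fourierInv_param (U := fun t => J.indicator (U t))
      (h.meas.indicator (measurable_snd hJ))).enorm
  have h0 := (hC 0 (by simp)).indicator hJ
  refine (lintegral_pow_six_le
    (B := fun s (q : ℝ × ℝ) => ‖𝓕⁻ (schr q.1 (J.indicator (inter U s))) q.2‖ₑ) (ν := volume.restrict (Set.Ioc 0 T)) hm
    (measurable_fourierInv_schr h0.meas).enorm (measurable_schr_inter h.meas hJ) ?_
    (h.lintegral_six_ne_top hT hJ)
    (lintegral_schr_six_restrict_le hK _ h0.meas (h0.integrable (by norm_num)))
    (b := fun s => K ^ (1 / 6 : ℝ) * massOn J (conv3 (U s)) ^ (1 / 2 : ℝ)) ?_).trans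
    (amount_six hβm)
  · have : ∀ᵐ s ∂(volume.restrict (Set.Ioc 0 T)), s ∈ Set.Ioc 0 T := ae_restrict_mem measurableSet_Ioc
    filter_upwards [Measure.quasiMeasurePreserving_fst.ae this] with q hq
    exact h.fourierInv_indicator_le ⟨hq.1.le, hq.2⟩ hT hJ q.2
  · refine (ae_restrict_mem measurableSet_Ioc).mono fun s hs => ?_
    have hd : HasDec 2 D (inter U s) := ⟨(measurable_inter h.meas).of_uncurry_left, fun ξ => by
      rw [norm_inter]; exact (hD s ⟨hs.1.le, hs.2.trans hT⟩).bound ξ⟩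
    have := hd.indicator hJ
    have h2 := lintegral_schr_six_restrict_le hK (Set.Ioc 0 T) this.meas
      (this.integrable (by norm_num))
    rwa [massOn_inter] at h2

lemma fourierInv_sub {F G : ℝ → ℂ} (hF : Integrable F) (hG : Integrable G) (x : ℝ) :
    𝓕⁻ (fun ξ => F ξ - G ξ) x = 𝓕⁻ F x - 𝓕⁻ G x := by
  simp_rw [Real.fourierInv_eq', smul_sub]
  exact integral_sub
    (integrable_exp_smul (k := fun ξ => 2 * π * inner ℝ ξ x) (by fun_prop) hF)
    (integrable_exp_smul (k := fun ξ => 2 * π * inner ℝ ξ x) (by fun_prop) hG)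

lemma enorm_cubic_sub_sq_le (u w : ℂ) :
    ‖u * ((starRingEnd ℂ) u * u) - w * ((starRingEnd ℂ) w * w)‖ₑ ^ (2 : ℕ)
      ≤ 8 * (‖u - w‖ₑ ^ (2 : ℕ) * ‖u‖ₑ ^ (4 : ℕ) + ‖u - w‖ₑ ^ (2 : ℕ) * ‖w‖ₑ ^ (4 : ℕ)) := by
  have h : ‖u * ((starRingEnd ℂ) u * u) - w * ((starRingEnd ℂ) w * w)‖
      ≤ 2 * (‖u - w‖ * (‖u‖ ^ 2 + ‖w‖ ^ 2)) := by
    have h1 : u * ((starRingEnd ℂ) u * u) - w * ((starRingEnd ℂ) w * w)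
        = u * u * (starRingEnd ℂ) (u - w) + (u - w) * ((starRingEnd ℂ) w * (u + w)) := by
      simp only [map_sub]; ring
    rw [h1]
    refine (norm_add_le _ _).trans ?_
    simp only [norm_mul, RCLike.norm_conj]
    have h2 : ‖u - w‖ * (‖w‖ * ‖u + w‖) ≤ ‖u - w‖ * (‖w‖ * (‖u‖ + ‖w‖)) := by
      gcongr; exact norm_add_le _ _
    nlinarith [mul_nonneg (norm_nonneg (u - w)) (sq_nonneg (‖u‖ - ‖w‖)),
      mul_nonneg (norm_nonneg (u - w)) (sq_nonneg (‖u‖)),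
      mul_nonneg (norm_nonneg (u - w)) (sq_nonneg (‖w‖))]
  have h2 : ‖u * ((starRingEnd ℂ) u * u) - w * ((starRingEnd ℂ) w * w)‖ ^ 2
      ≤ 8 * (‖u - w‖ ^ 2 * ‖u‖ ^ 4 + ‖u - w‖ ^ 2 * ‖w‖ ^ 4) := by
    calc _ ≤ (2 * (‖u - w‖ * (‖u‖ ^ 2 + ‖w‖ ^ 2))) ^ 2 := by gcongr
      _ ≤ _ := by nlinarith [mul_nonneg (sq_nonneg ‖u - w‖) (sq_nonneg (‖u‖ ^ 2 - ‖w‖ ^ 2))]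
  simp_rw [← ofReal_norm]
  simp_rw [← ENNReal.ofReal_pow (norm_nonneg _)]
  rw [← ENNReal.ofReal_mul (by positivity), ← ENNReal.ofReal_mul (by positivity),
    ← ENNReal.ofReal_add (by positivity) (by positivity),
    show (8 : ℝ≥0∞) = ENNReal.ofReal 8 by norm_num, ← ENNReal.ofReal_mul (by norm_num)]
  exact ENNReal.ofReal_le_ofReal h2

lemma lintegral_sq_mul_fourth_le {Ω : Type*} [MeasurableSpace Ω] {μ : Measure Ω}
    {f g : Ω → ℝ≥0∞} (hf : Measurable f) (hg : Measurable g) {k a b : ℝ≥0∞}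
    (ha : ∫⁻ ω, f ω ^ (6 : ℕ) ∂μ ≤ k * a ^ (3 : ℕ))
    (hb : ∫⁻ ω, g ω ^ (6 : ℕ) ∂μ ≤ k * b ^ (3 : ℕ)) :
    ∫⁻ ω, f ω ^ (2 : ℕ) * g ω ^ (4 : ℕ) ∂μ ≤ k * (a * b ^ (2 : ℕ)) := by
  have hpq : Real.HolderConjugate 3 (3 / 2) := by
    rw [Real.holderConjugate_iff]; norm_num
  have h := ENNReal.lintegral_mul_le_Lp_mul_Lq μ hpq (f := fun ω => f ω ^ (2 : ℕ))
    (g := fun ω => g ω ^ (4 : ℕ)) (hf.pow_const 2).aemeasurable (hg.pow_const 4).aemeasurable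
  refine h.trans ?_
  have e1 : ∀ x : ℝ≥0∞, (x ^ (2 : ℕ)) ^ (3 : ℝ) = x ^ (6 : ℕ) := fun x => by
    rw [← ENNReal.rpow_natCast, ← ENNReal.rpow_natCast, ← ENNReal.rpow_mul]; norm_num
  have e2 : ∀ x : ℝ≥0∞, (x ^ (4 : ℕ)) ^ (3 / 2 : ℝ) = x ^ (6 : ℕ) := fun x => by
    rw [← ENNReal.rpow_natCast, ← ENNReal.rpow_natCast, ← ENNReal.rpow_mul]; norm_num
  simp_rw [e1, e2]
  calc _ ≤ (k * a ^ (3 : ℕ)) ^ (1 / 3 : ℝ) * (k * b ^ (3 : ℕ)) ^ (1 / (3 / 2) : ℝ) := by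
        gcongr
    _ = (k ^ (1 / 3 : ℝ) * k ^ (2 / 3 : ℝ)) * ((a ^ (3 : ℕ)) ^ (1 / 3 : ℝ)
          * (b ^ (3 : ℕ)) ^ (2 / 3 : ℝ)) := by
        rw [show (1 / (3 / 2) : ℝ) = 2 / 3 by norm_num,
          ENNReal.mul_rpow_of_nonneg _ _ (by norm_num),
          ENNReal.mul_rpow_of_nonneg _ _ (by norm_num)]
        ring
    _ = _ := by
        rw [← ENNReal.rpow_add_of_nonneg _ _ (by norm_num) (by norm_num)]
        congr 1
        · norm_num
        · congr 1
          · rw [← ENNReal.rpow_natCast, ← ENNReal.rpow_mul]; norm_num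
          · rw [← ENNReal.rpow_natCast, ← ENNReal.rpow_natCast, ← ENNReal.rpow_mul]; norm_num

lemma massOn_conv3_le {C : ℝ} {G : ℝ → ℂ} (hG : HasDec 4 C G) {J J' : Set ℝ}
    (hJ' : MeasurableSet J') (hz : ∀ p ∈ J, conv3 (J'ᶜ.indicator G) p = 0) :
    massOn J (conv3 G) ≤ ∫⁻ x, 8 * (‖𝓕⁻ (J'.indicator G) x‖ₑ ^ (2 : ℕ)
        * ‖𝓕⁻ (Set.univ.indicator G) x‖ₑ ^ (4 : ℕ)
      + ‖𝓕⁻ (J'.indicator G) x‖ₑ ^ (2 : ℕ) * ‖𝓕⁻ (J'ᶜ.indicator G) x‖ₑ ^ (4 : ℕ)) := by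
  have hw := hG.indicator hJ'.compl
  have hv := hG.indicator hJ'
  have h3 := hG.conv3
  have hw3 := hw.conv3
  have h4 : (1 : ℕ) ≤ 4 := by norm_num
  have hx : ∀ x, 𝓕⁻ (J'.indicator G) x = 𝓕⁻ G x - 𝓕⁻ (J'ᶜ.indicator G) x := by
    intro x
    rw [← fourierInv_sub (hG.integrable h4) (hw.integrable h4)]
    refine congrArg (fun F : ℝ → ℂ => 𝓕⁻ F x) (funext fun ξ => ?_)
    by_cases h : ξ ∈ J' <;> simp [h]
  have hH : ∀ x, 𝓕⁻ (fun ξ => conv3 G ξ - conv3 (J'ᶜ.indicator G) ξ) x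
      = 𝓕⁻ G x * ((starRingEnd ℂ) (𝓕⁻ G x) * 𝓕⁻ G x) - 𝓕⁻ (J'ᶜ.indicator G) x
        * ((starRingEnd ℂ) (𝓕⁻ (J'ᶜ.indicator G) x) * 𝓕⁻ (J'ᶜ.indicator G) x) := by
    intro x
    rw [fourierInv_sub (h3.integrable (by norm_num)) (hw3.integrable (by norm_num)),
      fourierInv_conv3 (hG.integrable h4), fourierInv_conv3 (hw.integrable h4)]
  calc massOn J (conv3 G) ≤ ∫⁻ ξ, ‖conv3 G ξ - conv3 (J'ᶜ.indicator G) ξ‖ₑ ^ (2 : ℕ) := by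
        refine lintegral_mono fun ξ => ?_
        dsimp only
        by_cases hξ : ξ ∈ J
        · rw [Set.indicator_of_mem hξ, hz ξ hξ, sub_zero]
        · simp [Set.indicator_of_notMem hξ]
    _ = ∫⁻ x, ‖𝓕⁻ (fun ξ => conv3 G ξ - conv3 (J'ᶜ.indicator G) ξ) x‖ₑ ^ (2 : ℕ) :=
        (lintegral_fourierInv_sq
          ((h3.integrable (by norm_num)).sub (hw3.integrable (by norm_num)))
          ((h3.memLp (by norm_num)).sub (hw3.memLp (by norm_num)))).symm
    _ ≤ _ := by
        refine lintegral_mono fun x => ?_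
        dsimp only
        rw [hH, hx, Set.indicator_univ]
        exact enorm_cubic_sub_sq_le _ _

lemma FreqSol.lintegral_massOn_conv3_le {U : ℝ → ℝ → ℂ} (h : FreqSol U) {K : ℝ≥0∞}
    (hK : ∀ G : ℝ → ℂ, Measurable G → Integrable G →
    ∫⁻ t, ∫⁻ x, ‖𝓕⁻ (schr t G) x‖ₑ ^ (6 : ℕ) ≤ K * (∫⁻ x, ‖G x‖ₑ ^ (2 : ℕ)) ^ (3 : ℕ)) {T : ℝ}
    (hT : T ≤ 1) {J J' : Set ℝ} (hJ' : MeasurableSet J')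
    (hz : ∀ s ∈ Set.Icc (0 : ℝ) 1, ∀ p ∈ J, conv3 (J'ᶜ.indicator (U s)) p = 0) :
    ∫⁻ s in Set.Ioc 0 T, massOn J (conv3 (U s))
      ≤ 128 * K * (amount U T J' * amount U T Set.univ ^ (2 : ℕ)) := by
  obtain ⟨C, hC⟩ := h.decay
  have hm : ∀ {I : Set ℝ}, MeasurableSet I →
      Measurable (fun q : ℝ × ℝ => ‖𝓕⁻ (I.indicator (U q.1)) q.2‖ₑ) := fun hI =>
    (measurable_fourierInv_param (U := fun t => Set.indicator _ (U t))
      (h.meas.indicator (measurable_snd hI))).enorm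
  have hv := hm hJ'
  have hu := hm MeasurableSet.univ
  have hw := hm hJ'.compl
  have e1 := lintegral_sq_mul_fourth_le hv hu (h.lintegral_six_le hK hT hJ')
    (h.lintegral_six_le hK hT MeasurableSet.univ)
  have e2 := lintegral_sq_mul_fourth_le (b := amount U T Set.univ) hv hw
    (h.lintegral_six_le hK hT hJ') ((h.lintegral_six_le hK hT hJ'.compl).trans (by
      gcongr
      exact Set.subset_univ _))
  have hvu := (hv.pow_const 2).mul (hu.pow_const 4)
  have hvw := (hv.pow_const 2).mul (hw.pow_const 4)
  have e3 := setLIntegral_mono' (μ := volume) (measurableSet_Ioc (a := (0 : ℝ)) (b := T))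
    fun s hs => massOn_conv3_le (hC s ⟨hs.1.le, hs.2.trans hT⟩) hJ'
      (hz s ⟨hs.1.le, hs.2.trans hT⟩)
  refine e3.trans ?_
  have e4 := lintegral_prod (μ := volume.restrict (Set.Ioc 0 T)) (ν := volume) _
    ((hvu.add hvw).const_mul 8).aemeasurable
  refine e4.symm.le.trans ?_
  rw [lintegral_const_mul _ (hvu.add hvw)]
  refine (mul_le_mul_right ((lintegral_add_left hvu _).le.trans (add_le_add e1 e2)) 8).trans
    (le_of_eq ?_)
  ring

section

attribute [local irreducible] conv3

/-- The regions `|ξ| > 3^(j-1) L`, preceded by the whole line. -/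
def shell (L : ℝ) : ℕ → Set ℝ
  | 0 => Set.univ
  | j + 1 => {ξ | 3 ^ j * L < |ξ|}

lemma measurableSet_shell (L : ℝ) (j : ℕ) : MeasurableSet (shell L j) := by
  cases j with
  | zero => exact MeasurableSet.univ
  | succ j => exact measurableSet_lt measurable_const (by fun_prop)

lemma conv3_compl_univ (G : ℝ → ℂ) (p : ℝ) : conv3 (Set.univᶜ.indicator G) p = 0 := by
  rw [conv3_eq_integral]
  simp

lemma conv3_shell_eq_zero (L : ℝ) (j : ℕ) (G : ℝ → ℂ) {p : ℝ} (hp : p ∈ shell L (j + 1)) :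
    conv3 ((shell L j)ᶜ.indicator G) p = 0 := by
  cases j with
  | zero => exact conv3_compl_univ G p
  | succ j =>
    refine conv3_eq_zero (R := 3 ^ j * L) (fun ξ hξ => ?_) ?_
    · exact Set.indicator_of_notMem (fun h : ξ ∈ (shell L (j + 1))ᶜ => h hξ) _
    · have : 3 ^ (j + 1) * L < |p| := hp
      rw [pow_succ] at this
      linarith

/-- The dyadic weight attached to the regions `shell L j`. -/
def wt (r L ξ : ℝ) : ℝ≥0∞ := ∑' j : ℕ, ENNReal.ofReal (r ^ j) * (shell L j).indicator 1 ξ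

/-- The weighted squared `L²` norm. -/
def wmass (r L : ℝ) (G : ℝ → ℂ) : ℝ≥0∞ := ∑' j : ℕ, ENNReal.ofReal (r ^ j) * massOn (shell L j) G

lemma wmass_eq_lintegral (r L : ℝ) {G : ℝ → ℂ} (hG : Measurable G) :
    wmass r L G = ∫⁻ ξ, wt r L ξ * ‖G ξ‖ₑ ^ (2 : ℕ) := by
  have h0 : ∀ j, Measurable fun ξ => ‖(shell L j).indicator G ξ‖ₑ ^ (2 : ℕ) := fun j =>
    (hG.indicator (measurableSet_shell L j)).enorm.pow_const 2
  unfold wmass wt massOn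
  simp_rw [← ENNReal.tsum_mul_right]
  rw [lintegral_tsum]
  · refine tsum_congr fun j => ?_
    rw [← lintegral_const_mul _ (h0 j)]
    refine lintegral_congr fun ξ => ?_
    by_cases h : ξ ∈ shell L j <;> simp [h]
  · intro j
    exact (((measurable_one.indicator (measurableSet_shell L j)).const_mul _).mul
      (hG.enorm.pow_const 2)).aemeasurable

/-- The weighted size of the nonlinearity up to time `T`. -/
def forcing (r L : ℝ) (U : ℝ → ℝ → ℂ) (T : ℝ) : ℝ≥0∞ :=
  ∫⁻ s in Set.Ioc 0 T, wmass r L (conv3 (U s))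

lemma FreqSol.measurable_massOn_conv3 {U : ℝ → ℝ → ℂ} (h : FreqSol U) (L : ℝ) (j : ℕ) :
    Measurable (fun s => massOn (shell L j) (conv3 (U s))) :=
  measurable_massOn_param (measurable_conv3_param h.meas) (measurableSet_shell L j)

lemma FreqSol.forcing_eq {U : ℝ → ℝ → ℂ} (h : FreqSol U) (r L T : ℝ) :
    forcing r L U T = ∑' j : ℕ, ENNReal.ofReal (r ^ j)
      * ∫⁻ s in Set.Ioc 0 T, massOn (shell L j) (conv3 (U s)) := by
  unfold forcing wmass
  rw [lintegral_tsum fun j => ((h.measurable_massOn_conv3 L j).const_mul _).aemeasurable]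
  exact tsum_congr fun j => lintegral_const_mul _ (h.measurable_massOn_conv3 L j)

lemma FreqSol.tsum_amount {U : ℝ → ℝ → ℂ} (h : FreqSol U) (r L T : ℝ) :
    ∑' j : ℕ, ENNReal.ofReal (r ^ j) * amount U T (shell L j)
      = wmass r L (U 0) + ENNReal.ofReal T * forcing r L U T := by
  rw [h.forcing_eq, wmass, ← ENNReal.tsum_mul_left, ← ENNReal.tsum_add]
  refine tsum_congr fun j => ?_
  unfold amount
  ring

lemma FreqSol.forcing_le {U : ℝ → ℝ → ℂ} (h : FreqSol U) {K : ℝ≥0∞}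
    (hK : ∀ G : ℝ → ℂ, Measurable G → Integrable G →
    ∫⁻ t, ∫⁻ x, ‖𝓕⁻ (schr t G) x‖ₑ ^ (6 : ℕ) ≤ K * (∫⁻ x, ‖G x‖ₑ ^ (2 : ℕ)) ^ (3 : ℕ)) {T : ℝ}
    (hT : T ≤ 1) {r : ℝ} (hr : 0 ≤ r) (L : ℝ) :
    forcing r L U T ≤ 128 * K * (1 + ENNReal.ofReal r)
      * (wmass r L (U 0) + ENNReal.ofReal T * forcing r L U T) ^ (3 : ℕ) := by
  rw [← h.tsum_amount]
  set B := ∑' j : ℕ, ENNReal.ofReal (r ^ j) * amount U T (shell L j) with hB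
  set A := amount U T Set.univ with hA
  have hAB : A ≤ B := by
    refine le_trans (le_of_eq ?_) (ENNReal.le_tsum 0)
    simp [shell, hA]
  have h0 : ∫⁻ s in Set.Ioc 0 T, massOn (shell L 0) (conv3 (U s))
      ≤ 128 * K * (A * A ^ (2 : ℕ)) := by
    refine h.lintegral_massOn_conv3_le hK hT MeasurableSet.univ fun s _ p _ =>
      conv3_compl_univ _ p
  have h1 : ∀ j, ∫⁻ s in Set.Ioc 0 T, massOn (shell L (j + 1)) (conv3 (U s))
      ≤ 128 * K * (amount U T (shell L j) * A ^ (2 : ℕ)) := fun j =>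
    h.lintegral_massOn_conv3_le hK hT (measurableSet_shell L j) fun s _ p hp =>
      conv3_shell_eq_zero L j _ hp
  rw [h.forcing_eq, tsum_eq_zero_add' ENNReal.summable]
  calc _ ≤ 128 * K * (A * A ^ (2 : ℕ)) + ∑' j : ℕ, (128 * K * A ^ (2 : ℕ) * ENNReal.ofReal r)
        * (ENNReal.ofReal (r ^ j) * amount U T (shell L j)) := by
        refine add_le_add (by simpa only [pow_zero, ENNReal.ofReal_one, one_mul] using h0)
          (ENNReal.tsum_le_tsum fun j => ?_)
        · refine (mul_le_mul_right (h1 j) _).trans (le_of_eq ?_)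
          rw [pow_succ, ENNReal.ofReal_mul (by positivity)]
          ring
    _ ≤ 128 * K * (B * B ^ (2 : ℕ)) + (128 * K * B ^ (2 : ℕ) * ENNReal.ofReal r) * B := by
        rw [ENNReal.tsum_mul_left]
        gcongr
    _ = _ := by ring

lemma FreqSol.massOn_le {U : ℝ → ℝ → ℂ} (h : FreqSol U) {t T : ℝ} (ht : t ∈ Set.Icc (0 : ℝ) T)
    (hT : T ≤ 1) {J : Set ℝ} (hJ : MeasurableSet J) : massOn J (U t) ≤ 2 * amount U T J := by
  have ht1 : t ∈ Set.Icc (0 : ℝ) 1 := ⟨ht.1, ht.2.trans hT⟩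
  have hm : Measurable (fun q : ℝ × ℝ => ‖J.indicator (conv3 (U q.1)) q.2‖ₑ) :=
    ((measurable_conv3_param h.meas).indicator (measurable_snd hJ)).enorm
  have hm0 : Measurable (U 0) := h.meas.of_uncurry_left
  have hpt : ∀ ξ, ‖J.indicator (U t) ξ‖ₑ ≤ ‖J.indicator (U 0) ξ‖ₑ
      + ∫⁻ s in Set.Ioc 0 T, ‖J.indicator (conv3 (U s)) ξ‖ₑ := by
    intro ξ
    by_cases hξ : ξ ∈ J
    · simp only [Set.indicator_of_mem hξ]
      rw [show ‖U t ξ‖ₑ = ‖schr (-t) (U t) ξ‖ₑ from (enorm_schr _ _ _).symm, h.duhamel ht1,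
        intervalIntegral.integral_of_le ht.1]
      refine (enorm_add_le _ _).trans ?_
      gcongr
      refine (enorm_integral_le_lintegral_enorm _).trans ?_
      refine (lintegral_mono_set (Set.Ioc_subset_Ioc le_rfl ht.2)).trans (le_of_eq ?_)
      refine lintegral_congr fun s => ?_
      rw [← ofReal_norm, norm_inter, ofReal_norm]
    · simp [Set.indicator_of_notMem hξ]
  have hsq : ∀ ξ, ‖J.indicator (U t) ξ‖ₑ ^ (2 : ℕ) ≤ 2 * (‖J.indicator (U 0) ξ‖ₑ ^ (2 : ℕ)
      + ENNReal.ofReal T * ∫⁻ s in Set.Ioc 0 T, ‖J.indicator (conv3 (U s)) ξ‖ₑ ^ (2 : ℕ)) := by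
    intro ξ
    refine (pow_le_pow_left₀ zero_le (hpt ξ) 2).trans ((add_sq_le_two _ _).trans ?_)
    gcongr
    have hmξ : Measurable fun s => ‖J.indicator (conv3 (U s)) ξ‖ₑ :=
      Measurable.comp (g := fun q : ℝ × ℝ => ‖J.indicator (conv3 (U q.1)) q.2‖ₑ) hm
        (measurable_prodMk_right (y := ξ))
    have h3 := lintegral_mul_sq_le (μ := volume.restrict (Set.Ioc 0 T)) (f := fun _ => 1)
      aemeasurable_const hmξ.aemeasurable
    simpa using h3
  have hi : Measurable fun ξ => ∫⁻ s in Set.Ioc 0 T, ‖J.indicator (conv3 (U s)) ξ‖ₑ ^ (2 : ℕ) :=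
    (hm.pow_const 2).lintegral_prod_left'
  have h0m := (hm0.indicator hJ).enorm.pow_const 2
  have hsw : ∫⁻ ξ, ∫⁻ s in Set.Ioc 0 T, ‖J.indicator (conv3 (U s)) ξ‖ₑ ^ (2 : ℕ)
      = ∫⁻ s in Set.Ioc 0 T, massOn J (conv3 (U s)) :=
    lintegral_lintegral_swap ((hm.pow_const 2).comp measurable_swap).aemeasurable
  calc massOn J (U t) ≤ ∫⁻ ξ, 2 * (‖J.indicator (U 0) ξ‖ₑ ^ (2 : ℕ)
      + ENNReal.ofReal T * ∫⁻ s in Set.Ioc 0 T, ‖J.indicator (conv3 (U s)) ξ‖ₑ ^ (2 : ℕ)) :=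
        lintegral_mono hsq
    _ = 2 * ∫⁻ ξ, (‖J.indicator (U 0) ξ‖ₑ ^ (2 : ℕ)
      + ENNReal.ofReal T * ∫⁻ s in Set.Ioc 0 T, ‖J.indicator (conv3 (U s)) ξ‖ₑ ^ (2 : ℕ)) :=
        lintegral_const_mul _ (h0m.add (hi.const_mul _))
    _ = 2 * (massOn J (U 0) + ∫⁻ ξ, ENNReal.ofReal T
          * ∫⁻ s in Set.Ioc 0 T, ‖J.indicator (conv3 (U s)) ξ‖ₑ ^ (2 : ℕ)) := by
        congr 1
        exact lintegral_add_left h0m _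
    _ = _ := by rw [lintegral_const_mul _ hi, hsw, amount]

lemma FreqSol.wmass_le {U : ℝ → ℝ → ℂ} (h : FreqSol U) {t T : ℝ} (ht : t ∈ Set.Icc (0 : ℝ) T)
    (hT : T ≤ 1) (r L : ℝ) :
    wmass r L (U t) ≤ 2 * (wmass r L (U 0) + ENNReal.ofReal T * forcing r L U T) := by
  rw [← h.tsum_amount, ← ENNReal.tsum_mul_left, wmass]
  refine ENNReal.tsum_le_tsum fun j => ?_
  refine (mul_le_mul_right (h.massOn_le ht hT (measurableSet_shell L j)) _).trans (le_of_eq ?_)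
  ring

end

lemma FreqSol.forcing_small {U : ℝ → ℝ → ℂ} (h : FreqSol U) {K : ℝ≥0∞}
    (hK : ∀ G : ℝ → ℂ, Measurable G → Integrable G →
    ∫⁻ t, ∫⁻ x, ‖𝓕⁻ (schr t G) x‖ₑ ^ (6 : ℕ) ≤ K * (∫⁻ x, ‖G x‖ₑ ^ (2 : ℕ)) ^ (3 : ℕ))
    {r : ℝ} (hr : 0 ≤ r) {L M : ℝ}
    (hM : ∀ s ∈ Set.Icc (0 : ℝ) 1, wmass r L (conv3 (U s)) ≤ ENNReal.ofReal M) {κ C₁ δ : ℝ}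
    (hκ0 : 0 ≤ κ) (hκ : 128 * K * (1 + ENNReal.ofReal r) ≤ ENNReal.ofReal κ) (hC₁ : 0 < C₁)
    (h0 : wmass r L (U 0) ≤ ENNReal.ofReal C₁) (hδ0 : 0 ≤ δ) (hδ1 : δ ≤ 1)
    (hδ : δ * κ * 8 * C₁ ^ 2 < 1) :
    ENNReal.ofReal δ * forcing r L U δ ≤ ENNReal.ofReal C₁ := by
  have hgm : Measurable fun s => wmass r L (conv3 (U s)) := by
    unfold wmass
    exact Measurable.tsum fun j => (h.measurable_massOn_conv3 L j).const_mul _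
  set g : ℝ → ℝ := fun s => (wmass r L (conv3 (U s))).toReal with hg
  have hgi : IntegrableOn g (Set.Icc 0 1) := by
    refine Measure.integrableOn_of_bounded (M := max M 0) (by simp)
      hgm.ennreal_toReal.aestronglyMeasurable ?_
    refine (ae_restrict_mem measurableSet_Icc).mono fun s hs => ?_
    rw [hg, Real.norm_of_nonneg ENNReal.toReal_nonneg]
    refine (ENNReal.toReal_mono ENNReal.ofReal_ne_top (hM s hs)).trans (le_of_eq ?_)
    rw [ENNReal.toReal_ofReal']
  set y : ℝ → ℝ := fun T => ∫ s in (0 : ℝ)..T, g s with hy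
  have hyc : ContinuousOn y (Set.Icc 0 1) := by
    have := intervalIntegral.continuousOn_primitive_interval (f := g) (μ := volume)
      (a := 0) (b := 1) (by rwa [Set.uIcc_of_le zero_le_one])
    rwa [Set.uIcc_of_le zero_le_one] at this
  have hy0 : ∀ T ∈ Set.Icc (0 : ℝ) 1, 0 ≤ y T := fun T hT =>
    intervalIntegral.integral_nonneg hT.1 fun _ _ => ENNReal.toReal_nonneg
  have hf : ∀ T ∈ Set.Icc (0 : ℝ) 1, forcing r L U T = ENNReal.ofReal (y T) := by
    intro T hT
    have hsub : Set.Ioc 0 T ⊆ Set.Icc (0 : ℝ) 1 := fun s hs => ⟨hs.1.le, hs.2.trans hT.2⟩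
    rw [hy]
    simp only
    rw [intervalIntegral.integral_of_le hT.1, ofReal_integral_eq_lintegral_ofReal
      (hgi.mono_set hsub) (Filter.Eventually.of_forall fun _ => ENNReal.toReal_nonneg)]
    refine setLIntegral_congr_fun measurableSet_Ioc fun s hs => ?_
    exact (ENNReal.ofReal_toReal (ne_top_of_le_ne_top ENNReal.ofReal_ne_top (hM s (hsub hs)))).symm
  have hδI : δ ∈ Set.Icc (0 : ℝ) 1 := ⟨hδ0, hδ1⟩
  rw [hf δ hδI, ← ENNReal.ofReal_mul hδ0]
  refine ENNReal.ofReal_le_ofReal ?_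
  by_contra! hcon
  obtain ⟨T, hT, hTz⟩ : C₁ ∈ (fun T => T * y T) '' Set.Icc 0 δ := by
    refine intermediate_value_Icc hδ0 ?_ ⟨by simpa using hC₁.le, hcon.le⟩
    exact continuousOn_id.mul (hyc.mono (Set.Icc_subset_Icc le_rfl hδ1))
  have hT1 : T ∈ Set.Icc (0 : ℝ) 1 := ⟨hT.1, hT.2.trans hδ1⟩
  have hle := h.forcing_le hK hT1.2 hr L
  simp only at hTz
  rw [hf T hT1, ← ENNReal.ofReal_mul hT.1, hTz] at hle
  have h2 : y T ≤ κ * (C₁ + C₁) ^ 3 := by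
    rw [← ENNReal.ofReal_le_ofReal_iff (by positivity)]
    refine hle.trans ?_
    rw [ENNReal.ofReal_mul hκ0, ENNReal.ofReal_pow (by positivity), ENNReal.ofReal_add hC₁.le hC₁.le]
    gcongr
  have h3 : T * y T ≤ δ * (κ * (C₁ + C₁) ^ 3) :=
    mul_le_mul hT.2 h2 (hy0 T hT1) hδ0
  nlinarith

lemma FreqSol.wmass_le_of_small {U : ℝ → ℝ → ℂ} (h : FreqSol U) {r L C₁ δ : ℝ} (hC₁ : 0 < C₁)
    (h0 : wmass r L (U 0) ≤ ENNReal.ofReal C₁) (hδ1 : δ ≤ 1)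
    (hf : ENNReal.ofReal δ * forcing r L U δ ≤ ENNReal.ofReal C₁) :
    ∀ t ∈ Set.Icc (0 : ℝ) δ, wmass r L (U t) ≤ ENNReal.ofReal (4 * C₁) := by
  intro t ht
  refine (h.wmass_le ht hδ1 r L).trans ((mul_le_mul_right (add_le_add h0 hf) 2).trans (le_of_eq ?_))
  rw [← ENNReal.ofReal_add hC₁.le hC₁.le, show (2 : ℝ≥0∞) = ENNReal.ofReal 2 by norm_num,
    ← ENNReal.ofReal_mul (by norm_num)]
  congr 1
  ring

/-- On each shell the weight is a finite geometric sum. -/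
lemma wt_eq {r L ξ : ℝ} {k : ℕ} (hlow : ∀ j, j ≤ k → ξ ∈ shell L j) (hL : 0 ≤ L)
    (hhigh : |ξ| ≤ 3 ^ k * L) (hr : 0 ≤ r) :
    wt r L ξ = ENNReal.ofReal (∑ j ∈ Finset.range (k + 1), r ^ j) := by
  unfold wt
  rw [tsum_eq_sum (s := Finset.range (k + 1)), ENNReal.ofReal_sum_of_nonneg fun j _ => by positivity]
  · refine Finset.sum_congr rfl fun j hj => ?_
    rw [Set.indicator_of_mem (hlow j (by simpa [Nat.lt_succ_iff] using hj))]
    simp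
  · intro j hj
    obtain ⟨i, rfl⟩ : ∃ i, j = i + 1 + k := ⟨j - k - 1, by simp at hj; omega⟩
    rw [Set.indicator_of_notMem, mul_zero]
    intro hmem
    have h1 : 3 ^ (i + k) * L < |ξ| := by
      rw [show i + 1 + k = (i + k) + 1 by ring] at hmem
      exact hmem
    have h2 : (3 : ℝ) ^ k * L ≤ 3 ^ (i + k) * L := by
      gcongr
      · norm_num
      · omega
    linarith

/-- Each frequency lies in a last shell. -/
lemma exists_shell {L : ℝ} (hL : 0 < L) (ξ : ℝ) :
    ∃ k, (∀ j, j ≤ k → ξ ∈ shell L j) ∧ |ξ| ≤ 3 ^ k * L := by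
  classical
  have hex : ∃ k : ℕ, |ξ| ≤ 3 ^ k * L := by
    obtain ⟨k, hk⟩ := pow_unbounded_of_one_lt (|ξ| / L) (by norm_num : (1 : ℝ) < 3)
    exact ⟨k, by rw [div_lt_iff₀ hL] at hk; exact hk.le⟩
  refine ⟨Nat.find hex, fun j hj => ?_, Nat.find_spec hex⟩
  cases j with
  | zero => trivial
  | succ j => exact not_le.1 (Nat.find_min hex (by omega))

section

namespace AdmissibleHigh

variable {N s : ℝ} {θ : ℝ → ℝ}

lemma one_le (h : AdmissibleHigh N s θ) (hN : 2 ≤ N) (ξ : ℝ) : 1 ≤ θ ξ := by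
  rw [← h.eq_one 0 (by simp; linarith)]
  exact h.mono 0 ξ (by simp)

lemma pow_three (h : AdmissibleHigh N s θ) (hN : 2 ≤ N) (k : ℕ) :
    θ (3 ^ k * N) = (3 ^ s) ^ k := by
  have hN0 : 0 < N := by linarith
  have hpos : 0 < 3 ^ k * N := by positivity
  cases k with
  | zero => simpa using h.eq_one N (by rw [abs_of_pos hN0])
  | succ k =>
    rw [h.eq_high _ (by
      rw [abs_of_pos hpos, pow_succ]
      nlinarith [one_le_pow₀ (n := k) (by norm_num : (1 : ℝ) ≤ 3)]), abs_of_pos hpos,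
      Real.mul_rpow (by positivity) hN0.le, mul_assoc, ← Real.rpow_add hN0, add_neg_cancel,
      Real.rpow_zero, mul_one, ← Real.rpow_natCast, ← Real.rpow_natCast, ← Real.rpow_mul (by norm_num),
      ← Real.rpow_mul (by norm_num), mul_comm]

lemma le_two (h : AdmissibleHigh N s θ) (hs1 : s < 1) (hN : 2 ≤ N) {ξ : ℝ}
    (hξ : |ξ| ≤ 2 * N) : θ ξ ≤ 2 := by
  have hN0 : 0 < N := by linarith
  refine (h.mono ξ (2 * N) (by rwa [abs_of_pos (by positivity : 0 < 2 * N)])).trans ?_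
  rw [h.eq_high _ (by rw [abs_of_pos (by positivity)]), abs_of_pos (by positivity),
    Real.mul_rpow (by positivity) hN0.le, mul_assoc, ← Real.rpow_add hN0, add_neg_cancel,
    Real.rpow_zero, mul_one]
  calc (2 : ℝ) ^ s ≤ 2 ^ (1 : ℝ) := Real.rpow_le_rpow_of_exponent_le (by norm_num) hs1.le
    _ = 2 := by simp

lemma sq_le (h : AdmissibleHigh N s θ) (hs1 : s < 1) (hN : 2 ≤ N) (ξ : ℝ) :
    θ ξ ^ 2 ≤ 5 * (1 + ξ ^ 2) := by
  have hN0 : 0 < N := by linarith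
  have h1 := h.one_le hN ξ
  have h2 : θ ξ ≤ 2 + |ξ| := by
    rcases le_total |ξ| (2 * N) with hξ | hξ
    · linarith [h.le_two hs1 hN hξ, abs_nonneg ξ]
    · have e : θ ξ = (|ξ| / N) ^ s := by
        rw [h.eq_high ξ hξ, Real.div_rpow (abs_nonneg _) hN0.le, Real.rpow_neg hN0.le, div_eq_mul_inv]
      have e1 : 1 ≤ |ξ| / N := by rw [le_div_iff₀ hN0]; linarith
      have e2 : |ξ| / N ≤ |ξ| := div_le_self (abs_nonneg _) (by linarith)
      have e3 : (|ξ| / N) ^ s ≤ (|ξ| / N) ^ (1 : ℝ) := Real.rpow_le_rpow_of_exponent_le e1 hs1.le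
      rw [Real.rpow_one] at e3
      linarith
  nlinarith [sq_nonneg (2 * |ξ| - 1), sq_abs ξ, abs_nonneg ξ]

lemma three_mul_le (h : AdmissibleHigh N s θ) (hs1 : s < 1) (hN : 2 ≤ N) (ξ : ℝ) :
    θ (3 * ξ) ≤ 6 * θ ξ := by
  have hN0 : 0 < N := by linarith
  have h1 := h.one_le hN ξ
  have h3 : (3 : ℝ) ^ s ≤ 3 := by
    calc (3 : ℝ) ^ s ≤ 3 ^ (1 : ℝ) := Real.rpow_le_rpow_of_exponent_le (by norm_num) hs1.le
      _ = 3 := by simp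
  have key : ∀ x, 2 * N ≤ |x| → θ (3 * x) ≤ 3 * θ x := by
    intro x hx
    have h3x : |3 * x| = 3 * |x| := by rw [abs_mul]; norm_num
    rw [h.eq_high x hx, h.eq_high (3 * x) (by rw [h3x]; linarith [abs_nonneg x]), h3x,
      Real.mul_rpow (by norm_num) (abs_nonneg _), mul_assoc]
    have : 0 ≤ |x| ^ s * N ^ (-s) := by positivity
    nlinarith
  rcases le_total (2 * N) |ξ| with hξ | hξ
  · linarith [key ξ hξ]
  · have e1 : θ (3 * ξ) ≤ θ (3 * (2 * N)) := h.mono _ _ (by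
      rw [abs_mul, abs_mul, abs_of_pos (by positivity : 0 < 2 * N)]; gcongr)
    have e2 := key (2 * N) (by rw [abs_of_pos (by positivity)])
    have e3 := h.le_two hs1 hN (ξ := 2 * N) (by rw [abs_of_pos (by positivity)])
    linarith

end AdmissibleHigh

lemma one_lt_nine_rpow {s : ℝ} (hs0 : 0 < s) : (1 : ℝ) < 9 ^ s :=
  Real.one_lt_rpow (by norm_num) hs0

lemma nine_rpow_eq (s : ℝ) : (9 : ℝ) ^ s = (3 ^ s) ^ 2 := by
  rw [show (9 : ℝ) = 3 * 3 by norm_num, Real.mul_rpow (by norm_num) (by norm_num), sq]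

namespace AdmissibleHigh

variable {N s : ℝ} {θ : ℝ → ℝ}

lemma le_wt (h : AdmissibleHigh N s θ) (hN : 2 ≤ N) (ξ : ℝ) :
    ENNReal.ofReal (θ (2 * π * ξ) ^ 2) ≤ wt (9 ^ s) (N / (2 * π)) ξ := by
  have hN0 : 0 < N := by linarith
  have hπ := Real.pi_pos
  obtain ⟨k, hlow, hhigh⟩ := exists_shell (L := N / (2 * π)) (by positivity) ξ
  rw [wt_eq hlow (by positivity) hhigh (by positivity)]
  refine ENNReal.ofReal_le_ofReal ?_
  have h1 : θ (2 * π * ξ) ≤ θ (3 ^ k * N) := by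
    refine h.mono _ _ ?_
    rw [abs_mul, abs_of_pos (by positivity : 0 < 2 * π),
      abs_of_pos (by positivity : 0 < 3 ^ k * N)]
    calc 2 * π * |ξ| ≤ 2 * π * (3 ^ k * (N / (2 * π))) := by gcongr
      _ = 3 ^ k * N := by field_simp
  have h2 := h.one_le hN (2 * π * ξ)
  calc θ (2 * π * ξ) ^ 2 ≤ θ (3 ^ k * N) ^ 2 := by gcongr
    _ = (9 ^ s) ^ k := by rw [h.pow_three hN, nine_rpow_eq, ← pow_mul, ← pow_mul, mul_comm]
    _ ≤ _ := Finset.single_le_sum (f := fun j => ((9 : ℝ) ^ s) ^ j) (fun j _ => by positivity)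
        (by simp)

lemma wt_le (h : AdmissibleHigh N s θ) (hs0 : 0 < s) (hN : 2 ≤ N) (ξ : ℝ) :
    wt (9 ^ s) (N / (2 * π)) ξ
      ≤ ENNReal.ofReal ((9 ^ s) ^ 2 / (9 ^ s - 1) * θ (2 * π * ξ) ^ 2) := by
  have hN0 : 0 < N := by linarith
  have hπ := Real.pi_pos
  have hr := one_lt_nine_rpow hs0
  obtain ⟨k, hlow, hhigh⟩ := exists_shell (L := N / (2 * π)) (by positivity) ξ
  rw [wt_eq hlow (by positivity) hhigh (by positivity)]
  refine ENNReal.ofReal_le_ofReal ?_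
  have h2 := h.one_le hN (2 * π * ξ)
  have hr' : (0 : ℝ) < 9 ^ s - 1 := by linarith
  cases k with
  | zero =>
    simp only [zero_add, Finset.range_one, Finset.sum_singleton, pow_zero]
    have : 1 ≤ ((9 : ℝ) ^ s) ^ 2 / (9 ^ s - 1) := by
      rw [le_div_iff₀ hr']; nlinarith
    nlinarith
  | succ k =>
    have h1 : θ (3 ^ k * N) ≤ θ (2 * π * ξ) := by
      refine h.mono _ _ ?_
      rw [abs_mul, abs_mul (2 * π), abs_of_pos (by positivity : 0 < 2 * π),
        abs_of_pos (by positivity : (0 : ℝ) < 3 ^ k), abs_of_pos hN0]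
      have h3 : 3 ^ k * (N / (2 * π)) < |ξ| := hlow (k + 1) le_rfl
      calc 3 ^ k * N = 2 * π * (3 ^ k * (N / (2 * π))) := by field_simp
        _ ≤ _ := by gcongr
    have h0 := h.one_le hN (3 ^ k * N)
    have h4 : ((9 : ℝ) ^ s) ^ k ≤ θ (2 * π * ξ) ^ 2 := by
      calc ((9 : ℝ) ^ s) ^ k = θ (3 ^ k * N) ^ 2 := by
            rw [h.pow_three hN, nine_rpow_eq, ← pow_mul, ← pow_mul, mul_comm]
        _ ≤ _ := by gcongr
    rw [geom_sum_eq hr.ne']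
    calc (((9 : ℝ) ^ s) ^ (k + 1 + 1) - 1) / (9 ^ s - 1)
        ≤ ((9 : ℝ) ^ s) ^ (k + 1 + 1) / (9 ^ s - 1) := by gcongr; linarith
      _ = (9 ^ s) ^ 2 / (9 ^ s - 1) * (9 ^ s) ^ k := by ring
      _ ≤ _ := by gcongr

lemma continuous (h : AdmissibleHigh N s θ) : Continuous θ := h.smooth.continuous

end AdmissibleHigh

lemma wmass_le_of_hasDec {r L B D : ℝ} {G : ℝ → ℂ} (hG : HasDec 2 D G) (hB : 0 ≤ B)
    (hwt : ∀ ξ, wt r L ξ ≤ ENNReal.ofReal (B * (1 + ξ ^ 2))) :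
    wmass r L G ≤ ENNReal.ofReal (B * D ^ 2 * π) := by
  rw [wmass_eq_lintegral r L hG.meas]
  calc _ ≤ ∫⁻ ξ, ENNReal.ofReal (B * D ^ 2 * dec 1 ξ) := by
        refine lintegral_mono fun ξ => ?_
        dsimp only
        have hb := hG.bound ξ
        have h1 : 0 < 1 + ξ ^ 2 := by positivity
        have h2 : (1 + ξ ^ 2) * (dec 2 ξ) ^ 2 ≤ dec 1 ξ := by
          have e : (1 + ξ ^ 2) * (dec 2 ξ) = dec 1 ξ := by
            unfold dec; field_simp
          rw [sq (dec 2 ξ), ← mul_assoc, e]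
          exact mul_le_of_le_one_right (dec_pos _ _).le (dec_le_one _ _)
        refine (mul_le_mul_left (hwt ξ) _).trans ?_
        rw [← ofReal_norm, ← ENNReal.ofReal_pow (norm_nonneg _), ← ENNReal.ofReal_mul (by positivity)]
        refine ENNReal.ofReal_le_ofReal ?_
        calc B * (1 + ξ ^ 2) * ‖G ξ‖ ^ 2 ≤ B * (1 + ξ ^ 2) * (D * dec 2 ξ) ^ 2 := by gcongr
          _ = B * D ^ 2 * ((1 + ξ ^ 2) * (dec 2 ξ) ^ 2) := by ring
          _ ≤ _ := by gcongr
    _ = _ := by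
        rw [← ofReal_integral_eq_lintegral_ofReal ((integrable_dec le_rfl).const_mul _)
          (Filter.Eventually.of_forall fun ξ => by have := (dec_pos 1 ξ).le; positivity),
          integral_const_mul, dec_one_eq, integral_univ_inv_one_add_sq]

end

section

/-- The squared norm `‖D u‖²`, on the frequency side. -/
def thetaMass (θ : ℝ → ℝ) (G : ℝ → ℂ) : ℝ≥0∞ :=
  ∫⁻ ξ, (ENNReal.ofReal (θ (2 * π * ξ)) * ‖G ξ‖ₑ) ^ (2 : ℕ)

namespace AdmissibleHigh

variable {N s : ℝ} {θ : ℝ → ℝ}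

lemma thetaMass_le (h : AdmissibleHigh N s θ) (hN : 2 ≤ N) {G : ℝ → ℂ}
    (hG : Measurable G) : thetaMass θ G ≤ wmass (9 ^ s) (N / (2 * π)) G := by
  rw [wmass_eq_lintegral _ _ hG]
  refine lintegral_mono fun ξ => ?_
  dsimp only
  rw [mul_pow, ← ENNReal.ofReal_pow (zero_le_one.trans (h.one_le hN _))]
  gcongr
  exact h.le_wt hN ξ

lemma wmass_le (h : AdmissibleHigh N s θ) (hs0 : 0 < s) (hN : 2 ≤ N) {G : ℝ → ℂ}
    (hG : Measurable G) : wmass (9 ^ s) (N / (2 * π)) G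
      ≤ ENNReal.ofReal ((9 ^ s) ^ 2 / (9 ^ s - 1)) * thetaMass θ G := by
  have hr := one_lt_nine_rpow hs0
  rw [wmass_eq_lintegral _ _ hG, thetaMass, ← lintegral_const_mul' _ _ ENNReal.ofReal_ne_top]
  refine lintegral_mono fun ξ => ?_
  dsimp only
  refine (mul_le_mul_left (h.wt_le hs0 hN ξ) _).trans (le_of_eq ?_)
  rw [ENNReal.ofReal_mul (div_nonneg (by positivity) (by linarith)), mul_pow,
    ENNReal.ofReal_pow (zero_le_one.trans (h.one_le hN _)), mul_assoc]

lemma wt_le_sq (h : AdmissibleHigh N s θ) (hs0 : 0 < s) (hs1 : s < 1) (hN : 2 ≤ N) (ξ : ℝ) :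
    wt (9 ^ s) (N / (2 * π)) ξ
      ≤ ENNReal.ofReal ((9 ^ s) ^ 2 / (9 ^ s - 1) * (5 * (1 + (2 * π) ^ 2)) * (1 + ξ ^ 2)) := by
  have hr := one_lt_nine_rpow hs0
  have h0 : 0 ≤ ((9 : ℝ) ^ s) ^ 2 / (9 ^ s - 1) := div_nonneg (by positivity) (by linarith)
  refine (h.wt_le hs0 hN ξ).trans (ENNReal.ofReal_le_ofReal ?_)
  rw [mul_assoc _ _ (1 + ξ ^ 2)]
  refine mul_le_mul_of_nonneg_left ((h.sq_le hs1 hN _).trans ?_) h0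
  nlinarith [sq_nonneg ξ, sq_nonneg π]

end AdmissibleHigh

/-- A priori bounds on a short time interval depending only on the exponent and on the size of
the data. -/
lemma exists_apriori {s C₀ : ℝ} (hs0 : 0 < s) (hs1 : s < 1) (hC₀ : 0 < C₀) :
    ∃ δ C₁ : ℝ, 0 < δ ∧ δ ≤ 1 ∧ 0 < C₁ ∧ ∀ N : ℝ, 2 ≤ N → ∀ θ : ℝ → ℝ, AdmissibleHigh N s θ →
      ∀ U : ℝ → ℝ → ℂ, FreqSol U → thetaMass θ (U 0) ≤ ENNReal.ofReal C₀ →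
      (∀ t ∈ Set.Icc 0 δ, thetaMass θ (U t) ≤ ENNReal.ofReal C₁) ∧
      ∫⁻ t in Set.Ioc 0 δ, thetaMass θ (conv3 (U t)) ≤ ENNReal.ofReal C₁ := by
  obtain ⟨K, hKtop, hK⟩ := strichartz
  have hr := one_lt_nine_rpow hs0
  set r : ℝ := 9 ^ s with hrdef
  set b : ℝ := r ^ 2 / (r - 1) with hb
  have hb0 : 0 < b := div_pos (by positivity) (by linarith)
  set c : ℝ := b * C₀ with hc
  have hc0 : 0 < c := by positivity
  set κ : ℝ := (128 * K * (1 + ENNReal.ofReal r)).toReal with hκ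
  have hκ0 : 0 ≤ κ := ENNReal.toReal_nonneg
  have hκe : 128 * K * (1 + ENNReal.ofReal r) ≤ ENNReal.ofReal κ := by
    rw [hκ, ENNReal.ofReal_toReal]
    finiteness
  have hden : 0 < 1 + κ * 8 * c ^ 2 := by positivity
  set δ : ℝ := 1 / (1 + κ * 8 * c ^ 2) with hδ
  have hδ0 : 0 < δ := by positivity
  have hδ1 : δ ≤ 1 := by
    rw [hδ, div_le_one hden]
    nlinarith [mul_nonneg hκ0 (sq_nonneg c)]
  have hδs : δ * κ * 8 * c ^ 2 < 1 := by
    rw [hδ, show 1 / (1 + κ * 8 * c ^ 2) * κ * 8 * c ^ 2 = κ * 8 * c ^ 2 / (1 + κ * 8 * c ^ 2) by ring,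
      div_lt_one hden]
    linarith
  refine ⟨δ, 4 * c + c / δ, hδ0, hδ1, by positivity, fun N hN θ hθ U hU h0 => ?_⟩
  have hmU : ∀ t, Measurable (U t) := fun t => hU.meas.of_uncurry_left
  have hmV : ∀ t, Measurable (conv3 (U t)) := fun t =>
    Measurable.of_uncurry_left (f := fun t p => conv3 (U t) p) (measurable_conv3_param hU.meas)
  have hw0 : wmass r (N / (2 * π)) (U 0) ≤ ENNReal.ofReal c := by
    refine (hθ.wmass_le hs0 hN (hmU 0)).trans ?_
    rw [hc, ENNReal.ofReal_mul hb0.le]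
    gcongr
  obtain ⟨D, hD⟩ := hU.conv3_decay
  have hM : ∀ t ∈ Set.Icc (0 : ℝ) 1, wmass r (N / (2 * π)) (conv3 (U t))
      ≤ ENNReal.ofReal (b * (5 * (1 + (2 * π) ^ 2)) * D ^ 2 * π) := fun t ht =>
    wmass_le_of_hasDec (hD t ht) (by positivity) (hθ.wt_le_sq hs0 hs1 hN)
  have hf := hU.forcing_small hK (by positivity) hM hκ0 hκe hc0 hw0 hδ0.le hδ1 hδs
  refine ⟨fun t ht => ?_, ?_⟩
  · refine (hθ.thetaMass_le hN (hmU t)).trans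
      ((hU.wmass_le_of_small hc0 hw0 hδ1 hf t ht).trans (ENNReal.ofReal_le_ofReal ?_))
    have : 0 < c / δ := by positivity
    linarith
  · have h1 : forcing r (N / (2 * π)) U δ ≤ ENNReal.ofReal (c / δ) := by
      rw [ENNReal.ofReal_div_of_pos hδ0, ENNReal.le_div_iff_mul_le (by simp [hδ0]) (by simp), mul_comm]
      exact hf
    refine le_trans (lintegral_mono fun t => hθ.thetaMass_le hN (hmV t)) (h1.trans
      (ENNReal.ofReal_le_ofReal ?_))
    linarith

end

section

lemma abs_le_of_four_bounds {M A N X Y : ℝ} (hA : 0 ≤ A) (hN : 0 < N) (hX : 0 ≤ X) (hY : 0 ≤ Y)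
    (h0 : |M| ≤ 2 * A) (h1 : |M| ≤ 20 * A / N * X) (h2 : |M| ≤ 20 * A / N * Y)
    (h3 : |M| ≤ 10 * A / N ^ 2 * Y * X) :
    |M| ≤ 40 * A * (X * Y) * (1 / (N ^ 2 + X ^ 2) + 1 / (N ^ 2 + Y ^ 2)) := by
  have half : ∀ Z, 0 ≤ Z → Z ≤ N → 1 / (2 * N ^ 2) ≤ 1 / (N ^ 2 + Z ^ 2) := by
    intro Z hZ hZN
    gcongr
    nlinarith
  have key : ∀ Z V : ℝ, 0 ≤ Z → Z ≤ N → N ≤ V → 20 * A / N * Z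
      ≤ 40 * A * (Z * V) * (1 / (N ^ 2 + Z ^ 2)) := by
    intro Z V hZ hZN hV
    have hV0 : 0 ≤ V := hN.le.trans hV
    calc 20 * A / N * Z = 40 * A * (Z * N) * (1 / (2 * N ^ 2)) := by field_simp; ring
      _ ≤ _ := by
        have := half Z hZ hZN
        gcongr
  have pos : ∀ Z : ℝ, 0 ≤ 40 * A * (X * Y) * (1 / (N ^ 2 + Z ^ 2)) := fun Z => by positivity
  rw [mul_add]
  rcases le_total X N with hXN | hXN <;> rcases le_total Y N with hYN | hYN
  · have e1 := half X hX hXN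
    have : 10 * A / N ^ 2 * Y * X ≤ 40 * A * (X * Y) * (1 / (N ^ 2 + X ^ 2)) := by
      calc 10 * A / N ^ 2 * Y * X ≤ 20 * A / N ^ 2 * Y * X := by gcongr; norm_num
        _ = 40 * A * (X * Y) * (1 / (2 * N ^ 2)) := by field_simp; ring
        _ ≤ _ := by gcongr
    linarith [pos Y]
  · linarith [key X Y hX hXN hYN, pos Y]
  · have := key Y X hY hYN hXN
    rw [mul_comm Y X] at this
    linarith [pos X]
  · have hXp : 0 < X := by linarith
    have hYp : 0 < Y := by linarith
    have e1 : 1 / (2 * X ^ 2) ≤ 1 / (N ^ 2 + X ^ 2) := by gcongr; nlinarith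
    have e2 : 1 / (2 * Y ^ 2) ≤ 1 / (N ^ 2 + Y ^ 2) := by gcongr; nlinarith
    have e3 : 1 ≤ X * Y * (1 / (2 * X ^ 2)) + X * Y * (1 / (2 * Y ^ 2)) := by
      have : X * Y * (1 / (2 * X ^ 2)) + X * Y * (1 / (2 * Y ^ 2))
          = (Y ^ 2 + X ^ 2) / (2 * (X * Y)) := by field_simp
      rw [this, le_div_iff₀ (by positivity)]
      nlinarith [sq_nonneg (X - Y)]
    have e4 : X * Y * (1 / (2 * X ^ 2)) ≤ X * Y * (1 / (N ^ 2 + X ^ 2)) := by gcongr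
    have e5 : X * Y * (1 / (2 * Y ^ 2)) ≤ X * Y * (1 / (N ^ 2 + Y ^ 2)) := by gcongr
    have e6 : 40 * A * 1 ≤ 40 * A * (X * Y * (1 / (N ^ 2 + X ^ 2)) + X * Y * (1 / (N ^ 2 + Y ^ 2))) := by
      gcongr; linarith
    linarith

/-- Bounds for second differences of a function with controlled derivatives. -/
lemma second_difference_bounds {f f' f'' : ℝ → ℝ} {A N Λ p x y : ℝ}
    (hf : ∀ z, HasDerivAt f (f' z) z) (hf' : ∀ z, HasDerivAt f' (f'' z) z)
    (h0 : ∀ z, |z| ≤ Λ → 0 ≤ f z ∧ f z ≤ A) (h1 : ∀ z, |z| ≤ Λ → |f' z| ≤ 10 * A / N)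
    (h2 : ∀ z, |z| ≤ Λ → |f'' z| ≤ 10 * A / N ^ 2) (hN : 0 < N)
    (hp1 : |p| ≤ Λ) (hp2 : |p + x| ≤ Λ) (hp3 : |p + x + y| ≤ Λ) (hp4 : |p + y| ≤ Λ) :
    |f p - f (p + x) + f (p + x + y) - f (p + y)|
      ≤ 40 * A * (|x| * |y|) * (1 / (N ^ 2 + x ^ 2) + 1 / (N ^ 2 + y ^ 2)) := by
  have hA : 0 ≤ A := (h0 p hp1).1.trans (h0 p hp1).2
  have mem : ∀ z, |z| ≤ Λ ↔ z ∈ Set.Icc (-Λ) Λ := fun z => by rw [abs_le]; rfl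
  have d1 : ∀ u v, |u| ≤ Λ → |v| ≤ Λ → |f v - f u| ≤ 10 * A / N * |v - u| := by
    intro u v hu hv
    have := (convex_Icc (-Λ) Λ).norm_image_sub_le_of_norm_hasDerivWithin_le
      (fun z _ => (hf z).hasDerivWithinAt) (fun z hz => h1 z ((mem z).2 hz))
      ((mem u).1 hu) ((mem v).1 hv)
    simpa using this
  have d2 : ∀ u v, |u| ≤ Λ → |v| ≤ Λ → |f' v - f' u| ≤ 10 * A / N ^ 2 * |v - u| := by
    intro u v hu hv
    have := (convex_Icc (-Λ) Λ).norm_image_sub_le_of_norm_hasDerivWithin_le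
      (fun z _ => (hf' z).hasDerivWithinAt) (fun z hz => h2 z ((mem z).2 hz))
      ((mem u).1 hu) ((mem v).1 hv)
    simpa using this
  have b1 := h0 _ hp1
  have b2 := h0 _ hp2
  have b3 := h0 _ hp3
  have b4 := h0 _ hp4
  rw [← sq_abs x, ← sq_abs y]
  refine abs_le_of_four_bounds hA hN (abs_nonneg x) (abs_nonneg y) ?_ ?_ ?_ ?_
  · rw [abs_le]; constructor <;> linarith
  · have e1 := d1 _ _ hp1 hp2
    have e2 := d1 _ _ hp4 hp3
    rw [show p + x - p = x by ring] at e1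
    rw [show p + x + y - (p + y) = x by ring] at e2
    calc _ = |(f (p + x + y) - f (p + y)) - (f (p + x) - f p)| := by congr 1; ring
      _ ≤ _ := (abs_sub _ _).trans (by
        have : 20 * A / N * |x| = 10 * A / N * |x| + 10 * A / N * |x| := by ring
        linarith)
  · have e1 := d1 _ _ hp1 hp4
    have e2 := d1 _ _ hp2 hp3
    rw [show p + y - p = y by ring] at e1
    rw [show p + x + y - (p + x) = y by ring] at e2
    calc _ = |(f (p + x + y) - f (p + x)) - (f (p + y) - f p)| := by congr 1; ring
      _ ≤ _ := (abs_sub _ _).trans (by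
        have : 20 * A / N * |y| = 10 * A / N * |y| + 10 * A / N * |y| := by ring
        linarith)
  · have hconv : Convex ℝ (Set.Icc (-Λ) Λ ∩ Set.Icc (-Λ - y) (Λ - y)) :=
      (convex_Icc _ _).inter (convex_Icc _ _)
    have mem' : ∀ z, |z| ≤ Λ → |z + y| ≤ Λ → z ∈ Set.Icc (-Λ) Λ ∩ Set.Icc (-Λ - y) (Λ - y) := by
      intro z hz hzy
      rw [abs_le] at hz hzy
      exact ⟨⟨hz.1, hz.2⟩, ⟨by linarith, by linarith⟩⟩
    have hg : ∀ z, HasDerivAt (fun z => f (z + y) - f z) (f' (z + y) - f' z) z := fun z =>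
      ((hf (z + y)).comp_add_const z y).sub (hf z)
    have := hconv.norm_image_sub_le_of_norm_hasDerivWithin_le
      (C := 10 * A / N ^ 2 * |y|) (fun z _ => (hg z).hasDerivWithinAt) (fun z hz => by
        have hz1 : |z| ≤ Λ := (mem z).2 hz.1
        have hz2 : |z + y| ≤ Λ := abs_le.2 ⟨by linarith [hz.2.1], by linarith [hz.2.2]⟩
        have := d2 _ _ hz1 hz2
        rwa [show z + y - z = y by ring] at this)
      (mem' p hp1 hp4) (mem' (p + x) hp2 hp3)
    simp only [Real.norm_eq_abs] at this
    rw [show p + x - p = x by ring] at this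
    refine le_trans (le_of_eq ?_) this
    congr 1
    ring

namespace AdmissibleHigh

variable {N s : ℝ} {θ : ℝ → ℝ}

lemma deriv_bounds (h : AdmissibleHigh N s θ) (hN : 2 ≤ N) (ζ : ℝ) :
    |deriv (fun ζ => θ ζ ^ 2) ζ| ≤ 10 * θ ζ ^ 2 / N ∧
      |deriv (deriv (fun ζ => θ ζ ^ 2)) ζ| ≤ 10 * θ ζ ^ 2 / N ^ 2 := by
  have hN0 : 0 < N := by linarith
  rcases lt_or_ge |ζ| N with hζ | hζ
  · have hev : ∀ᶠ z in nhds ζ, |z| < N := continuous_abs.continuousAt.eventually_lt_const hζ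
    have e0 : (fun ζ => θ ζ ^ 2) =ᶠ[nhds ζ] fun _ => (1 : ℝ) := by
      filter_upwards [hev] with z hz
      simp [h.eq_one z hz.le]
    have e1 := e0.deriv
    have e2 := e1.deriv_eq
    rw [e0.deriv_eq, e2]
    simp only [deriv_const, deriv_const', abs_zero]
    constructor <;> positivity
  · have hj : N ≤ jap ζ := by unfold jap; linarith
    have h2 := h.deriv2 ζ
    rw [iteratedDeriv_succ, iteratedDeriv_one] at h2
    exact ⟨(h.deriv1 ζ).trans (by gcongr), h2.trans (by gcongr)⟩

lemma sq_le_prod (h : AdmissibleHigh N s θ) (hs1 : s < 1) (hN : 2 ≤ N) {a b c d : ℝ}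
    (habcd : |a| ≤ |b| + |c| + |d|) : θ a ^ 2 ≤ 6 * (θ a * θ b * θ c * θ d) := by
  have ha := h.one_le hN a
  have hb := h.one_le hN b
  have hc := h.one_le hN c
  have hd := h.one_le hN d
  have key : ∀ e, |a| ≤ 3 * |e| → θ a ≤ 6 * θ e := fun e he =>
    (h.mono a (3 * e) (by rw [abs_mul]; norm_num; exact he)).trans (h.three_mul_le hs1 hN e)
  have hbc : 1 ≤ θ b * θ c := one_le_mul_of_one_le_of_one_le hb hc
  have main : θ a ≤ 6 * (θ b * θ c * θ d) := by
    by_cases h1 : |a| ≤ 3 * |b|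
    · have := key b h1
      have : θ b ≤ θ b * θ c * θ d := by
        rw [mul_assoc]
        exact le_mul_of_one_le_right (by linarith) (one_le_mul_of_one_le_of_one_le hc hd)
      linarith
    by_cases h2 : |a| ≤ 3 * |c|
    · have := key c h2
      have : θ c ≤ θ b * θ c * θ d := by
        rw [mul_comm (θ b), mul_assoc]
        exact le_mul_of_one_le_right (by linarith) (one_le_mul_of_one_le_of_one_le hb hd)
      linarith
    · have := key d (by linarith)
      have : θ d ≤ θ b * θ c * θ d := le_mul_of_one_le_left (by linarith) hbc
      linarith
  calc θ a ^ 2 = θ a * θ a := sq _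
    _ ≤ θ a * (6 * (θ b * θ c * θ d)) := by gcongr
    _ = _ := by ring

lemma symbol_bound (h : AdmissibleHigh N s θ) (hs1 : s < 1) (hN : 2 ≤ N) (p x y : ℝ) :
    |θ p ^ 2 - θ (p + x) ^ 2 + θ (p + x + y) ^ 2 - θ (p + y) ^ 2|
      ≤ 240 * (θ p * θ (p + x) * θ (p + x + y) * θ (p + y)) * (|x| * |y|)
        * (1 / (N ^ 2 + x ^ 2) + 1 / (N ^ 2 + y ^ 2)) := by
  have hN0 : 0 < N := by linarith
  have hd1 : ContDiff ℝ 2 (fun ζ => θ ζ ^ 2) := (contDiff_infty.1 (h.smooth.pow 2)) 2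
  have hf : ∀ z, HasDerivAt (fun ζ => θ ζ ^ 2) (deriv (fun ζ => θ ζ ^ 2) z) z := fun z =>
    (hd1.differentiable (by norm_num) z).hasDerivAt
  have hd2 : ContDiff ℝ 1 (deriv (fun ζ => θ ζ ^ 2)) := by
    have : ContDiff ℝ (1 + 1) (fun ζ => θ ζ ^ 2) := hd1
    exact (contDiff_succ_iff_deriv.1 this).2.2
  have hf' : ∀ z, HasDerivAt (deriv (fun ζ => θ ζ ^ 2)) (deriv (deriv (fun ζ => θ ζ ^ 2)) z) z :=
    fun z => (hd2.differentiable (by norm_num) z).hasDerivAt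
  have key : ∀ e, |p| ≤ |e| → |p + x| ≤ |e| → |p + x + y| ≤ |e| → |p + y| ≤ |e| →
      θ e ^ 2 ≤ 6 * (θ p * θ (p + x) * θ (p + x + y) * θ (p + y)) →
      |θ p ^ 2 - θ (p + x) ^ 2 + θ (p + x + y) ^ 2 - θ (p + y) ^ 2|
      ≤ 240 * (θ p * θ (p + x) * θ (p + x + y) * θ (p + y)) * (|x| * |y|)
        * (1 / (N ^ 2 + x ^ 2) + 1 / (N ^ 2 + y ^ 2)) := by
    intro e h1 h2 h3 h4 h5
    have hz : ∀ z, |z| ≤ |e| → θ z ^ 2 ≤ 6 * (θ p * θ (p + x) * θ (p + x + y) * θ (p + y)) := by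
      intro z hz
      have := h.one_le hN z
      have := h.mono z e hz
      exact le_trans (by gcongr) h5
    have := second_difference_bounds hf hf' (Λ := |e|)
      (A := 6 * (θ p * θ (p + x) * θ (p + x + y) * θ (p + y))) (N := N)
      (fun z hze => ⟨sq_nonneg _, hz z hze⟩)
      (fun z hze => (h.deriv_bounds hN z).1.trans (by have := hz z hze; gcongr))
      (fun z hze => (h.deriv_bounds hN z).2.trans (by have := hz z hze; gcongr)) hN0 h1 h2 h3 h4
    refine this.trans (le_of_eq ?_)
    ring
  have t1 : |p| ≤ |p + x| + |p + x + y| + |p + y| := by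
    calc |p| = |(p + x) - (p + x + y) + (p + y)| := by congr 1; ring
      _ ≤ _ := (abs_add_le _ _).trans (add_le_add_left (abs_sub _ _) _)
  have t2 : |p + x| ≤ |p| + |p + x + y| + |p + y| := by
    calc |p + x| = |p + (p + x + y) - (p + y)| := by congr 1; ring
      _ ≤ _ := (abs_sub _ _).trans (add_le_add_left (abs_add_le _ _) _)
  have t3 : |p + x + y| ≤ |p| + |p + x| + |p + y| := by
    calc |p + x + y| = |(p + y) - p + (p + x)| := by congr 1; ring
      _ ≤ |p + y| + |p| + |p + x| := (abs_add_le _ _).trans (add_le_add_left (abs_sub _ _) _)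
      _ = _ := by ring
  have t4 : |p + y| ≤ |p| + |p + x| + |p + x + y| := by
    calc |p + y| = |(p + x + y) - (p + x) + p| := by congr 1; ring
      _ ≤ |p + x + y| + |p + x| + |p| := (abs_add_le _ _).trans (add_le_add_left (abs_sub _ _) _)
      _ = _ := by ring
  have s1 := h.sq_le_prod hs1 hN t1
  have s2 := h.sq_le_prod hs1 hN t2
  have s3 := h.sq_le_prod hs1 hN t3
  have s4 := h.sq_le_prod hs1 hN t4
  obtain ⟨e, he, hmax⟩ := Finset.exists_max_image ({p, p + x, p + x + y, p + y} : Finset ℝ)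
    (fun z => |z|) ⟨p, by simp⟩
  refine key e (hmax _ (by simp)) (hmax _ (by simp)) (hmax _ (by simp)) (hmax _ (by simp)) ?_
  simp only [Finset.mem_insert, Finset.mem_singleton] at he
  rcases he with rfl | rfl | rfl | rfl
  · exact s1
  · linarith
  · linarith
  · linarith

end AdmissibleHigh

end

lemma ennreal_mul_le_sq_add_sq (a b : ℝ≥0∞) : a * b ≤ a ^ 2 + b ^ 2 := by
  rcases le_total a b with h | h
  · calc a * b ≤ b * b := by gcongr
      _ ≤ _ := by rw [← sq]; exact le_add_self
  · calc a * b ≤ a * a := by gcongr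
      _ ≤ _ := by rw [← sq]; exact le_self_add

lemma lintegral_translate_mul_le {F G : ℝ → ℝ≥0∞} (hF : Measurable F) (a b : ℝ) :
    ∫⁻ x, F (x + a) * G (x + b) ≤ (∫⁻ x, F x ^ 2) + ∫⁻ x, G x ^ 2 := by
  calc ∫⁻ x, F (x + a) * G (x + b) ≤ ∫⁻ x, (F (x + a) ^ 2 + G (x + b) ^ 2) :=
        lintegral_mono fun x => ennreal_mul_le_sq_add_sq _ _
    _ = (∫⁻ x, F (x + a) ^ 2) + ∫⁻ x, G (x + b) ^ 2 :=
        lintegral_add_left (by fun_prop) _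
    _ = _ := by
        rw [lintegral_add_right_eq_self (fun x => F x ^ 2) a,
          lintegral_add_right_eq_self (fun x => G x ^ 2) b]

/-- The variables are `q = ((ξ, η), p)`. -/
lemma lintegral_quad_fst_le {k F₁ F₂ F₃ F₄ : ℝ → ℝ≥0∞} (hk : Measurable k) (h₁ : Measurable F₁)
    (h₂ : Measurable F₂) (h₃ : Measurable F₃) (h₄ : Measurable F₄) :
    ∫⁻ q : (ℝ × ℝ) × ℝ, k q.1.1 * (F₁ q.2 * F₂ (q.2 + q.1.1) * F₃ (q.2 + q.1.1 + q.1.2)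
        * F₄ (q.2 + q.1.2))
      ≤ (∫⁻ x, k x) * ((∫⁻ x, F₁ x ^ 2) + ∫⁻ x, F₂ x ^ 2)
        * ((∫⁻ x, F₃ x ^ 2) + ∫⁻ x, F₄ x ^ 2) := by
  set A := (∫⁻ x, F₁ x ^ 2) + ∫⁻ x, F₂ x ^ 2
  set B := (∫⁻ x, F₃ x ^ 2) + ∫⁻ x, F₄ x ^ 2
  rw [Measure.volume_eq_prod, lintegral_prod_symm' _ (by fun_prop)]
  calc ∫⁻ p : ℝ, ∫⁻ r : ℝ × ℝ, k r.1 * (F₁ p * F₂ (p + r.1) * F₃ (p + r.1 + r.2) * F₄ (p + r.2))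
      = ∫⁻ p : ℝ, ∫⁻ ξ : ℝ, ∫⁻ η : ℝ,
          k ξ * (F₁ p * F₂ (p + ξ) * F₃ (p + ξ + η) * F₄ (p + η)) := by
        refine lintegral_congr fun p => ?_
        rw [Measure.volume_eq_prod, lintegral_prod _ (by fun_prop)]
    _ ≤ ∫⁻ p : ℝ, ∫⁻ ξ : ℝ, k ξ * (F₁ p * F₂ (p + ξ)) * B := by
        refine lintegral_mono fun p => lintegral_mono fun ξ => ?_
        simp_rw [mul_assoc (F₁ p * F₂ (p + ξ)), ← mul_assoc (k ξ) (F₁ p * F₂ (p + ξ))]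
        rw [lintegral_const_mul _ (by fun_prop)]
        gcongr
        refine le_trans (le_of_eq (lintegral_congr fun η => ?_))
          (lintegral_translate_mul_le h₃ (p + ξ) p)
        rw [add_comm (p + ξ) η, add_comm p η]
    _ = ∫⁻ ξ : ℝ, ∫⁻ p : ℝ, k ξ * (F₁ p * F₂ (p + ξ)) * B :=
        lintegral_lintegral_swap (by unfold Function.uncurry; fun_prop)
    _ ≤ ∫⁻ ξ : ℝ, k ξ * A * B := by
        refine lintegral_mono fun ξ => ?_
        simp only
        rw [lintegral_mul_const _ (by fun_prop), lintegral_const_mul _ (by fun_prop)]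
        gcongr
        simpa using lintegral_translate_mul_le (G := F₂) h₁ 0 ξ
    _ = _ := by
        rw [lintegral_mul_const _ (by fun_prop), lintegral_mul_const _ (by fun_prop)]

lemma lintegral_quad_snd_le {k F₁ F₂ F₃ F₄ : ℝ → ℝ≥0∞} (hk : Measurable k) (h₁ : Measurable F₁)
    (h₂ : Measurable F₂) (h₃ : Measurable F₃) (h₄ : Measurable F₄) :
    ∫⁻ q : (ℝ × ℝ) × ℝ, k q.1.2 * (F₁ q.2 * F₂ (q.2 + q.1.1) * F₃ (q.2 + q.1.1 + q.1.2)
        * F₄ (q.2 + q.1.2))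
      ≤ (∫⁻ x, k x) * ((∫⁻ x, F₁ x ^ 2) + ∫⁻ x, F₄ x ^ 2)
        * ((∫⁻ x, F₃ x ^ 2) + ∫⁻ x, F₂ x ^ 2) := by
  refine le_trans (le_of_eq ?_) (lintegral_quad_fst_le hk h₁ h₄ h₃ h₂)
  have hm : MeasurePreserving (fun q : (ℝ × ℝ) × ℝ => (q.1.swap, q.2)) :=
    (Measure.measurePreserving_swap (μ := (volume : Measure ℝ)) (ν := (volume : Measure ℝ))).prod
      (MeasurePreserving.id (volume : Measure ℝ))
  rw [← hm.lintegral_comp (by fun_prop)]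
  refine lintegral_congr fun q => ?_
  simp only [Prod.fst_swap, Prod.snd_swap]
  rw [add_right_comm q.2 q.1.2 q.1.1]
  ring

/-- The weight `1 / (N² + (2πξ)²)`. -/
def kern (N ξ : ℝ) : ℝ := 1 / (N ^ 2 + (2 * π * ξ) ^ 2)

lemma measurable_kern (N : ℝ) : Measurable (kern N) := by unfold kern; fun_prop

lemma lintegral_kern_le {N : ℝ} (hN : 0 < N) :
    ∫⁻ ξ, ENNReal.ofReal (kern N ξ) ≤ ENNReal.ofReal (1 / N) := by
  have h1 : (fun ξ => kern N ξ) = fun ξ => (N ^ 2)⁻¹ * (1 + ((2 * π / N) * ξ) ^ 2)⁻¹ := by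
    ext ξ
    unfold kern
    rw [← mul_inv, one_div]
    congr 1
    field_simp
  have hi : Integrable (fun ξ : ℝ => (1 + ((2 * π / N) * ξ) ^ 2)⁻¹) :=
    integrable_inv_one_add_sq.comp_mul_left' (by positivity)
  have hk : Integrable (fun ξ => kern N ξ) := by rw [h1]; exact hi.const_mul _
  rw [← ofReal_integral_eq_lintegral_ofReal hk
    (Filter.Eventually.of_forall fun ξ => by simp only [Pi.zero_apply]; unfold kern; positivity)]
  apply ENNReal.ofReal_le_ofReal
  rw [h1, integral_const_mul, Measure.integral_comp_mul_left (fun x => (1 + x ^ 2)⁻¹),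
    integral_univ_inv_one_add_sq, smul_eq_mul, abs_of_pos (by positivity)]
  have : (N ^ 2)⁻¹ * ((2 * π / N)⁻¹ * π) = 1 / 2 * (1 / N) := by field_simp
  rw [this]
  have : 0 < 1 / N := by positivity
  linarith

/-- The quadrilinear form at `q = ((ξ, η), p)`. -/
def quad (G₁ G₂ G₃ G₄ : ℝ → ℂ) (q : (ℝ × ℝ) × ℝ) : ℂ :=
  G₁ q.2 * (starRingEnd ℂ) (G₂ (q.2 + q.1.1)) * G₃ (q.2 + q.1.1 + q.1.2)
    * (starRingEnd ℂ) (G₄ (q.2 + q.1.2))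

lemma norm_quad (G₁ G₂ G₃ G₄ : ℝ → ℂ) (q : (ℝ × ℝ) × ℝ) : ‖quad G₁ G₂ G₃ G₄ q‖
    = ‖G₁ q.2‖ * ‖G₂ (q.2 + q.1.1)‖ * ‖G₃ (q.2 + q.1.1 + q.1.2)‖ * ‖G₄ (q.2 + q.1.2)‖ := by
  simp [quad]

lemma enorm_quad (G₁ G₂ G₃ G₄ : ℝ → ℂ) (q : (ℝ × ℝ) × ℝ) : ‖quad G₁ G₂ G₃ G₄ q‖ₑ
    = ‖G₁ q.2‖ₑ * ‖G₂ (q.2 + q.1.1)‖ₑ * ‖G₃ (q.2 + q.1.1 + q.1.2)‖ₑ * ‖G₄ (q.2 + q.1.2)‖ₑ := by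
  simp [quad, enorm_mul]

lemma measurable_quad_param {α : Type*} [MeasurableSpace α] {G₁ G₂ G₃ G₄ : α → ℝ → ℂ}
    (h₁ : Measurable (fun q : α × ℝ => G₁ q.1 q.2)) (h₂ : Measurable (fun q : α × ℝ => G₂ q.1 q.2))
    (h₃ : Measurable (fun q : α × ℝ => G₃ q.1 q.2))
    (h₄ : Measurable (fun q : α × ℝ => G₄ q.1 q.2)) :
    Measurable (fun z : α × ((ℝ × ℝ) × ℝ) => quad (G₁ z.1) (G₂ z.1) (G₃ z.1) (G₄ z.1) z.2) := by
  have hc := Complex.continuous_conj.measurable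
  unfold quad
  refine ((Measurable.mul ?_ (hc.comp ?_)).mul ?_).mul (hc.comp ?_)
  · exact h₁.comp (g := fun q : α × ℝ => G₁ q.1 q.2)
      (by fun_prop : Measurable fun z : α × ((ℝ × ℝ) × ℝ) => (z.1, z.2.2))
  · exact h₂.comp (g := fun q : α × ℝ => G₂ q.1 q.2)
      (by fun_prop : Measurable fun z : α × ((ℝ × ℝ) × ℝ) => (z.1, z.2.2 + z.2.1.1))
  · exact h₃.comp (g := fun q : α × ℝ => G₃ q.1 q.2)
      (by fun_prop : Measurable fun z : α × ((ℝ × ℝ) × ℝ) => (z.1, z.2.2 + z.2.1.1 + z.2.1.2))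
  · exact h₄.comp (g := fun q : α × ℝ => G₄ q.1 q.2)
      (by fun_prop : Measurable fun z : α × ((ℝ × ℝ) × ℝ) => (z.1, z.2.2 + z.2.1.2))

lemma measurable_quad {G : ℝ → ℂ} (h : Measurable G) : Measurable (quad G G G G) := by
  have hc := Complex.continuous_conj.measurable
  unfold quad
  refine ((Measurable.mul ?_ (hc.comp ?_)).mul ?_).mul (hc.comp ?_)
  · exact h.comp measurable_snd
  · exact h.comp (by fun_prop : Measurable fun q : (ℝ × ℝ) × ℝ => q.2 + q.1.1)
  · exact h.comp (by fun_prop : Measurable fun q : (ℝ × ℝ) × ℝ => q.2 + q.1.1 + q.1.2)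
  · exact h.comp (by fun_prop : Measurable fun q : (ℝ × ℝ) × ℝ => q.2 + q.1.2)

/-- An integrable weight in the variables `((ξ, η), p)`. -/
def decQ (q : (ℝ × ℝ) × ℝ) : ℝ := dec 1 q.1.1 * dec 1 q.1.2 * dec 1 q.2

lemma decQ_nonneg (q : (ℝ × ℝ) × ℝ) : 0 ≤ decQ q := by
  unfold decQ
  have := dec_pos 1 q.1.1; have := dec_pos 1 q.1.2; have := dec_pos 1 q.2
  positivity

lemma decQ_le (q : (ℝ × ℝ) × ℝ) : decQ q ≤ dec 1 q.1.1 * dec 1 q.1.2 :=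
  mul_le_of_le_one_right (mul_pos (dec_pos _ _) (dec_pos _ _)).le (dec_le_one _ _)

lemma integrable_decQ : Integrable decQ :=
  ((integrable_dec le_rfl).mul_prod (integrable_dec le_rfl)).mul_prod (integrable_dec le_rfl)

lemma norm_quad_le {C : ℝ} {G : ℝ → ℂ} (h : HasDec 4 C G) (q : (ℝ × ℝ) × ℝ) :
    (1 + q.2 ^ 2) * ‖quad G G G G q‖ ≤ 4 * C ^ 4 * decQ q := by
  obtain ⟨⟨ξ, η⟩, p⟩ := q
  have hC := h.nonneg
  have d : ∀ m x, 0 < dec m x := dec_pos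
  have e1 : dec 1 p * dec 1 (p + ξ) ≤ 2 * dec 1 ξ := by
    have := dec_mul_le 1 ξ (-p)
    rwa [dec_neg, sub_neg_eq_add, add_comm ξ p, pow_one] at this
  have e2 : dec 1 p * dec 1 (p + η) ≤ 2 * dec 1 η := by
    have := dec_mul_le 1 η (-p)
    rwa [dec_neg, sub_neg_eq_add, add_comm η p, pow_one] at this
  have e0 : (1 + p ^ 2) * dec 4 p = dec 1 p * (dec 1 p * dec 1 p) := by
    unfold dec; field_simp
  rw [norm_quad]
  dsimp only
  calc (1 + p ^ 2) * (‖G p‖ * ‖G (p + ξ)‖ * ‖G (p + ξ + η)‖ * ‖G (p + η)‖)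
      ≤ (1 + p ^ 2) * ((C * dec 4 p) * (C * dec 4 (p + ξ)) * C * (C * dec 4 (p + η))) := by
        have := h.bound p; have := h.bound (p + ξ); have := h.bdd (p + ξ + η)
        have := h.bound (p + η)
        have := d 4 p; have := d 4 (p + ξ)
        gcongr
    _ = C ^ 4 * (((1 + p ^ 2) * dec 4 p) * dec 4 (p + ξ) * dec 4 (p + η)) := by ring
    _ ≤ C ^ 4 * (((1 + p ^ 2) * dec 4 p) * dec 1 (p + ξ) * dec 1 (p + η)) := by
        have := d 4 p; have := d 4 (p + η); have := d 1 (p + ξ)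
        have := dec_anti (show 1 ≤ 4 by norm_num) (p + ξ)
        have := dec_anti (show 1 ≤ 4 by norm_num) (p + η)
        gcongr
    _ = C ^ 4 * (dec 1 p * (dec 1 p * dec 1 (p + ξ)) * (dec 1 p * dec 1 (p + η))) := by
        rw [e0]; ring
    _ ≤ C ^ 4 * (dec 1 p * (2 * dec 1 ξ) * (2 * dec 1 η)) := by
        have := d 1 p; have := d 1 ξ; have := d 1 (p + η)
        gcongr
    _ = _ := by unfold decQ; ring

/-- The first symmetry of the quadrilinear form. -/
def flipFst (q : (ℝ × ℝ) × ℝ) : (ℝ × ℝ) × ℝ := ((-q.1.1, q.1.2), q.2 + q.1.1)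

/-- The second symmetry of the quadrilinear form. -/
def flipSnd (q : (ℝ × ℝ) × ℝ) : (ℝ × ℝ) × ℝ := ((q.1.1, -q.1.2), q.2 + q.1.2)

lemma measurePreserving_flipFst : MeasurePreserving flipFst := by
  have h := (Measure.measurePreserving_neg (volume : Measure ℝ)).prod
    (MeasurePreserving.id (volume : Measure ℝ))
  exact h.skew_product (g := fun r p => p + r.1) (by unfold Function.uncurry; fun_prop)
    (Filter.Eventually.of_forall fun r => map_add_right_eq_self _ _)

lemma measurePreserving_flipSnd : MeasurePreserving flipSnd := by
  have h := (MeasurePreserving.id (volume : Measure ℝ)).prod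
    (Measure.measurePreserving_neg (volume : Measure ℝ))
  exact h.skew_product (g := fun r p => p + r.2) (by unfold Function.uncurry; fun_prop)
    (Filter.Eventually.of_forall fun r => map_add_right_eq_self _ _)

lemma quad_flipFst (G : ℝ → ℂ) (q : (ℝ × ℝ) × ℝ) :
    quad G G G G (flipFst q) = (starRingEnd ℂ) (quad G G G G q) := by
  simp only [quad, flipFst, map_mul, Complex.conj_conj, add_neg_cancel_right]
  ring

lemma quad_flipSnd (G : ℝ → ℂ) (q : (ℝ × ℝ) × ℝ) :
    quad G G G G (flipSnd q) = (starRingEnd ℂ) (quad G G G G q) := by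
  simp only [quad, flipSnd, map_mul, Complex.conj_conj, add_neg_cancel_right]
  rw [show q.2 + q.1.2 + q.1.1 + -q.1.2 = q.2 + q.1.1 by ring,
    show q.2 + q.1.2 + q.1.1 = q.2 + q.1.1 + q.1.2 by ring]
  ring

lemma flipFst_involutive (q : (ℝ × ℝ) × ℝ) : flipFst (flipFst q) = q := by
  simp [flipFst]

lemma flipSnd_involutive (q : (ℝ × ℝ) × ℝ) : flipSnd (flipSnd q) = q := by
  simp [flipSnd]

/-- Symmetrisation of a weighted integral of a function `Q` with the symmetries of `quad`. -/
lemma integral_im_symmetrize {a : ℝ → ℝ} {Q : (ℝ × ℝ) × ℝ → ℂ}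
    (h1 : ∀ q, Q (flipFst q) = (starRingEnd ℂ) (Q q))
    (h2 : ∀ q, Q (flipSnd q) = (starRingEnd ℂ) (Q q))
    (hi : Integrable (fun q => a q.2 * (Q q).im)) :
    4 * ∫ q, a q.2 * (Q q).im
      = ∫ q : (ℝ × ℝ) × ℝ, (a q.2 - a (q.2 + q.1.1) + a (q.2 + q.1.1 + q.1.2) - a (q.2 + q.1.2))
        * (Q q).im := by
  set F : (ℝ × ℝ) × ℝ → ℝ := fun q => a q.2 * (Q q).im with hF
  have m1 := measurePreserving_flipFst
  have m2 := measurePreserving_flipSnd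
  have e1 : MeasurableEmbedding flipFst :=
    (MeasurableEquiv.ofInvolutive flipFst flipFst_involutive m1.measurable).measurableEmbedding
  have e2 : MeasurableEmbedding flipSnd :=
    (MeasurableEquiv.ofInvolutive flipSnd flipSnd_involutive m2.measurable).measurableEmbedding
  have i1 : Integrable (fun q => F (flipFst q)) := m1.integrable_comp_of_integrable hi
  have i2 : Integrable (fun q => F (flipSnd q)) := m2.integrable_comp_of_integrable hi
  have i3 : Integrable (fun q => F (flipFst (flipSnd q))) := m2.integrable_comp_of_integrable i1
  have i4 : Integrable (fun q => F q + F (flipFst q)) := hi.add i1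
  have i5 : Integrable (fun q => F q + F (flipFst q) + F (flipFst (flipSnd q))) := i4.add i3
  have j1 : ∫ q, F (flipFst q) = ∫ q, F q := m1.integral_comp e1 F
  have j2 : ∫ q, F (flipSnd q) = ∫ q, F q := m2.integral_comp e2 F
  have j3 : ∫ q, F (flipFst (flipSnd q)) = ∫ q, F q := by
    rw [← j1]; exact m2.integral_comp e2 (fun q => F (flipFst q))
  calc 4 * ∫ q, F q = (∫ q, F q) + (∫ q, F (flipFst q)) + (∫ q, F (flipFst (flipSnd q)))
        + ∫ q, F (flipSnd q) := by rw [j1, j2, j3]; ring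
    _ = ∫ q, (F q + F (flipFst q) + F (flipFst (flipSnd q)) + F (flipSnd q)) := by
        rw [integral_add i5 i2, integral_add i4 i3, integral_add hi i1]
    _ = _ := by
        refine integral_congr_ae (Filter.Eventually.of_forall fun q => ?_)
        simp only [hF]
        rw [h1, h1, h2]
        simp only [flipFst, flipSnd, Complex.conj_im, neg_neg]
        rw [add_right_comm q.2 q.1.2 q.1.1]
        ring

section

/-- The time integral of the quadrilinear form along `U`. -/
def quadInt (U : ℝ → ℝ → ℂ) (δ : ℝ) (q : (ℝ × ℝ) × ℝ) : ℂ :=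
  ∫ t in Set.Ioc 0 δ, quad (U t) (U t) (U t) (U t) q

lemma mul_conj_conv3 {C : ℝ} {G : ℝ → ℂ} (h : HasDec 4 C G) (p : ℝ) :
    G p * (starRingEnd ℂ) (conv3 G p) = ∫ r, quad G G G G (r, p) := by
  have hq := measurable_quad h.meas
  have hi : Integrable (fun r : ℝ × ℝ => quad G G G G (r, p)) := by
    refine (((integrable_dec le_rfl).mul_prod (integrable_dec le_rfl)).const_mul
      (4 * C ^ 4)).mono' (hq.comp (by fun_prop : Measurable fun r : ℝ × ℝ => (r, p))
        ).aestronglyMeasurable (Filter.Eventually.of_forall fun r => ?_)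
    have h0 := norm_quad_le h (r, p)
    have hC := h.nonneg
    have h1 : (1 : ℝ) ≤ 1 + p ^ 2 := by nlinarith
    calc ‖quad G G G G (r, p)‖ ≤ (1 + p ^ 2) * ‖quad G G G G (r, p)‖ :=
          le_mul_of_one_le_left (norm_nonneg _) h1
      _ ≤ 4 * C ^ 4 * decQ (r, p) := h0
      _ ≤ _ := by
          have := decQ_le (r, p)
          gcongr
  rw [Measure.volume_eq_prod, integral_prod _ (by rw [← Measure.volume_eq_prod]; exact hi),
    conv3_eq_integral, ← integral_conj, ← integral_const_mul]
  refine integral_congr_ae (Filter.Eventually.of_forall fun ξ => ?_)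
  dsimp only
  rw [← integral_conj, ← integral_const_mul]
  refine integral_congr_ae (Filter.Eventually.of_forall fun η => ?_)
  simp only [quad, map_mul, Complex.conj_conj]
  ring

section
variable {U : ℝ → ℝ → ℂ} {δ : ℝ}

lemma FreqSol.measurable_quad (h : FreqSol U) : Measurable
    (fun z : ℝ × ((ℝ × ℝ) × ℝ) => quad (U z.1) (U z.1) (U z.1) (U z.1) z.2) :=
  measurable_quad_param h.meas h.meas h.meas h.meas

lemma FreqSol.norm_quad_le (h : FreqSol U) : ∃ K : ℝ, 0 ≤ K ∧ ∀ t ∈ Set.Icc (0 : ℝ) 1, ∀ q,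
    (1 + q.2 ^ 2) * ‖quad (U t) (U t) (U t) (U t) q‖ ≤ K * decQ q := by
  obtain ⟨C, hC⟩ := h.decay
  have := (hC 0 (by simp)).nonneg
  exact ⟨4 * C ^ 4, by positivity, fun t ht q => _root_.norm_quad_le (hC t ht) q⟩

lemma FreqSol.hasDerivAt_norm_sq (h : FreqSol U) {t : ℝ} (ht : t ∈ Set.Icc (0 : ℝ) 1) (p : ℝ) :
    HasDerivAt (fun τ => ‖U τ p‖ ^ 2) (2 * (∫ r, quad (U t) (U t) (U t) (U t) (r, p)).im) t := by
  obtain ⟨C, hC⟩ := h.decay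
  refine (h.deriv t ht p).norm_sq.congr_deriv ?_
  rw [← mul_conj_conv3 (hC t ht) p, Complex.inner]
  simp only [Complex.mul_re, Complex.mul_im, Complex.I_re, Complex.I_im, Complex.conj_re,
    Complex.conj_im, Complex.sub_re, Complex.sub_im, Complex.ofReal_re, Complex.ofReal_im]
  ring

lemma FreqSol.norm_sq_sub (h : FreqSol U) (hδ0 : 0 ≤ δ) (hδ1 : δ ≤ 1) (p : ℝ) :
    ‖U δ p‖ ^ 2 - ‖U 0 p‖ ^ 2 = 2 * ∫ r, (quadInt U δ (r, p)).im := by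
  obtain ⟨K, hK0, hK⟩ := h.norm_quad_le
  have hm := h.measurable_quad
  have hIoc : ∀ t ∈ Set.Ioc 0 δ, t ∈ Set.Icc (0 : ℝ) 1 := fun t ht => ⟨ht.1.le, ht.2.trans hδ1⟩
  have hsub : Set.uIcc 0 δ ⊆ Set.Icc 0 1 := by
    rw [Set.uIcc_of_le hδ0]; exact Set.Icc_subset_Icc le_rfl hδ1
  have hb : ∀ t ∈ Set.Icc (0 : ℝ) 1, ∀ r : ℝ × ℝ, ‖quad (U t) (U t) (U t) (U t) (r, p)‖
      ≤ K * (dec 1 r.1 * dec 1 r.2) := by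
    intro t ht r
    have h1 : (1 : ℝ) ≤ 1 + p ^ 2 := by nlinarith
    calc _ ≤ (1 + p ^ 2) * ‖quad (U t) (U t) (U t) (U t) (r, p)‖ :=
          le_mul_of_one_le_left (norm_nonneg _) h1
      _ ≤ K * decQ (r, p) := hK t ht (r, p)
      _ ≤ _ := by
          have := decQ_le (r, p)
          gcongr
  have hprod : Integrable (Function.uncurry fun (t : ℝ) (r : ℝ × ℝ) =>
      quad (U t) (U t) (U t) (U t) (r, p)) ((volume.restrict (Set.Ioc 0 δ)).prod volume) := by
    have hbase : Integrable (fun z : ℝ × (ℝ × ℝ) => (1 : ℝ) * (K * (dec 1 z.2.1 * dec 1 z.2.2)))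
        ((volume.restrict (Set.Ioc 0 δ)).prod volume) :=
      (integrable_const (1 : ℝ)).mul_prod
        (((integrable_dec le_rfl).mul_prod (integrable_dec le_rfl)).const_mul K)
    refine hbase.mono' ?_ ?_
    · exact (hm.comp (by fun_prop : Measurable fun z : ℝ × (ℝ × ℝ) => (z.1, (z.2, p)))
        ).aestronglyMeasurable
    · have : ∀ᵐ z ∂((volume.restrict (Set.Ioc 0 δ)).prod (volume : Measure (ℝ × ℝ))),
          z.1 ∈ Set.Ioc 0 δ :=
        Measure.quasiMeasurePreserving_fst.ae (ae_restrict_mem measurableSet_Ioc)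
      filter_upwards [this] with z hz
      rw [one_mul]
      exact hb z.1 (hIoc _ hz) z.2
  have hquad : Integrable (fun t => ∫ r, quad (U t) (U t) (U t) (U t) (r, p))
      (volume.restrict (Set.Ioc 0 δ)) := hprod.integral_prod_left
  have hquad' : Integrable (fun r => quadInt U δ (r, p)) := hprod.integral_prod_right
  have hii : IntervalIntegrable
      (fun t => 2 * (∫ r, quad (U t) (U t) (U t) (U t) (r, p)).im) volume 0 δ := by
    rw [intervalIntegrable_iff, Set.uIoc_of_le hδ0]
    exact (hquad.im).const_mul 2
  rw [← intervalIntegral.integral_eq_sub_of_hasDerivAt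
    (fun t ht => h.hasDerivAt_norm_sq (hsub ht) p) hii, intervalIntegral.integral_of_le hδ0,
    integral_const_mul]
  congr 1
  have e1 := integral_im hquad
  have e2 := integral_im hquad'
  simp only [RCLike.im_eq_complex_im] at e1 e2
  rw [e1, e2]
  congr 1
  exact integral_integral_swap hprod

lemma FreqSol.quadInt_bound (h : FreqSol U) (hδ1 : δ ≤ 1) : ∃ K : ℝ, 0 ≤ K ∧
    ∀ q, (1 + q.2 ^ 2) * ‖quadInt U δ q‖ ≤ K * decQ q := by
  obtain ⟨K, hK0, hK⟩ := h.norm_quad_le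
  refine ⟨K, hK0, fun q => ?_⟩
  have hp : 0 < 1 + q.2 ^ 2 := by positivity
  rw [mul_comm, ← le_div_iff₀ hp]
  have := norm_setIntegral_le_of_norm_le_const (μ := (volume : Measure ℝ)) (s := Set.Ioc 0 δ)
    (f := fun t => quad (U t) (U t) (U t) (U t) q) (C := K * decQ q / (1 + q.2 ^ 2)) (by simp)
    (fun t ht => by
      rw [le_div_iff₀ hp, mul_comm]
      exact hK t ⟨ht.1.le, ht.2.trans hδ1⟩ q)
  refine this.trans (mul_le_of_le_one_right (by have := decQ_nonneg q; positivity) ?_)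
  rw [Measure.real, Real.volume_Ioc, sub_zero]
  exact ENNReal.toReal_le_of_le_ofReal zero_le_one (ENNReal.ofReal_le_ofReal hδ1)

lemma FreqSol.measurable_quadInt (h : FreqSol U) : Measurable (quadInt U δ) := by
  unfold quadInt
  refine (StronglyMeasurable.integral_prod_left (μ := volume.restrict (Set.Ioc 0 δ))
    (f := fun t q => quad (U t) (U t) (U t) (U t) q) ?_).measurable
  exact h.measurable_quad.stronglyMeasurable

lemma FreqSol.integrable_weighted_quadInt (h : FreqSol U) (hδ1 : δ ≤ 1) {a : ℝ → ℝ}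
    (ha : Measurable a) {B : ℝ} (hB : ∀ p, |a p| ≤ B * (1 + p ^ 2)) :
    Integrable (fun q => a q.2 * (quadInt U δ q).im) := by
  obtain ⟨K, hK0, hK⟩ := h.quadInt_bound hδ1
  have hB0 : 0 ≤ B := by have := (abs_nonneg _).trans (hB 0); simpa using this
  refine (integrable_decQ.const_mul (B * K)).mono' ?_ (Filter.Eventually.of_forall fun q => ?_)
  · exact ((ha.comp measurable_snd).mul
      (Complex.measurable_im.comp h.measurable_quadInt)).aestronglyMeasurable
  · rw [norm_mul, Real.norm_eq_abs, Real.norm_eq_abs]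
    calc |a q.2| * |(quadInt U δ q).im| ≤ B * (1 + q.2 ^ 2) * ‖quadInt U δ q‖ := by
          have := hB q.2
          have := Complex.abs_im_le_norm (quadInt U δ q)
          gcongr
      _ = B * ((1 + q.2 ^ 2) * ‖quadInt U δ q‖) := by ring
      _ ≤ B * (K * decQ q) := by have := hK q; gcongr
      _ = _ := by ring

lemma HasDec.integrable_weighted_sq {C : ℝ} {G : ℝ → ℂ} (h : HasDec 4 C G) {a : ℝ → ℝ}
    (ha : Measurable a) {B : ℝ} (hB : ∀ p, |a p| ≤ B * (1 + p ^ 2)) :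
    Integrable (fun p => a p * ‖G p‖ ^ 2) := by
  have hB0 : 0 ≤ B := by have := (abs_nonneg _).trans (hB 0); simpa using this
  have hC := h.nonneg
  refine ((integrable_dec (le_refl 1)).const_mul (B * C * C)).mono' ?_
    (Filter.Eventually.of_forall fun p => ?_)
  · exact (ha.mul (h.meas.norm.pow_const 2)).aestronglyMeasurable
  · rw [norm_mul, Real.norm_eq_abs, norm_pow, norm_norm]
    have e0 : (1 + p ^ 2) * dec 4 p = dec 3 p := by unfold dec; field_simp
    calc |a p| * ‖G p‖ ^ 2 ≤ (B * (1 + p ^ 2)) * ((C * dec 4 p) * C) := by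
          have := hB p; have := h.bound p; have := h.bdd p; have := dec_pos 4 p
          rw [sq]
          gcongr
      _ = B * C * C * dec 3 p := by rw [← e0]; ring
      _ ≤ _ := by
          have := dec_anti (show 1 ≤ 3 by norm_num) p
          gcongr

lemma FreqSol.weighted_sub (h : FreqSol U) (hδ0 : 0 ≤ δ) (hδ1 : δ ≤ 1) {a : ℝ → ℝ}
    (ha : Measurable a) {B : ℝ} (hB : ∀ p, |a p| ≤ B * (1 + p ^ 2)) :
    2 * ((∫ p, a p * ‖U δ p‖ ^ 2) - ∫ p, a p * ‖U 0 p‖ ^ 2)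
      = ∫ q : (ℝ × ℝ) × ℝ, (a q.2 - a (q.2 + q.1.1) + a (q.2 + q.1.1 + q.1.2) - a (q.2 + q.1.2))
        * (quadInt U δ q).im := by
  obtain ⟨C, hC⟩ := h.decay
  have hi := h.integrable_weighted_quadInt hδ1 ha hB
  rw [← integral_im_symmetrize (fun q => ?_) (fun q => ?_) hi]
  · rw [← integral_sub ((hC δ ⟨hδ0, hδ1⟩).integrable_weighted_sq ha hB)
      ((hC 0 (by simp)).integrable_weighted_sq ha hB)]
    simp_rw [← mul_sub, h.norm_sq_sub hδ0 hδ1]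
    rw [Measure.volume_eq_prod (ℝ × ℝ) ℝ,
      integral_prod_symm _ (by rw [← Measure.volume_eq_prod]; exact hi)]
    simp_rw [integral_const_mul]
    rw [← integral_const_mul, ← integral_const_mul]
    refine integral_congr_ae (Filter.Eventually.of_forall fun p => ?_)
    dsimp only
    ring
  · unfold quadInt
    rw [← integral_conj]
    simp_rw [quad_flipFst]
  · unfold quadInt
    rw [← integral_conj]
    simp_rw [quad_flipSnd]

end

end

section

/-- The sum of the four forms with one slot replaced by `W`. -/
def quadSum (G W : ℝ → ℂ) (q : (ℝ × ℝ) × ℝ) : ℝ≥0∞ :=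
  ‖quad W G G G q‖ₑ + ‖quad G W G G q‖ₑ + ‖quad G G W G q‖ₑ + ‖quad G G G W q‖ₑ

/-- The nonresonant part of the time derivative of `quad`. -/
def quadForcing (G W : ℝ → ℂ) (q : (ℝ × ℝ) × ℝ) : ℂ :=
  Complex.I * (quad W G G G q - quad G W G G q + quad G G W G q - quad G G G W q)

lemma enorm_quadForcing_le (G W : ℝ → ℂ) (q : (ℝ × ℝ) × ℝ) :
    ‖quadForcing G W q‖ₑ ≤ quadSum G W q := by
  unfold quadForcing quadSum
  rw [enorm_mul, show ‖Complex.I‖ₑ = 1 by simp [← ofReal_norm], one_mul]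
  refine (enorm_sub_le).trans ?_
  gcongr
  refine (enorm_add_le _ _).trans ?_
  gcongr
  exact enorm_sub_le

lemma norm_quad_le_of_bdd {G₁ G₂ G₃ G₄ : ℝ → ℂ} {C₁ C₂ C₃ C₄ : ℝ} (h₁ : ∀ x, ‖G₁ x‖ ≤ C₁)
    (h₂ : ∀ x, ‖G₂ x‖ ≤ C₂) (h₃ : ∀ x, ‖G₃ x‖ ≤ C₃) (h₄ : ∀ x, ‖G₄ x‖ ≤ C₄) (q : (ℝ × ℝ) × ℝ) :
    ‖quad G₁ G₂ G₃ G₄ q‖ ≤ C₁ * C₂ * C₃ * C₄ := by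
  rw [norm_quad]
  have := (norm_nonneg _).trans (h₁ 0)
  have := (norm_nonneg _).trans (h₂ 0)
  have := (norm_nonneg _).trans (h₃ 0)
  gcongr
  exacts [h₁ _, h₂ _, h₃ _, h₄ _]

section
variable {U : ℝ → ℝ → ℂ} {δ : ℝ}

lemma FreqSol.hasDerivAt_quad (h : FreqSol U) {t : ℝ} (ht : t ∈ Set.Icc (0 : ℝ) 1)
    (q : (ℝ × ℝ) × ℝ) : HasDerivAt (fun τ => quad (U τ) (U τ) (U τ) (U τ) q)
      (-(Complex.I * (8 * π ^ 2 * q.1.1 * q.1.2 : ℝ)) * quad (U t) (U t) (U t) (U t) q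
        + quadForcing (U t) (conv3 (U t)) q) t := by
  have d := h.deriv t ht
  have := (((d q.2).mul (d (q.2 + q.1.1)).star).mul (d (q.2 + q.1.1 + q.1.2))).mul
    (d (q.2 + q.1.2)).star
  refine this.congr_deriv ?_
  simp only [quad, quadForcing, Pi.mul_apply, ← starRingEnd_apply, map_mul,
    map_sub, Complex.conj_I, Complex.conj_ofReal]
  push_cast
  ring

lemma FreqSol.integrableOn_quad_of (h : FreqSol U) (hδ1 : δ ≤ 1) (q : (ℝ × ℝ) × ℝ) :
    IntegrableOn (fun t => quad (U t) (U t) (U t) (U t) q) (Set.Ioc 0 δ) ∧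
    IntegrableOn (fun t => quadForcing (U t) (conv3 (U t)) q) (Set.Ioc 0 δ) := by
  obtain ⟨C, hC⟩ := h.decay
  obtain ⟨D, hD⟩ := h.conv3_decay
  have mU := h.meas
  have mW : Measurable (fun q : ℝ × ℝ => conv3 (U q.1) q.2) := measurable_conv3_param h.meas
  have key : ∀ (G₁ G₂ G₃ G₄ : ℝ → ℝ → ℂ) (C₁ C₂ C₃ C₄ : ℝ)
      (_ : Measurable (fun q : ℝ × ℝ => G₁ q.1 q.2)) (_ : Measurable (fun q : ℝ × ℝ => G₂ q.1 q.2))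
      (_ : Measurable (fun q : ℝ × ℝ => G₃ q.1 q.2)) (_ : Measurable (fun q : ℝ × ℝ => G₄ q.1 q.2))
      (_ : ∀ t ∈ Set.Icc (0 : ℝ) 1, ∀ x, ‖G₁ t x‖ ≤ C₁)
      (_ : ∀ t ∈ Set.Icc (0 : ℝ) 1, ∀ x, ‖G₂ t x‖ ≤ C₂)
      (_ : ∀ t ∈ Set.Icc (0 : ℝ) 1, ∀ x, ‖G₃ t x‖ ≤ C₃)
      (_ : ∀ t ∈ Set.Icc (0 : ℝ) 1, ∀ x, ‖G₄ t x‖ ≤ C₄),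
      IntegrableOn (fun t => quad (G₁ t) (G₂ t) (G₃ t) (G₄ t) q) (Set.Ioc 0 δ) := by
    intro G₁ G₂ G₃ G₄ C₁ C₂ C₃ C₄ m₁ m₂ m₃ m₄ b₁ b₂ b₃ b₄
    refine Measure.integrableOn_of_bounded (M := C₁ * C₂ * C₃ * C₄) (by simp) ?_ ?_
    · exact ((measurable_quad_param m₁ m₂ m₃ m₄).comp
        (by fun_prop : Measurable fun s : ℝ => (s, q))).aestronglyMeasurable
    · refine (ae_restrict_mem measurableSet_Ioc).mono fun s hs => ?_
      have hs' : s ∈ Set.Icc (0 : ℝ) 1 := ⟨hs.1.le, hs.2.trans hδ1⟩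
      exact norm_quad_le_of_bdd (b₁ s hs') (b₂ s hs') (b₃ s hs') (b₄ s hs') q
  have bU : ∀ t ∈ Set.Icc (0 : ℝ) 1, ∀ x, ‖U t x‖ ≤ C := fun t ht => (hC t ht).bdd
  have bW : ∀ t ∈ Set.Icc (0 : ℝ) 1, ∀ x, ‖conv3 (U t) x‖ ≤ D := fun t ht => (hD t ht).bdd
  let W : ℝ → ℝ → ℂ := fun t => conv3 (U t)
  refine ⟨key U U U U C C C C mU mU mU mU bU bU bU bU, ?_⟩
  have k1 := key W U U U D C C C mW mU mU mU bW bU bU bU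
  have k2 := key U W U U C D C C mU mW mU mU bU bW bU bU
  have k3 := key U U W U C C D C mU mU mW mU bU bU bW bU
  have k4 := key U U U W C C C D mU mU mU mW bU bU bU bW
  exact (((k1.sub k2).add k3).sub k4).const_mul Complex.I

lemma FreqSol.quadInt_le (h : FreqSol U) (hδ0 : 0 ≤ δ) (hδ1 : δ ≤ 1) (q : (ℝ × ℝ) × ℝ) :
    ENNReal.ofReal (8 * π ^ 2 * |q.1.1| * |q.1.2|) * ‖quadInt U δ q‖ₑ
      ≤ ‖quad (U δ) (U δ) (U δ) (U δ) q‖ₑ + ‖quad (U 0) (U 0) (U 0) (U 0) q‖ₑ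
        + ∫⁻ t in Set.Ioc 0 δ, quadSum (U t) (conv3 (U t)) q := by
  obtain ⟨i1, i2⟩ := h.integrableOn_quad_of hδ1 q
  have hsub : Set.uIcc 0 δ ⊆ Set.Icc 0 1 := by
    rw [Set.uIcc_of_le hδ0]; exact Set.Icc_subset_Icc le_rfl hδ1
  set c : ℂ := Complex.I * (8 * π ^ 2 * q.1.1 * q.1.2 : ℝ) with hc
  have hii : IntervalIntegrable (fun t => -c * quad (U t) (U t) (U t) (U t) q
      + quadForcing (U t) (conv3 (U t)) q) volume 0 δ := by
    rw [intervalIntegrable_iff, Set.uIoc_of_le hδ0]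
    exact (i1.const_mul (-c)).add i2
  have ftc := intervalIntegral.integral_eq_sub_of_hasDerivAt
    (fun t ht => h.hasDerivAt_quad (hsub ht) q) hii
  rw [intervalIntegral.integral_of_le hδ0, integral_add (i1.const_mul (-c)) i2,
    integral_const_mul] at ftc
  have e : c * quadInt U δ q = quad (U 0) (U 0) (U 0) (U 0) q - quad (U δ) (U δ) (U δ) (U δ) q
      + ∫ t in Set.Ioc 0 δ, quadForcing (U t) (conv3 (U t)) q := by
    unfold quadInt
    linear_combination (-1 : ℂ) * ftc
  have hcn : ‖c‖ₑ = ENNReal.ofReal (8 * π ^ 2 * |q.1.1| * |q.1.2|) := by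
    rw [← ofReal_norm, hc]
    congr 1
    rw [norm_mul, Complex.norm_I, one_mul, Complex.norm_real, Real.norm_eq_abs, abs_mul, abs_mul,
      abs_of_pos (by positivity)]
  rw [← hcn, ← enorm_mul, e]
  refine (enorm_add_le _ _).trans ?_
  gcongr
  · exact enorm_sub_le.trans_eq (add_comm _ _)
  · exact (enorm_integral_le_lintegral_enorm _).trans
      (lintegral_mono fun t => enorm_quadForcing_le _ _ q)

end

end

section

/-- The modulus of the multiplier applied to `G`, on the frequency side. -/
def thetaAbs (θ : ℝ → ℝ) (G : ℝ → ℂ) (ξ : ℝ) : ℝ≥0∞ :=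
  ENNReal.ofReal (θ (2 * π * ξ)) * ‖G ξ‖ₑ

/-- The combined weight of the four slots. -/
def slotWeight (θ : ℝ → ℝ) (N : ℝ) (q : (ℝ × ℝ) × ℝ) : ℝ≥0∞ :=
  (ENNReal.ofReal (kern N q.1.1) + ENNReal.ofReal (kern N q.1.2))
    * (ENNReal.ofReal (θ (2 * π * q.2)) * ENNReal.ofReal (θ (2 * π * (q.2 + q.1.1)))
      * ENNReal.ofReal (θ (2 * π * (q.2 + q.1.1 + q.1.2)))
      * ENNReal.ofReal (θ (2 * π * (q.2 + q.1.2))))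

lemma measurable_slotWeight {θ : ℝ → ℝ} (hθ : Measurable θ) (N : ℝ) :
    Measurable (slotWeight θ N) := by
  have := measurable_kern N
  unfold slotWeight
  fun_prop

lemma measurable_thetaAbs {θ : ℝ → ℝ} (hθ : Measurable θ) {G : ℝ → ℂ} (hG : Measurable G) :
    Measurable (thetaAbs θ G) := by
  unfold thetaAbs
  fun_prop

lemma lintegral_slotWeight_quad_le {θ : ℝ → ℝ} (hθ : Measurable θ) {N : ℝ} (hN : 0 < N)
    {G₁ G₂ G₃ G₄ : ℝ → ℂ} (h₁ : Measurable G₁) (h₂ : Measurable G₂) (h₃ : Measurable G₃)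
    (h₄ : Measurable G₄) :
    ∫⁻ q, slotWeight θ N q * ‖quad G₁ G₂ G₃ G₄ q‖ₑ ≤ ENNReal.ofReal (1 / N)
      * ((thetaMass θ G₁ + thetaMass θ G₂) * (thetaMass θ G₃ + thetaMass θ G₄)
        + (thetaMass θ G₁ + thetaMass θ G₄) * (thetaMass θ G₃ + thetaMass θ G₂)) := by
  have m₁ := measurable_thetaAbs hθ h₁
  have m₂ := measurable_thetaAbs hθ h₂
  have m₃ := measurable_thetaAbs hθ h₃
  have m₄ := measurable_thetaAbs hθ h₄
  have mk := measurable_kern N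
  have hk : Measurable fun ξ => ENNReal.ofReal (kern N ξ) := (measurable_kern N).ennreal_ofReal
  have e : ∀ q : (ℝ × ℝ) × ℝ, slotWeight θ N q * ‖quad G₁ G₂ G₃ G₄ q‖ₑ
      = ENNReal.ofReal (kern N q.1.1) * (thetaAbs θ G₁ q.2 * thetaAbs θ G₂ (q.2 + q.1.1)
          * thetaAbs θ G₃ (q.2 + q.1.1 + q.1.2) * thetaAbs θ G₄ (q.2 + q.1.2))
        + ENNReal.ofReal (kern N q.1.2) * (thetaAbs θ G₁ q.2 * thetaAbs θ G₂ (q.2 + q.1.1)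
          * thetaAbs θ G₃ (q.2 + q.1.1 + q.1.2) * thetaAbs θ G₄ (q.2 + q.1.2)) := by
    intro q
    rw [enorm_quad]
    unfold slotWeight thetaAbs
    ring
  simp_rw [e]
  rw [lintegral_add_left (by fun_prop)]
  have l1 := lintegral_quad_fst_le hk m₁ m₂ m₃ m₄
  have l2 := lintegral_quad_snd_le hk m₁ m₂ m₃ m₄
  have hl := lintegral_kern_le hN
  refine (add_le_add l1 l2).trans ?_
  rw [mul_assoc, mul_assoc, ← mul_add]
  unfold thetaMass
  unfold thetaAbs
  gcongr

lemma lintegral_slotWeight_quad_le_of_le {θ : ℝ → ℝ} (hθ : Measurable θ) {N : ℝ} (hN : 0 < N)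
    {G : ℝ → ℂ} (hG : Measurable G) {A : ℝ≥0∞} (hA : thetaMass θ G ≤ A) :
    ∫⁻ q, slotWeight θ N q * ‖quad G G G G q‖ₑ ≤ ENNReal.ofReal (1 / N) * (8 * A ^ 2) := by
  refine (lintegral_slotWeight_quad_le hθ hN hG hG hG hG).trans ?_
  gcongr
  calc _ ≤ (A + A) * (A + A) + (A + A) * (A + A) := by gcongr
    _ = 8 * A ^ 2 := by ring

lemma measurable_of_uncurry_right {α : Type*} [MeasurableSpace α] {f : α → ℝ → ℂ}
    (hf : Measurable (fun q : α × ℝ => f q.1 q.2)) (a : α) : Measurable (f a) :=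
  hf.comp (by fun_prop : Measurable fun x : ℝ => (a, x))

lemma lintegral_slotWeight_quadSum_le {θ : ℝ → ℝ} (hθ : Measurable θ) {N : ℝ} (hN : 0 < N)
    {G W : ℝ → ℂ} (hG : Measurable G) (hW : Measurable W) {A : ℝ≥0∞} (hA : thetaMass θ G ≤ A) :
    ∫⁻ q, slotWeight θ N q * quadSum G W q
      ≤ ENNReal.ofReal (1 / N) * (16 * A * (A + thetaMass θ W)) := by
  have hm := measurable_slotWeight hθ N
  have mq : ∀ {G₁ G₂ G₃ G₄ : ℝ → ℂ}, Measurable G₁ → Measurable G₂ → Measurable G₃ →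
      Measurable G₄ → Measurable fun q => slotWeight θ N q * ‖quad G₁ G₂ G₃ G₄ q‖ₑ := by
    intro G₁ G₂ G₃ G₄ h₁ h₂ h₃ h₄
    have hc := Complex.continuous_conj.measurable
    simp_rw [enorm_quad]
    fun_prop
  unfold quadSum
  simp_rw [mul_add]
  rw [lintegral_add_right _ (mq hG hG hG hW), lintegral_add_right _ (mq hG hG hW hG),
    lintegral_add_right _ (mq hG hW hG hG)]
  set B := thetaMass θ W
  have b : ∀ x, x ≤ (A + B) * (A + A) + (A + A) * (A + B) →
      ENNReal.ofReal (1 / N) * x ≤ ENNReal.ofReal (1 / N) * (4 * A * (A + B)) := by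
    intro x hx
    gcongr
    exact hx.trans_eq (by ring)
  calc _ ≤ ENNReal.ofReal (1 / N) * (4 * A * (A + B)) + ENNReal.ofReal (1 / N) * (4 * A * (A + B))
        + ENNReal.ofReal (1 / N) * (4 * A * (A + B))
        + ENNReal.ofReal (1 / N) * (4 * A * (A + B)) := by
        gcongr
        · refine (lintegral_slotWeight_quad_le hθ hN hW hG hG hG).trans (b _ ?_)
          calc _ ≤ (B + A) * (A + A) + (B + A) * (A + A) := by gcongr
            _ = _ := by ring
        · refine (lintegral_slotWeight_quad_le hθ hN hG hW hG hG).trans (b _ ?_)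
          calc _ ≤ (A + B) * (A + A) + (A + A) * (A + B) := by gcongr
            _ = _ := by ring
        · refine (lintegral_slotWeight_quad_le hθ hN hG hG hW hG).trans (b _ ?_)
          calc _ ≤ (A + A) * (B + A) + (A + A) * (B + A) := by gcongr
            _ = _ := by ring
        · refine (lintegral_slotWeight_quad_le hθ hN hG hG hG hW).trans (b _ ?_)
          calc _ ≤ (A + A) * (A + B) + (A + B) * (A + A) := by gcongr
            _ = _ := by ring
    _ = _ := by ring

section
variable {U : ℝ → ℝ → ℂ} {δ N s : ℝ} {θ : ℝ → ℝ}

lemma AdmissibleHigh.slot_bound (h : AdmissibleHigh N s θ) (hs1 : s < 1) (hN : 2 ≤ N)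
    (q : (ℝ × ℝ) × ℝ) :
    ‖θ (2 * π * q.2) ^ 2 - θ (2 * π * (q.2 + q.1.1)) ^ 2
        + θ (2 * π * (q.2 + q.1.1 + q.1.2)) ^ 2 - θ (2 * π * (q.2 + q.1.2)) ^ 2‖ₑ
      ≤ 120 * slotWeight θ N q * ENNReal.ofReal (8 * π ^ 2 * |q.1.1| * |q.1.2|) := by
  obtain ⟨⟨ξ, η⟩, p⟩ := q
  dsimp only
  have t : ∀ x, 0 ≤ θ x := fun x => zero_le_one.trans (h.one_le hN x)
  have k : ∀ x, 0 ≤ kern N x := fun x => by unfold kern; positivity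
  have hb := h.symbol_bound hs1 hN (2 * π * p) (2 * π * ξ) (2 * π * η)
  rw [← ofReal_norm, Real.norm_eq_abs]
  unfold slotWeight
  dsimp only
  rw [← ENNReal.ofReal_add (k _) (k _), ← ENNReal.ofReal_mul (t _),
    ← ENNReal.ofReal_mul (mul_nonneg (t _) (t _)),
    ← ENNReal.ofReal_mul (mul_nonneg (mul_nonneg (t _) (t _)) (t _)),
    ← ENNReal.ofReal_mul (add_nonneg (k _) (k _)),
    show (120 : ℝ≥0∞) = ENNReal.ofReal 120 by simp, ← ENNReal.ofReal_mul (by norm_num),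
    ← ENNReal.ofReal_mul (mul_nonneg (by norm_num) (mul_nonneg (add_nonneg (k _) (k _))
      (mul_nonneg (mul_nonneg (mul_nonneg (t _) (t _)) (t _)) (t _))))]
  apply ENNReal.ofReal_le_ofReal
  rw [abs_mul (2 * π) ξ, abs_mul (2 * π) η, abs_of_pos (by positivity : 0 < 2 * π)] at hb
  simp only [mul_add]
  refine hb.trans (le_of_eq ?_)
  unfold kern
  ring

lemma lintegral_mul_lintegral_le {X : Type*} [MeasurableSpace X] {μ : Measure X} [SFinite μ]
    {w : X → ℝ≥0∞} {S : ℝ → X → ℝ≥0∞} {b : ℝ → ℝ≥0∞} {δ : ℝ} (hw : Measurable w)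
    (hS : Measurable fun z : ℝ × X => S z.1 z.2)
    (hb : ∀ t ∈ Set.Ioc 0 δ, ∫⁻ q, w q * S t q ∂μ ≤ b t) :
    ∫⁻ q, w q * (∫⁻ t in Set.Ioc 0 δ, S t q) ∂μ ≤ ∫⁻ t in Set.Ioc 0 δ, b t := by
  have mt : ∀ q, Measurable fun t => S t q := fun q =>
    hS.comp (by fun_prop : Measurable fun t : ℝ => (t, q))
  calc ∫⁻ q, w q * (∫⁻ t in Set.Ioc 0 δ, S t q) ∂μ
      = ∫⁻ q, (∫⁻ t in Set.Ioc 0 δ, w q * S t q) ∂μ :=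
        lintegral_congr fun q => (lintegral_const_mul _ (mt q)).symm
    _ = ∫⁻ t in Set.Ioc 0 δ, ∫⁻ q, w q * S t q ∂μ := by
        refine lintegral_lintegral_swap (Measurable.aemeasurable ?_)
        exact (hw.comp measurable_fst).mul (hS.comp measurable_swap)
    _ ≤ _ := lintegral_mono_ae ((ae_restrict_mem measurableSet_Ioc).mono hb)

lemma FreqSol.lintegral_slotWeight_le (h : FreqSol U) (mθ : Measurable θ) (hN0 : 0 < N)
    (hδ0 : 0 ≤ δ) (hδ1 : δ ≤ 1) {A : ℝ≥0∞} (hAt : A ≠ ⊤)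
    (hU : ∀ t ∈ Set.Icc 0 δ, thetaMass θ (U t) ≤ A)
    (hW : ∫⁻ t in Set.Ioc 0 δ, thetaMass θ (conv3 (U t)) ≤ A) :
    ∫⁻ q : (ℝ × ℝ) × ℝ, slotWeight θ N q
      * (‖quad (U δ) (U δ) (U δ) (U δ) q‖ₑ + ‖quad (U 0) (U 0) (U 0) (U 0) q‖ₑ
        + ∫⁻ t in Set.Ioc 0 δ, quadSum (U t) (conv3 (U t)) q)
      ≤ ENNReal.ofReal (1 / N) * (48 * A ^ 2) := by
  have mU := h.meas
  have mW : Measurable (fun q : ℝ × ℝ => conv3 (U q.1) q.2) := measurable_conv3_param h.meas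
  have mw := measurable_slotWeight mθ N
  have msum : Measurable (fun z : ℝ × ((ℝ × ℝ) × ℝ) => quadSum (U z.1) (conv3 (U z.1)) z.2) := by
    let W : ℝ → ℝ → ℂ := fun t => conv3 (U t)
    have mW' : Measurable (fun q : ℝ × ℝ => W q.1 q.2) := mW
    exact (((measurable_quad_param mW' mU mU mU).enorm.add
      (measurable_quad_param mU mW' mU mU).enorm).add
      (measurable_quad_param mU mU mW' mU).enorm).add (measurable_quad_param mU mU mU mW').enorm
  have mUt : ∀ t, Measurable (U t) := measurable_of_uncurry_right mU
  have mWt : ∀ t, Measurable (conv3 (U t)) := measurable_of_uncurry_right mW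
  have m0 : ∀ t, Measurable fun q => slotWeight θ N q * ‖quad (U t) (U t) (U t) (U t) q‖ₑ :=
    fun t => mw.mul (_root_.measurable_quad (mUt t)).enorm
  have hswap : ∫⁻ q : (ℝ × ℝ) × ℝ, slotWeight θ N q
      * ∫⁻ t in Set.Ioc 0 δ, quadSum (U t) (conv3 (U t)) q
      ≤ ENNReal.ofReal (1 / N) * (32 * A ^ 2) := by
    refine (lintegral_mul_lintegral_le (S := fun t q => quadSum (U t) (conv3 (U t)) q) mw msum
      (b := fun t => ENNReal.ofReal (1 / N) * (16 * A * (A + thetaMass θ (conv3 (U t)))))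
      fun t ht => lintegral_slotWeight_quadSum_le mθ hN0 (mUt t) (mWt t)
        (hU t ⟨ht.1.le, ht.2⟩)).trans ?_
    calc _ = ENNReal.ofReal (1 / N) * (16 * A
            * (A * volume (Set.Ioc 0 δ) + ∫⁻ t in Set.Ioc 0 δ, thetaMass θ (conv3 (U t)))) := by
            rw [lintegral_const_mul' _ _ ENNReal.ofReal_ne_top,
              lintegral_const_mul' _ _ (ENNReal.mul_ne_top (by norm_num) hAt),
              lintegral_add_left measurable_const, setLIntegral_const]
      _ ≤ ENNReal.ofReal (1 / N) * (16 * A * (A * 1 + A)) := by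
            gcongr
            rw [Real.volume_Ioc, sub_zero]
            exact ENNReal.ofReal_le_one.2 hδ1
      _ = _ := by ring
  have e1 := lintegral_slotWeight_quad_le_of_le mθ hN0 (mUt δ) (hU δ ⟨hδ0, le_rfl⟩)
  have e0 := lintegral_slotWeight_quad_le_of_le mθ hN0 (mUt 0) (hU 0 ⟨le_rfl, hδ0⟩)
  have m00 : Measurable fun q => slotWeight θ N q * ‖quad (U δ) (U δ) (U δ) (U δ) q‖ₑ
      + slotWeight θ N q * ‖quad (U 0) (U 0) (U 0) (U 0) q‖ₑ := (m0 δ).add (m0 0)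
  simp_rw [mul_add]
  rw [lintegral_add_left m00, lintegral_add_left (m0 δ)]
  refine (add_le_add (add_le_add e1 e0) hswap).trans (le_of_eq ?_)
  ring

lemma FreqSol.weighted_sub_le (h : FreqSol U) (hθ : AdmissibleHigh N s θ) (hs1 : s < 1)
    (hN : 2 ≤ N) (hδ0 : 0 ≤ δ) (hδ1 : δ ≤ 1) {C : ℝ} (hC : 0 ≤ C)
    (hU : ∀ t ∈ Set.Icc 0 δ, thetaMass θ (U t) ≤ ENNReal.ofReal C)
    (hW : ∫⁻ t in Set.Ioc 0 δ, thetaMass θ (conv3 (U t)) ≤ ENNReal.ofReal C) :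
    |(∫ p, θ (2 * π * p) ^ 2 * ‖U δ p‖ ^ 2) - ∫ p, θ (2 * π * p) ^ 2 * ‖U 0 p‖ ^ 2|
      ≤ 2880 * C ^ 2 * (1 / N) := by
  have hN0 : 0 < N := by linarith
  have mθ : Measurable θ := hθ.continuous.measurable
  set A := ENNReal.ofReal C with hA
  have hB : ∀ p, |θ (2 * π * p) ^ 2| ≤ (20 * π ^ 2) * (1 + p ^ 2) := by
    intro p
    rw [abs_of_nonneg (sq_nonneg _)]
    have := hθ.sq_le hs1 hN (2 * π * p)
    nlinarith [Real.pi_gt_three]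
  have hid := h.weighted_sub hδ0 hδ1 (a := fun p => θ (2 * π * p) ^ 2) (by fun_prop) hB
  have hmain := h.lintegral_slotWeight_le mθ hN0 hδ0 hδ1 ENNReal.ofReal_ne_top hU hW
  have hfin : ‖2 * ((∫ p, θ (2 * π * p) ^ 2 * ‖U δ p‖ ^ 2)
      - ∫ p, θ (2 * π * p) ^ 2 * ‖U 0 p‖ ^ 2)‖ₑ ≤ 120 * (ENNReal.ofReal (1 / N) * (48 * A ^ 2)) := by
    rw [hid]
    refine (enorm_integral_le_lintegral_enorm _).trans ?_
    refine le_trans (lintegral_mono fun q => ?_) (le_trans (le_of_eq (lintegral_const_mul' 120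
      (fun q => slotWeight θ N q
      * (‖quad (U δ) (U δ) (U δ) (U δ) q‖ₑ + ‖quad (U 0) (U 0) (U 0) (U 0) q‖ₑ
        + ∫⁻ t in Set.Ioc 0 δ, quadSum (U t) (conv3 (U t)) q)) (by norm_num))) (by gcongr))
    rw [enorm_mul]
    have i1 : ‖(quadInt U δ q).im‖ₑ ≤ ‖quadInt U δ q‖ₑ := by
      rw [← ofReal_norm, ← ofReal_norm]
      exact ENNReal.ofReal_le_ofReal (Complex.abs_im_le_norm _)
    calc _ ≤ (120 * slotWeight θ N q * ENNReal.ofReal (8 * π ^ 2 * |q.1.1| * |q.1.2|))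
          * ‖quadInt U δ q‖ₑ := by
          gcongr
          exact hθ.slot_bound hs1 hN q
      _ = 120 * (slotWeight θ N q * (ENNReal.ofReal (8 * π ^ 2 * |q.1.1| * |q.1.2|)
          * ‖quadInt U δ q‖ₑ)) := by ring
      _ ≤ _ := by
          gcongr
          exact h.quadInt_le hδ0 hδ1 q
  rw [hA, ← ENNReal.ofReal_pow hC, ← ofReal_norm, show (120 : ℝ≥0∞) = ENNReal.ofReal 120 by simp,
    show (48 : ℝ≥0∞) = ENNReal.ofReal 48 by simp, ← ENNReal.ofReal_mul (by norm_num),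
    ← ENNReal.ofReal_mul (by positivity), ← ENNReal.ofReal_mul (by norm_num),
    ENNReal.ofReal_le_ofReal_iff (by positivity), norm_mul, Real.norm_eq_abs, Real.norm_eq_abs,
    abs_two] at hfin
  linarith

end

end

section

/-- Smoothness together with uniform inverse-square decay of the first eight derivatives. -/
structure SmoothDec (C : ℝ) (f : ℝ → ℂ) : Prop where
  smooth : ContDiff ℝ (8 : ℕ) f
  bound : ∀ n ≤ 8, ∀ x, ‖iteratedDeriv n f x‖ ≤ C * dec 1 x

namespace SmoothDec
variable {C : ℝ} {f : ℝ → ℂ}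

lemma continuous_iteratedDeriv (h : SmoothDec C f) {n : ℕ} (hn : n ≤ 8) :
    Continuous (iteratedDeriv n f) :=
  h.smooth.continuous_iteratedDeriv n (by exact_mod_cast hn)

lemma integrable_iteratedDeriv (h : SmoothDec C f) {n : ℕ} (hn : n ≤ 8) :
    Integrable (iteratedDeriv n f) :=
  ((HasDec.mk (m := 1) (h.continuous_iteratedDeriv hn).measurable (h.bound n hn))).integrable le_rfl

lemma hasDec (h : SmoothDec C f) : HasDec 1 C f :=
  ⟨h.smooth.continuous.measurable, fun x => by simpa using h.bound 0 (by norm_num) x⟩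

lemma integral_iteratedDeriv_le (h : SmoothDec C f) {n : ℕ} (hn : n ≤ 8) :
    ∫ x, ‖iteratedDeriv n f x‖ ≤ C * π := by
  calc ∫ x, ‖iteratedDeriv n f x‖ ≤ ∫ x, C * dec 1 x := by
        refine integral_mono (h.integrable_iteratedDeriv hn).norm ?_ (h.bound n hn)
        rw [dec_one_eq]; exact integrable_inv_one_add_sq.const_mul C
    _ = _ := by rw [integral_const_mul, dec_one_eq, integral_univ_inv_one_add_sq]

lemma fourier_iteratedDeriv (h : SmoothDec C f) {n : ℕ} (hn : n ≤ 8) (ξ : ℝ) :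
    𝓕 (iteratedDeriv n f) ξ = (2 * π * Complex.I * ξ) ^ n * 𝓕 f ξ := by
  have := Real.fourier_iteratedDeriv (N := (8 : ℕ)) (n := n) (f := f) h.smooth
    (fun k hk => h.integrable_iteratedDeriv (by exact_mod_cast hk)) (by exact_mod_cast hn)
  rw [this]; rfl

lemma fourier_bound (h : SmoothDec C f) {n : ℕ} (hn : n ≤ 8) (ξ : ℝ) :
    |2 * π * ξ| ^ n * ‖𝓕 f ξ‖ ≤ C * π := by
  have h1 : ‖𝓕 (iteratedDeriv n f) ξ‖ ≤ C * π :=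
    (VectorFourier.norm_fourierIntegral_le_integral_norm _ _ _ _ _).trans
      (h.integral_iteratedDeriv_le hn)
  rw [h.fourier_iteratedDeriv hn, norm_mul, norm_pow] at h1
  convert h1 using 3
  simp [abs_mul]

lemma continuous_fourier (h : SmoothDec C f) : Continuous (𝓕 f) :=
  VectorFourier.fourierIntegral_continuous Real.continuous_fourierChar
    (by exact continuous_inner) (h.hasDec.integrable le_rfl)

lemma hasDec_fourier (h : SmoothDec C f) : HasDec 4 (16 * (C * π)) (𝓕 f) := by
  refine ⟨h.continuous_fourier.measurable, fun ξ => ?_⟩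
  have h0 := h.fourier_bound (n := 0) (by norm_num) ξ
  have h8 := h.fourier_bound (n := 8) le_rfl ξ
  have hp : |ξ| ^ 8 ≤ |2 * π * ξ| ^ 8 := by
    refine pow_le_pow_left₀ (abs_nonneg _) ?_ 8
    rw [abs_mul, abs_of_pos Real.two_pi_pos]
    have := abs_nonneg ξ
    nlinarith [Real.pi_gt_three]
  have he : |ξ| ^ 8 = ξ ^ 8 := by rw [← abs_pow]; exact abs_of_nonneg (by positivity)
  rw [he] at hp
  rw [dec, ← div_eq_mul_inv, le_div_iff₀ (by positivity)]
  have hk : (1 + ξ ^ 2) ^ 4 ≤ 8 * (1 + ξ ^ 8) := by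
    have : (1 + ξ ^ 2) ^ 2 ≤ 2 * (1 + ξ ^ 4) := by nlinarith [sq_nonneg (ξ ^ 2 - 1)]
    calc (1 + ξ ^ 2) ^ 4 = ((1 + ξ ^ 2) ^ 2) ^ 2 := by ring
      _ ≤ (2 * (1 + ξ ^ 4)) ^ 2 := pow_le_pow_left₀ (by positivity) this 2
      _ ≤ _ := by nlinarith [sq_nonneg (ξ ^ 4 - 1)]
  have hn := norm_nonneg (𝓕 f ξ)
  calc ‖𝓕 f ξ‖ * (1 + ξ ^ 2) ^ 4 ≤ ‖𝓕 f ξ‖ * (8 * (1 + ξ ^ 8)) := by gcongr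
    _ = 8 * (‖𝓕 f ξ‖ + ξ ^ 8 * ‖𝓕 f ξ‖) := by ring
    _ ≤ 8 * (C * π + C * π) := by
        have : ξ ^ 8 * ‖𝓕 f ξ‖ ≤ |2 * π * ξ| ^ 8 * ‖𝓕 f ξ‖ := by gcongr
        simp only [pow_zero, one_mul] at h0
        linarith
    _ = _ := by ring

end SmoothDec

lemma HasDec.continuous_conv {m : ℕ} {C D : ℝ} {F G : ℝ → ℂ} (hF : HasDec m C F)
    (hG : HasDec m D G) (hm : 1 ≤ m) (hc : Continuous G) :
    Continuous (F ⋆[ContinuousLinearMap.mul ℂ ℂ, volume] G) := by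
  refine BddAbove.continuous_convolution_right_of_integrable _ ⟨D, ?_⟩ (hF.integrable hm) hc
  rintro _ ⟨x, rfl⟩
  exact hG.bdd x

lemma HasDec.continuous_conv3 {m : ℕ} {C : ℝ} {G : ℝ → ℂ} (h : HasDec (m + 2) C G)
    (hc : Continuous G) : Continuous (_root_.conv3 G) := by
  have hr := h.reflConj
  have h2 : HasDec (m + 1) _ _ := HasDec.convolution (m := m + 1) hr h
  exact HasDec.continuous_conv (m := m + 1) (h.mono_m (by omega)) h2 (by omega)
    (hr.continuous_conv h (by omega) hc)

lemma SmoothDec.fourier_cubic {C : ℝ} {f : ℝ → ℂ} (h : SmoothDec C f) :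
    𝓕 (fun x => ((‖f x‖ : ℂ) ^ 2 * f x)) = conv3 (𝓕 f) := by
  have hd := h.hasDec_fourier
  have hi : Integrable (𝓕 f) := hd.integrable (by norm_num)
  have hf : 𝓕⁻ (𝓕 f) = f := Continuous.fourierInv_fourier_eq h.smooth.continuous
    (h.hasDec.integrable le_rfl) hi
  have hcu : 𝓕⁻ (conv3 (𝓕 f)) = fun x => ((‖f x‖ : ℂ) ^ 2 * f x) := by
    funext x
    rw [fourierInv_conv3 hi x, hf, ← mul_assoc, Complex.mul_conj']
  have hcd : HasDec 2 _ (conv3 (𝓕 f)) := HasDec.conv3 (m := 2) hd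
  rw [← hcu]
  refine Continuous.fourier_fourierInv_eq (HasDec.continuous_conv3 (m := 2) hd h.continuous_fourier)
    (hcd.integrable (by norm_num)) ?_
  have h3 : 𝓕 (conv3 (𝓕 f)) = fun x => 𝓕⁻ (conv3 (𝓕 f)) (-x) := by
    funext x; rw [Real.fourierInv_eq_fourier_neg, neg_neg]
  rw [h3, hcu]
  refine Integrable.comp_neg (f := fun x => ((‖f x‖ : ℂ) ^ 2 * f x)) ?_
  refine (h.hasDec.integrable le_rfl).bdd_mul (c := C ^ 2) ?_ ?_
  · exact ((Complex.continuous_ofReal.comp h.smooth.continuous.norm).pow 2).aestronglyMeasurable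
  · refine Filter.Eventually.of_forall fun x => ?_
    rw [norm_pow, Complex.norm_real, norm_norm]
    exact pow_le_pow_left₀ (norm_nonneg _) (h.hasDec.bdd x) 2

end

lemma IsSchwartzSolution.translate {u : ℝ → ℝ → ℂ} (h : IsSchwartzSolution u) (t₀ : ℝ) :
    IsSchwartzSolution (fun x t => u x (t₀ + t)) where
  smooth := h.smooth.comp (contDiff_fst.prodMk (contDiff_const.add contDiff_snd))
  decay k n T hT := by
    obtain ⟨C, hC⟩ := h.decay k n (|t₀| + T) (by positivity)
    exact ⟨C, fun x t ht => hC x (t₀ + t) ((abs_add_le _ _).trans (by gcongr))⟩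
  eqn x t := by
    rw [deriv_comp_const_add (f := fun τ => u x τ)]
    exact h.eqn x (t₀ + t)

lemma IsSchwartzInX.exists_smoothDec {u : ℝ → ℝ → ℂ} (h : IsSchwartzInX u) {T : ℝ} (hT : 0 < T) :
    ∃ C, ∀ t, |t| ≤ T → SmoothDec C (fun x => u x t) := by
  choose A hA using fun n => h.decay 0 n T hT
  choose B hB using fun n => h.decay 2 n T hT
  have h0 : |(0 : ℝ)| ≤ T := by simpa using hT.le
  have hA0 : ∀ n, 0 ≤ A n := fun n => le_trans (by positivity) (hA n 0 0 h0)
  have hB0 : ∀ n, 0 ≤ B n := fun n => le_trans (by positivity) (hB n 0 0 h0)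
  refine ⟨∑ n ∈ Finset.range 9, (A n + B n), fun t ht => ⟨?_, fun n hn x => ?_⟩⟩
  · have : ContDiff ℝ (⊤ : ℕ∞) (fun x => u x t) :=
      h.smooth.comp (contDiff_id.prodMk contDiff_const)
    exact contDiff_infty.1 this 8
  · have h1 := hA n x t ht
    have h2 := hB n x t ht
    have h3 : A n + B n ≤ ∑ n ∈ Finset.range 9, (A n + B n) :=
      Finset.single_le_sum (f := fun n => A n + B n) (fun i _ => add_nonneg (hA0 i) (hB0 i))
        (Finset.mem_range.2 (by omega))
    rw [dec, ← div_eq_mul_inv, le_div_iff₀ (by positivity)]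
    rw [sq_abs] at h2
    linarith

lemma IsSchwartzSolution.hasDerivAt {u : ℝ → ℝ → ℂ} (h : IsSchwartzSolution u) (x t : ℝ) :
    HasDerivAt (fun τ => u x τ)
      (Complex.I * (iteratedDeriv 2 (fun y => u y t) x + (‖u x t‖ : ℂ) ^ 2 * u x t)) t := by
  have hd : DifferentiableAt ℝ (fun τ => u x τ) t := by
    have : ContDiff ℝ (⊤ : ℕ∞) (fun τ => u x τ) :=
      h.smooth.comp (contDiff_const.prodMk contDiff_id)
    exact this.differentiable (by simp) t
  refine hd.hasDerivAt.congr_deriv ?_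
  linear_combination (-Complex.I) * h.eqn x t + deriv (fun τ => u x τ) t * Complex.I_sq

lemma IsSchwartzSolution.freqSol_deriv {u : ℝ → ℝ → ℂ} (h : IsSchwartzSolution u) {t : ℝ}
    (ht : t ∈ Set.Icc (0 : ℝ) 1) (ξ : ℝ) :
    HasDerivAt (fun τ => 𝓕 (fun x => u x τ) ξ)
      (Complex.I * (conv3 (𝓕 (fun x => u x t)) ξ
        - (4 * π ^ 2 * ξ ^ 2 : ℝ) * 𝓕 (fun x => u x t) ξ)) t := by
  obtain ⟨C, hC⟩ := h.toIsSchwartzInX.exists_smoothDec (T := 2) (by norm_num)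
  have htT : |t| ≤ 2 := by rw [abs_le]; exact ⟨by linarith [ht.1], by linarith [ht.2]⟩
  have hs : Set.Ioo (-2 : ℝ) 2 ∈ nhds t := Ioo_mem_nhds (by linarith [ht.1]) (by linarith [ht.2])
  have hsT : ∀ τ ∈ Set.Ioo (-2 : ℝ) 2, |τ| ≤ 2 := fun τ hτ => abs_le.2 ⟨hτ.1.le, hτ.2.le⟩
  set e : ℝ → ℂ := fun x => Complex.exp (((-2 * π * (x * ξ) : ℝ) : ℂ) * Complex.I) with he
  have hce : Continuous e := by rw [he]; fun_prop
  have hne : ∀ x, ‖e x‖ = 1 := fun x => Complex.norm_exp_ofReal_mul_I _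
  have hF : ∀ f : ℝ → ℂ, 𝓕 f ξ = ∫ x, e x * f x := by
    intro f
    rw [Real.fourier_eq']
    refine integral_congr_ae (Filter.Eventually.of_forall fun x => ?_)
    simp [he, mul_comm]
  set g : ℝ → ℝ → ℂ := fun τ x =>
    Complex.I * (iteratedDeriv 2 (fun y => u y τ) x + (‖u x τ‖ : ℂ) ^ 2 * u x τ) with hg
  have hcub : Integrable (fun x => (‖u x t‖ : ℂ) ^ 2 * u x t) := by
    have hd := (hC t htT)
    refine (hd.hasDec.integrable le_rfl).bdd_mul (c := C ^ 2) ?_ ?_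
    · exact ((Complex.continuous_ofReal.comp hd.smooth.continuous.norm).pow 2).aestronglyMeasurable
    · refine Filter.Eventually.of_forall fun x => ?_
      rw [norm_pow, Complex.norm_real, norm_norm]
      exact pow_le_pow_left₀ (norm_nonneg _) (hd.hasDec.bdd x) 2
  have hmul : ∀ {f : ℝ → ℂ}, Integrable f → Integrable (fun x => e x * f x) := fun hf =>
    hf.bdd_mul hce.aestronglyMeasurable (Filter.Eventually.of_forall fun x => (hne x).le)
  have huxx := (hC t htT).integrable_iteratedDeriv (n := 2) (by norm_num)
  have hkey := hasDerivAt_integral_of_dominated_loc_of_deriv_le (μ := volume) (𝕜 := ℝ)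
    (F := fun τ x => e x * u x τ) (F' := fun τ x => e x * g τ x) (x₀ := t)
    (bound := fun x => (C + C ^ 2 * C) * dec 1 x) hs ?_ ?_ ?_ ?_ ?_ ?_
  · have h2 := hkey.2
    simp_rw [hF]
    refine h2.congr_deriv ?_
    have h3 : ∫ x, e x * g t x
        = Complex.I * (𝓕 (iteratedDeriv 2 (fun y => u y t)) ξ
          + 𝓕 (fun x => (‖u x t‖ : ℂ) ^ 2 * u x t) ξ) := by
      rw [hF, hF, ← integral_add (hmul huxx) (hmul hcub), ← integral_const_mul]
      refine integral_congr_ae (Filter.Eventually.of_forall fun x => ?_)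
      simp only [hg]; ring
    rw [h3, (hC t htT).fourier_cubic, (hC t htT).fourier_iteratedDeriv (by norm_num), ← hF]
    push_cast
    linear_combination (4 * π ^ 2 * ξ ^ 2 * 𝓕 (fun x => u x t) ξ * Complex.I) * Complex.I_sq
  · filter_upwards [hs] with τ hτ
    exact (hce.mul (hC τ (hsT τ hτ)).smooth.continuous).aestronglyMeasurable
  · exact hmul ((hC t htT).hasDec.integrable le_rfl)
  · exact (hmul ((huxx.add hcub).const_mul Complex.I)).aestronglyMeasurable
  · refine Filter.Eventually.of_forall fun x τ hτ => ?_
    have hd := hC τ (hsT τ hτ)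
    have h1 := hd.bound 2 (by norm_num) x
    have h2 := hd.hasDec.bound x
    have h3 := hd.hasDec.bdd x
    rw [norm_mul, hne, one_mul, hg]
    simp only [norm_mul, Complex.norm_I, one_mul]
    refine (norm_add_le _ _).trans ?_
    rw [add_mul, norm_mul, norm_pow, Complex.norm_real, norm_norm, mul_assoc]
    gcongr
  · rw [dec_one_eq]; exact integrable_inv_one_add_sq.const_mul _
  · exact Filter.Eventually.of_forall fun x τ _ => (h.hasDerivAt x τ).const_mul (e x)

lemma IsSchwartzSolution.freqSol {u : ℝ → ℝ → ℂ} (h : IsSchwartzSolution u) :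
    FreqSol (fun t => 𝓕 (fun x => u x t)) where
  meas := by
    have hu : Measurable (fun q : ℝ × ℝ => u q.2 q.1) :=
      (h.smooth.continuous.comp continuous_swap).measurable
    have h1 := measurable_fourierInv_param (U := fun (t : ℝ) (x : ℝ) => u x t) hu
    have h2 := h1.comp (measurable_fst.prodMk measurable_snd.neg)
    convert h2 using 1
    funext q
    simp [Real.fourierInv_eq_fourier_neg]
  decay := by
    obtain ⟨C, hC⟩ := h.toIsSchwartzInX.exists_smoothDec (T := 1) one_pos
    exact ⟨_, fun t ht => (hC t (abs_le.2 ⟨by linarith [ht.1], ht.2⟩)).hasDec_fourier⟩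
  deriv t ht ξ := h.freqSol_deriv ht ξ

lemma ft_eq_fourier (f : ℝ → ℂ) (ξ : ℝ) : ft f ξ = 𝓕 f ((2 * π)⁻¹ * ξ) := by
  rw [Real.fourier_eq', ft]
  refine integral_congr_ae (Filter.Eventually.of_forall fun x => ?_)
  have hp := Real.pi_ne_zero
  simp only [RCLike.inner_apply, conj_trivial, smul_eq_mul]
  congr 2
  have : -2 * π * ((2 * π)⁻¹ * ξ * x) = -(x * ξ) := by field_simp
  rw [this]
  push_cast; ring

lemma mult_eq_fourierInv (θ : ℝ → ℝ) (f : ℝ → ℂ) (x : ℝ) :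
    mult θ f x = 𝓕⁻ (fun p => (θ (2 * π * p) : ℂ) * 𝓕 f p) x := by
  have hp := Real.two_pi_pos
  have h := Measure.integral_comp_mul_left (fun p : ℝ =>
    Complex.exp (((2 * π * (p * x) : ℝ) : ℂ) * Complex.I) * ((θ (2 * π * p) : ℂ) * 𝓕 f p))
    (2 * π)⁻¹
  rw [inv_inv, abs_of_pos hp] at h
  rw [mult, Real.fourierInv_eq']
  have h1 : ∫ ξ : ℝ, Complex.exp (Complex.I * x * ξ) * (θ ξ : ℂ) * ft f ξ
      = (2 * π) • ∫ p : ℝ, Complex.exp (((2 * π * (p * x) : ℝ) : ℂ) * Complex.I)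
        * ((θ (2 * π * p) : ℂ) * 𝓕 f p) := by
    rw [← h]
    refine integral_congr_ae (Filter.Eventually.of_forall fun ξ => ?_)
    have e1 : 2 * π * ((2 * π)⁻¹ * ξ) = ξ := by field_simp
    have e2 : 2 * π * ((2 * π)⁻¹ * ξ * x) = x * ξ := by field_simp
    simp only [ft_eq_fourier, e1, e2]
    push_cast
    ring_nf
  rw [h1, smul_smul, inv_mul_cancel₀ hp.ne', one_smul]
  refine integral_congr_ae (Filter.Eventually.of_forall fun p => ?_)
  simp [mul_comm]

lemma AdmissibleHigh.sq_scaled_le {N s : ℝ} {θ : ℝ → ℝ} (hθ : AdmissibleHigh N s θ) (hs1 : s < 1)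
    (hN : 2 ≤ N) (p : ℝ) : θ (2 * π * p) ^ 2 ≤ 20 * π ^ 2 * (1 + p ^ 2) := by
  have := hθ.sq_le hs1 hN (2 * π * p)
  nlinarith [Real.pi_gt_three]

lemma integral_norm_sq_eq_toReal {g : ℝ → ℂ} (hg : Measurable g) :
    ∫ x, ‖g x‖ ^ 2 = (∫⁻ x, ‖g x‖ₑ ^ (2 : ℕ)).toReal := by
  rw [integral_eq_lintegral_of_nonneg_ae (Filter.Eventually.of_forall fun x => by positivity)
    (hg.norm.pow_const 2).aestronglyMeasurable]
  simp_rw [ENNReal.ofReal_pow (norm_nonneg _), ofReal_norm]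

lemma HasDec.integral_fourierInv_sq {m : ℕ} {C : ℝ} {H : ℝ → ℂ} (h : HasDec m C H) (hm : 1 ≤ m) :
    ∫ x, ‖𝓕⁻ H x‖ ^ 2 = ∫ p, ‖H p‖ ^ 2 := by
  have hmeas : Measurable (𝓕⁻ H) := by
    have h0 : Measurable (fun q : ℝ × ℝ => 𝓕⁻ H q.2) :=
      measurable_fourierInv_param (U := fun _ : ℝ => H) (h.meas.comp measurable_snd)
    have h1 : Measurable fun x : ℝ => ((0 : ℝ), x) := measurable_const.prodMk measurable_id
    have h2 := h0.comp h1
    simpa only [Function.comp_def] using h2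
  rw [integral_norm_sq_eq_toReal hmeas, integral_norm_sq_eq_toReal h.meas,
    lintegral_fourierInv_sq (h.integrable hm) (h.memLp hm)]

lemma AdmissibleHigh.measurable_scaled {N s : ℝ} {θ : ℝ → ℝ} (hθ : AdmissibleHigh N s θ) :
    Measurable fun p => θ (2 * π * p) :=
  (hθ.continuous.comp (continuous_const.mul continuous_id)).measurable

lemma AdmissibleHigh.hasDec_mul {N s : ℝ} {θ : ℝ → ℝ} (hθ : AdmissibleHigh N s θ) (hs1 : s < 1)
    (hN : 2 ≤ N) {C : ℝ} {G : ℝ → ℂ} (h : HasDec 4 C G) :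
    HasDec 3 (20 * π ^ 2 * C) (fun p => (θ (2 * π * p) : ℂ) * G p) := by
  refine ⟨(Complex.measurable_ofReal.comp hθ.measurable_scaled).mul h.meas, fun p => ?_⟩
  have h1 := hθ.one_le hN (2 * π * p)
  have h2 := hθ.sq_scaled_le hs1 hN p
  have h3 : θ (2 * π * p) ≤ 20 * π ^ 2 * (1 + p ^ 2) := by nlinarith
  have h4 := h.bound p
  have h5 : dec 4 p * (1 + p ^ 2) = dec 3 p := by
    have : (1 + p ^ 2) ≠ 0 := by positivity
    unfold dec; field_simp
  rw [norm_mul, Complex.norm_real, Real.norm_of_nonneg (by linarith)]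
  calc θ (2 * π * p) * ‖G p‖ ≤ (20 * π ^ 2 * (1 + p ^ 2)) * (C * dec 4 p) := by gcongr
    _ = 20 * π ^ 2 * C * (dec 4 p * (1 + p ^ 2)) := by ring
    _ = _ := by rw [h5]

lemma L2sq_mult {N s : ℝ} {θ : ℝ → ℝ} (hθ : AdmissibleHigh N s θ) (hs1 : s < 1) (hN : 2 ≤ N)
    {C : ℝ} {f : ℝ → ℂ} (h : HasDec 4 C (𝓕 f)) :
    L2sq (mult θ f) = ∫ p, θ (2 * π * p) ^ 2 * ‖𝓕 f p‖ ^ 2 := by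
  have hH := (hθ.hasDec_mul hs1 hN h).integral_fourierInv_sq (by norm_num)
  simp_rw [L2sq, mult_eq_fourierInv]
  rw [hH]
  refine integral_congr_ae (Filter.Eventually.of_forall fun p => ?_)
  dsimp only
  rw [norm_mul, Complex.norm_real, mul_pow, Real.norm_eq_abs, sq_abs]

lemma thetaMass_eq_ofReal {N s : ℝ} {θ : ℝ → ℝ} (hθ : AdmissibleHigh N s θ) (hs1 : s < 1)
    (hN : 2 ≤ N) {C : ℝ} {G : ℝ → ℂ} (h : HasDec 4 C G) :
    thetaMass θ G = ENNReal.ofReal (∫ p, θ (2 * π * p) ^ 2 * ‖G p‖ ^ 2) := by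
  rw [ofReal_integral_eq_lintegral_ofReal]
  · refine lintegral_congr fun p => ?_
    have := hθ.one_le hN (2 * π * p)
    rw [← ofReal_norm, ← ENNReal.ofReal_mul (by linarith), ← ENNReal.ofReal_pow (by positivity),
      mul_pow]
  · exact h.integrable_weighted_sq (a := fun p => θ (2 * π * p) ^ 2) (hθ.measurable_scaled.pow_const 2) fun p => by
      rw [abs_of_nonneg (sq_nonneg _)]; exact hθ.sq_scaled_le hs1 hN p
  · exact Filter.Eventually.of_forall fun p => by positivity

/-- almost conservation of `‖D u(t)‖_{L²}²` (upside-down I-method). -/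
theorem almost_conservation_upside_down_I (s ε C₀ : ℝ)
    (hs0 : 0 < s) (hs1 : s < 1) (hε : 0 < ε) (hC₀ : 0 < C₀) :
    ∃ δ C : ℝ, 0 < δ ∧ 0 < C ∧
      ∀ N : ℝ, 2 ≤ N → ∀ θ : ℝ → ℝ, AdmissibleHigh N s θ →
        ∀ u : ℝ → ℝ → ℂ, IsSchwartzSolution u → ∀ t₀ : ℝ,
          L2sq (fun x => multX θ u x t₀) ≤ C₀ →
          |L2sq (fun x => multX θ u x (t₀ + δ)) - L2sq (fun x => multX θ u x t₀)|
            ≤ C * N ^ (-(1 / 2) + ε) := by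
  obtain ⟨δ, C₁, hδ, hδ1, hC₁, H⟩ := exists_apriori hs0 hs1 hC₀
  refine ⟨δ, 2880 * C₁ ^ 2, hδ, by positivity, fun N hN θ hθ u hu t₀ h0 => ?_⟩
  have hU := (hu.translate t₀).freqSol
  obtain ⟨A, hA⟩ := hU.decay
  have hL : ∀ t ∈ Set.Icc (0 : ℝ) 1, L2sq (fun x => multX θ u x (t₀ + t))
      = ∫ p, θ (2 * π * p) ^ 2 * ‖𝓕 (fun x => u x (t₀ + t)) p‖ ^ 2 :=
    fun t ht => L2sq_mult hθ hs1 hN (hA t ht)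
  have m0 : (0 : ℝ) ∈ Set.Icc (0 : ℝ) 1 := by simp
  have hL0 := hL 0 m0
  rw [add_zero] at hL0
  have hM : thetaMass θ (𝓕 (fun x => u x (t₀ + 0))) ≤ ENNReal.ofReal C₀ := by
    rw [thetaMass_eq_ofReal hθ hs1 hN (hA 0 m0), ← hL 0 m0, add_zero]
    exact ENNReal.ofReal_le_ofReal h0
  obtain ⟨hX, hW⟩ := H N hN θ hθ _ hU hM
  have hfin := hU.weighted_sub_le hθ hs1 hN hδ.le hδ1 hC₁.le hX hW
  rw [← hL δ ⟨hδ.le, hδ1⟩, ← hL 0 m0, add_zero] at hfin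
  refine hfin.trans (mul_le_mul_of_nonneg_left ?_ (by positivity))
  rw [one_div, ← Real.rpow_neg_one]
  exact Real.rpow_le_rpow_of_exponent_le (by linarith) (by linarith)
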